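/- For every integer n ≥ 3, the inequality N2(1,10,n) + N2(2,10,n) > N2(3,10,n) + N2(4,10,n) holds. -/

import Mathlib

open scoped Classical

/-- The M2-rank of a partition: ⌈ℓ/2⌉ − s, where ℓ is the largest part
(0 for the empty partition) and s is the number of parts. -/
def m2Rank {n : ℕ} (P : n.Partition) : ℤ :=
  (((P.parts.sup + 1) / 2 : ℕ) : ℤ) - (Multiset.card P.parts : ℤ)

/-- A partition has no repeated odd parts. -/
def NoRepeatedOddParts {n : ℕ} (P : n.Partition) : Prop :=
  ∀ j : ℕ, Odd j → P.parts.count j ≤ 1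

/-- `N2 r m n` is the number of partitions of `n` without repeated odd parts whose
M2-rank is congruent to `r` modulo `m`. -/
noncomputable def N2 (r : ℤ) (m n : ℕ) : ℕ :=
  Nat.card {P : n.Partition // NoRepeatedOddParts P ∧ m2Rank P ≡ r [ZMOD (m : ℤ)]}

def tri (n : ℤ) : ℤ := n * (n - 1) / 2

lemma two_tri (n : ℤ) : 2 * tri n = n * (n - 1) := by
  unfold tri
  have : (2 : ℤ) ∣ n * (n - 1) := by
    rcases Int.even_or_odd n with h | h
    · exact h.two_dvd.mul_right _
    · exact (h.sub_odd odd_one).two_dvd.mul_left _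
  exact Int.mul_ediv_cancel' this

lemma tri_of {n m : ℤ} (h : 2 * m = n * (n - 1)) : tri n = m := by
  have := two_tri n; omega

lemma tri_cast (n : ℤ) : ((tri n : ℤ) : ℝ) = (n : ℝ) * (n - 1) / 2 := by
  have := two_tri n
  have h : ((2 * tri n : ℤ) : ℝ) = ((n * (n - 1) : ℤ) : ℝ) := by rw [this]
  push_cast at h; linarith

lemma tri_succ (n : ℤ) : tri (n + 1) = tri n + n := by
  apply tri_of; have := two_tri n; linear_combination this

lemma tri_one_sub (n : ℤ) : tri (1 - n) = tri n := by
  apply tri_of; have := two_tri n; linear_combination this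

lemma tri_neg (n : ℤ) : tri (-n) = tri n + n := by
  apply tri_of; have := two_tri n; linear_combination this

lemma zpow_exp {p : ℝ} (hp : 0 < p) (n : ℤ) : p ^ n = Real.exp (n * Real.log p) := by
  rw [← Real.rpow_intCast, Real.rpow_def_of_pos hp, mul_comm]

/-- term of the theta series -/
noncomputable def jt (p z : ℝ) (n : ℤ) : ℝ := (-1) ^ n * p ^ (tri n) * z ^ n

noncomputable def j (p z : ℝ) : ℝ := ∑' n : ℤ, jt p z n

lemma jt_ne {p z : ℝ} (hp : 0 < p) (hz : z ≠ 0) (n : ℤ) : jt p z n ≠ 0 := by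
  unfold jt
  have := (zpow_pos hp (tri n)).ne'
  have h2 := zpow_ne_zero n hz
  have h3 : ((-1 : ℝ)) ^ n ≠ 0 := zpow_ne_zero n (by norm_num)
  positivity

lemma jt_succ {p z : ℝ} (hp : 0 < p) (hz : z ≠ 0) (n : ℤ) :
    jt p z (n + 1) = -(p ^ n * z) * jt p z n := by
  unfold jt
  rw [tri_succ, zpow_add₀ hp.ne', zpow_add₀ hz, zpow_add₀ (by norm_num : (-1 : ℝ) ≠ 0)]
  simp; ring

lemma jt_one_sub {p z : ℝ} (hp : 0 < p) (hz : z ≠ 0) (n : ℤ) :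
    jt p (p / z) n = jt p z (-n) := by
  unfold jt
  rw [tri_neg, zpow_add₀ hp.ne', div_zpow, zpow_neg, zpow_neg]
  have h3 : ((-1 : ℝ)) ^ n ≠ 0 := zpow_ne_zero n (by norm_num)
  have h4 : ((-1 : ℝ)) ^ n * (-1)^n = 1 := by
    rw [← mul_zpow]; simp
  have : ((-1 : ℝ) ^ n)⁻¹ = (-1)^n := by
    field_simp; rw [sq]; exact h4.symm
  rw [this]; field_simp

lemma jt_summable_nat {p z : ℝ} (hp : 0 < p) (hp1 : p < 1) (hz : z ≠ 0) :
    Summable (fun n : ℕ => jt p z n) := by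
  apply summable_of_ratio_test_tendsto_lt_one (l := 0) (by norm_num)
  · exact Filter.Eventually.of_forall fun n => jt_ne hp hz n
  · have h : ∀ n : ℕ, ‖jt p z ((n + 1 : ℕ) : ℤ)‖ / ‖jt p z n‖ = p ^ n * |z| := by
      intro n
      have := jt_succ hp hz (n : ℤ)
      push_cast
      rw [this, norm_mul, mul_div_assoc, div_self (norm_ne_zero_iff.2 (jt_ne hp hz n))]
      simp [abs_of_pos hp]
    simp_rw [h]
    have := (tendsto_pow_atTop_nhds_zero_of_lt_one hp.le hp1).mul_const |z|
    simpa using this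

lemma jt_summable {p z : ℝ} (hp : 0 < p) (hp1 : p < 1) (hz : z ≠ 0) :
    Summable (jt p z) := by
  apply Summable.of_nat_of_neg (jt_summable_nat hp hp1 hz)
  have := jt_summable_nat hp hp1 (z := p / z) (by positivity)
  simpa [jt_one_sub hp hz] using this

lemma jt_hasSum {p z : ℝ} (hp : 0 < p) (hp1 : p < 1) (hz : z ≠ 0) :
    HasSum (jt p z) (j p z) := (jt_summable hp hp1 hz).hasSum

lemma jt_norm {p z : ℝ} (n : ℤ) : ‖jt p z n‖ = |p| ^ tri n * |z| ^ n := by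
  unfold jt; simp

lemma jt_mul_p {p z : ℝ} (hp : 0 < p) (hz : z ≠ 0) (n : ℤ) :
    jt p (p * z) n = -z⁻¹ * jt p z (n + 1) := by
  rw [jt_succ hp hz]; unfold jt; rw [mul_zpow]; field_simp

lemma j_mul_p {p z : ℝ} (hp : 0 < p) (hz : z ≠ 0) :
    j p (p * z) = -z⁻¹ * j p z := by
  unfold j
  simp_rw [jt_mul_p hp hz]
  rw [tsum_mul_left]; congr 1; exact (Equiv.addRight (1 : ℤ)).tsum_eq (jt p z)

lemma j_inv_p {p z : ℝ} (hp : 0 < p) (hz : z ≠ 0) :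
    j p (p / z) = j p z := by
  unfold j
  simp_rw [jt_one_sub hp hz]
  exact (Equiv.neg ℤ).tsum_eq (jt p z)

lemma j_inv {p z : ℝ} (hp : 0 < p) (hz : z ≠ 0) :
    j p z⁻¹ = -z⁻¹ * j p z := by
  have h := j_mul_p hp (inv_ne_zero hz)
  rw [← div_eq_mul_inv, j_inv_p hp hz] at h
  rw [h]; field_simp

lemma j_one {p : ℝ} (hp : 0 < p) : j p 1 = 0 := by
  have := j_inv hp one_ne_zero
  simp at this; linarith

/-- parity splitting of a double sum -/
def parEquiv : (ℤ × ℤ) ⊕ (ℤ × ℤ) ≃ ℤ × ℤ where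
  toFun := Sum.elim (fun a => (a.1 - a.2, a.1 + a.2)) (fun a => (a.1 - a.2 + 1, a.1 + a.2))
  invFun := fun b => if (b.1 + b.2) % 2 = 0 then Sum.inl ((b.1 + b.2) / 2, (b.2 - b.1) / 2)
    else Sum.inr ((b.1 + b.2) / 2, (b.2 - b.1 + 1) / 2)
  left_inv := by
    rintro (⟨s, t⟩ | ⟨s, t⟩)
    · have h : (s - t + (s + t)) % 2 = 0 := by omega
      simp only [Sum.elim_inl, h, if_true]
      congr 2 <;> omega
    · have h : ¬ (s - t + 1 + (s + t)) % 2 = 0 := by omega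
      simp only [Sum.elim_inr, h, if_false]
      congr 2 <;> omega
  right_inv := by
    rintro ⟨m, n⟩
    dsimp only
    split_ifs with h
    · simp only [Sum.elim_inl, Prod.mk.injEq]; omega
    · simp only [Sum.elim_inr, Prod.mk.injEq]; omega

lemma tsum_par {f : ℤ × ℤ → ℝ} (hf : Summable f) :
    ∑' a, f a = ∑' a : ℤ × ℤ, f (a.1 - a.2, a.1 + a.2) +
      ∑' a : ℤ × ℤ, f (a.1 - a.2 + 1, a.1 + a.2) := by
  rw [← parEquiv.tsum_eq f]
  have h := (parEquiv.summable_iff (f := f)).2 hf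
  exact Summable.tsum_sum (f := f ∘ parEquiv)
    (h.comp_injective Sum.inl_injective) (h.comp_injective Sum.inr_injective)

lemma neg_one_zpow_mul_self (n : ℤ) : ((-1 : ℝ)) ^ n * (-1)^n = 1 := by
  rw [← mul_zpow]; simp

lemma j_mul_j {p x y p' : ℝ} (hp : 0 < p) (hp1 : p < 1) (hp' : 0 < p') (hp1' : p' < 1)
    (hx : x ≠ 0) (hy : y ≠ 0) :
    Summable (fun a : ℤ × ℤ => jt p x a.1 * jt p' y a.2) ∧
    j p x * j p' y = ∑' a : ℤ × ℤ, jt p x a.1 * jt p' y a.2 := by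
  have h1 := (jt_summable hp hp1 hx).norm
  have h2 := (jt_summable hp' hp1' hy).norm
  exact ⟨summable_mul_of_summable_norm h1 h2, tsum_mul_tsum_of_summable_norm h1 h2⟩

lemma jt_neg {p z : ℝ} (n : ℤ) : jt p (-z) n = p ^ tri n * z ^ n := by
  unfold jt; rw [← neg_one_mul z, mul_zpow]
  have := neg_one_zpow_mul_self n
  linear_combination (p ^ tri n * z ^ n) * this

lemma T2 {p x y : ℝ} (hp : 0 < p) (hp1 : p < 1) (hx : x ≠ 0) (hy : y ≠ 0) :
    j p x * j p y = j (p^2) (-(x*y)) * j (p^2) (-(p*y/x))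
      - x * (j (p^2) (-(p*x*y)) * j (p^2) (-(y/x))) := by
  have hp2 : 0 < p ^ 2 := by positivity
  have hp21 : p ^ 2 < 1 := by nlinarith
  obtain ⟨s, e⟩ := j_mul_j hp hp1 hp hp1 hx hy
  rw [e, tsum_par s]
  rw [(j_mul_j hp2 hp21 hp2 hp21 (by simp [hx, hy] : -(x*y) ≠ 0) (by simp [hx,hy,hp.ne'] : -(p*y/x) ≠ 0)).2,
    (j_mul_j hp2 hp21 hp2 hp21 (by simp [hx, hy,hp.ne'] : -(p*x*y) ≠ 0) (by simp [hx,hy] : -(y/x) ≠ 0)).2, ← tsum_mul_left, sub_eq_add_neg, ← tsum_neg]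
  have sg : ∀ s t : ℤ, ((-1 : ℝ))^(s-t) * (-1)^(s+t) = 1 := by
    intro s t
    rw [zpow_sub₀ (by norm_num), zpow_add₀ (by norm_num)]
    have h1 := neg_one_zpow_mul_self s
    have h3 : ((-1 : ℝ)) ^ t ≠ 0 := zpow_ne_zero t (by norm_num)
    field_simp; rw [sq]; exact h1
  congr 1
  · apply tsum_congr
    rintro ⟨s, t⟩
    simp only [jt_neg]
    have e1 : p ^ tri (s - t) * p ^ tri (s + t) = (p^2)^tri s * ((p^2)^tri t * p ^ t) := by
      simp only [zpow_exp hp, zpow_exp hp2, ← Real.exp_add, Real.log_pow, tri_cast]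
      congr 1; push_cast; ring
    unfold jt
    have e2 : x ^ (s - t) * y ^ (s+t) = (x*y)^s * (y/x)^t := by
      rw [zpow_sub₀ hx, zpow_add₀ hy, mul_zpow, div_zpow]; field_simp
    have e3 : (p * y / x)^t = p ^ t * (y/x)^t := by rw [mul_div_assoc, mul_zpow]
    rw [e3]
    linear_combination (p ^ tri (s - t) * p ^ tri (s + t) * x ^ (s - t) * y ^ (s+t)) * sg s t
      + (x ^ (s - t) * y ^ (s+t)) * e1 + ((p^2)^tri s * ((p^2)^tri t * p ^ t)) * e2
  · apply tsum_congr
    rintro ⟨s, t⟩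
    simp only [jt_neg]
    have e1 : p ^ tri (s - t + 1) * p ^ tri (s + t) = (p^2)^tri s * p ^ s * ((p^2)^tri t) := by
      simp only [zpow_exp hp, zpow_exp hp2, ← Real.exp_add, Real.log_pow, tri_cast]
      congr 1; push_cast; ring
    unfold jt
    have e2 : x ^ (s - t + 1) * y ^ (s+t) = x * (x*y)^s * (y/x)^t := by
      rw [zpow_add₀ hx, zpow_sub₀ hx, zpow_add₀ hy, mul_zpow, div_zpow]; field_simp
    have e3 : (p * x * y)^s = p ^ s * (x*y)^s := by rw [mul_assoc, mul_zpow]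
    have e4 : ((-1 : ℝ))^(s-t+1) = - (-1) ^ (s-t) := by
      rw [zpow_add₀ (by norm_num)]; simp
    rw [e3, e4]
    linear_combination (-p ^ tri (s - t + 1) * p ^ tri (s + t) * x ^ (s - t + 1) * y ^ (s+t)) * sg s t
      - (x ^ (s - t + 1) * y ^ (s+t)) * e1 - ((p^2)^tri s * p ^ s * ((p^2)^tri t )) * e2

open Filter Topology

/-- finite q-Pochhammer -/
noncomputable def pocN (p a : ℝ) (N : ℕ) : ℝ := ∏ i ∈ Finset.range N, (1 - a * p ^ i)
/-- infinite q-Pochhammer -/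
noncomputable def poc (p a : ℝ) : ℝ := ∏' i : ℕ, (1 - a * p ^ i)

lemma poc_multipliable {p : ℝ} (hp : 0 < p) (hp1 : p < 1) (a : ℝ) :
    Multipliable (fun i : ℕ => 1 - a * p ^ i) := by
  simp_rw [sub_eq_add_neg]
  apply multipliable_one_add_of_summable
  simp only [norm_neg, norm_mul, norm_pow]
  apply Summable.mul_left
  apply summable_geometric_of_lt_one (norm_nonneg _)
  simpa [abs_of_pos hp] using hp1

lemma poc_tendsto {p : ℝ} (hp : 0 < p) (hp1 : p < 1) (a : ℝ) :
    Tendsto (pocN p a) atTop (𝓝 (poc p a)) :=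
  (poc_multipliable hp hp1 a).hasProd.tendsto_prod_nat

lemma pocN_succ (p a : ℝ) (N : ℕ) : pocN p a (N + 1) = pocN p a N * (1 - a * p ^ N) := by
  unfold pocN; rw [Finset.prod_range_succ]

lemma pocN_pos {p a : ℝ} (hp : 0 < p) (hp1 : p < 1) (ha : a < 1) (N : ℕ) : 0 < pocN p a N := by
  apply Finset.prod_pos
  intro i _
  have h1 : p ^ i ≤ 1 := pow_le_one₀ hp.le hp1.le
  have h2 : 0 < p ^ i := by positivity
  nlinarith

lemma poc_ne_zero {p a : ℝ} (hp : 0 < p) (hp1 : p < 1) (ha : a < 1) : poc p a ≠ 0 := by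
  unfold poc
  simp_rw [sub_eq_add_neg]
  apply tprod_one_add_ne_zero_of_summable
  · intro i
    have h1 : p ^ i ≤ 1 := pow_le_one₀ hp.le hp1.le
    have h2 : 0 < p ^ i := by positivity
    nlinarith
  · simp only [norm_neg, norm_mul, norm_pow]
    apply Summable.mul_left
    apply summable_geometric_of_lt_one (norm_nonneg _)
    simpa [abs_of_pos hp] using hp1

lemma poc_pos {p a : ℝ} (hp : 0 < p) (hp1 : p < 1) (ha : a < 1) : 0 < poc p a := by
  have h := ge_of_tendsto' (poc_tendsto hp hp1 a) (fun N => (pocN_pos hp hp1 ha N).le)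
  exact lt_of_le_of_ne h (poc_ne_zero hp hp1 ha).symm

lemma pocN_anti {p a : ℝ} (hp : 0 < p) (hp1 : p < 1) (ha0 : 0 ≤ a) (ha : a < 1) : Antitone (pocN p a) := by
  apply antitone_nat_of_succ_le
  intro n
  rw [pocN_succ]
  have := pocN_pos hp hp1 ha n
  have h2 : 0 < p ^ n := by positivity
  nlinarith [mul_nonneg ha0 h2.le]

lemma poc_le {p a : ℝ} (hp : 0 < p) (hp1 : p < 1) (ha0 : 0 ≤ a) (ha : a < 1) (N : ℕ) :
    poc p a ≤ pocN p a N :=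
  (pocN_anti hp hp1 ha0 ha).le_of_tendsto (poc_tendsto hp hp1 a) N

/-- reciprocal of (p;p)_k, zero for negative k -/
noncomputable def rp (p : ℝ) (k : ℤ) : ℝ := if 0 ≤ k then (pocN p p k.toNat)⁻¹ else 0

lemma rp_rec {p : ℝ} (hp : 0 < p) (hp1 : p < 1) (k : ℤ) :
    rp p (k - 1) = rp p k * (1 - p ^ k) := by
  unfold rp
  rcases lt_trichotomy k 0 with h | h | h
  · rw [if_neg (by omega), if_neg (by omega)]; simp
  · subst h; simp
  · obtain ⟨m, rfl⟩ : ∃ m : ℕ, k = m + 1 := ⟨(k-1).toNat, by omega⟩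
    rw [if_pos (by omega), if_pos (by omega)]
    have : ((m : ℤ) + 1 - 1).toNat = m := by omega
    rw [this]
    have : ((m : ℤ) + 1).toNat = m + 1 := by omega
    rw [this, pocN_succ]
    have h1 := (pocN_pos hp hp1 hp1 m).ne'
    have h2 : 1 - p * p ^ m ≠ 0 := by
      have h1 : p ^ m ≤ 1 := pow_le_one₀ hp.le hp1.le
      have h2 : 0 < p ^ m := by positivity
      nlinarith
    have h3 : p ^ ((m : ℤ) + 1) = p * p ^ m := by
      rw [zpow_add₀ hp.ne']; simp; ring
    rw [h3]; field_simp

lemma rp_nonneg {p : ℝ} (hp : 0 < p) (hp1 : p < 1) (k : ℤ) : 0 ≤ rp p k := by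
  unfold rp; split_ifs
  · exact (inv_pos.2 (pocN_pos hp hp1 hp1 _)).le
  · rfl

lemma rp_le {p : ℝ} (hp : 0 < p) (hp1 : p < 1) (k : ℤ) : rp p k ≤ (poc p p)⁻¹ := by
  unfold rp; split_ifs
  · exact inv_anti₀ (poc_pos hp hp1 hp1) (poc_le hp hp1 hp.le hp1 _)
  · exact (inv_pos.2 (poc_pos hp hp1 hp1)).le

lemma rp_tendsto {p : ℝ} (hp : 0 < p) (hp1 : p < 1) (n : ℤ) :
    Tendsto (fun N : ℕ => rp p (N + n)) atTop (𝓝 (poc p p)⁻¹) := by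
  have h : Tendsto (fun N : ℕ => (pocN p p ((N : ℤ) + n).toNat)⁻¹) atTop (𝓝 (poc p p)⁻¹) := by
    apply Tendsto.inv₀ _ (poc_pos hp hp1 hp1).ne'
    apply (poc_tendsto hp hp1 p).comp
    apply tendsto_atTop.2
    intro b
    filter_upwards [eventually_ge_atTop (b + n.natAbs)] with N hN
    omega
  apply h.congr'
  filter_upwards [eventually_ge_atTop (n.natAbs)] with N hN
  unfold rp; rw [if_pos (by omega)]

noncomputable def bb (p : ℝ) (N : ℕ) (n : ℤ) : ℝ := rp p (N + n) * rp p (N - n)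

lemma bb_nonneg {p : ℝ} (hp : 0 < p) (hp1 : p < 1) (N : ℕ) (n : ℤ) : 0 ≤ bb p N n :=
  mul_nonneg (rp_nonneg hp hp1 _) (rp_nonneg hp hp1 _)

lemma bb_le {p : ℝ} (hp : 0 < p) (hp1 : p < 1) (N : ℕ) (n : ℤ) : bb p N n ≤ (poc p p)⁻¹ * (poc p p)⁻¹ :=
  mul_le_mul (rp_le hp hp1 _) (rp_le hp hp1 _) (rp_nonneg hp hp1 _) (inv_pos.2 (poc_pos hp hp1 hp1)).le

lemma bb_tendsto {p : ℝ} (hp : 0 < p) (hp1 : p < 1) (n : ℤ) :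
    Tendsto (fun N : ℕ => bb p N n) atTop (𝓝 ((poc p p)⁻¹ * (poc p p)⁻¹)) := by
  apply (rp_tendsto hp hp1 n).mul
  simpa [sub_eq_add_neg] using rp_tendsto hp hp1 (-n)

lemma bb_norm {p : ℝ} (hp : 0 < p) (hp1 : p < 1) (N : ℕ) (n : ℤ) (x : ℝ) :
    ‖bb p N n * x‖ ≤ (poc p p)⁻¹ * (poc p p)⁻¹ * ‖x‖ := by
  rw [norm_mul, Real.norm_of_nonneg (bb_nonneg hp hp1 N n)]
  exact mul_le_mul_of_nonneg_right (bb_le hp hp1 N n) (norm_nonneg _)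

lemma bb_summable {p : ℝ} (hp : 0 < p) (hp1 : p < 1) (N : ℕ) {f : ℤ → ℝ} (hf : Summable f) :
    Summable (fun n => bb p N n * f n) :=
  Summable.of_norm_bounded (hf.norm.mul_left _) (fun n => bb_norm hp hp1 N n (f n))

lemma bb_lim {p : ℝ} (hp : 0 < p) (hp1 : p < 1) {f : ℤ → ℝ} (hf : Summable f) :
    Tendsto (fun N : ℕ => ∑' n, bb p N n * f n) atTop (𝓝 ((poc p p)⁻¹ * (poc p p)⁻¹ * ∑' n, f n)) := by
  rw [← tsum_mul_left]
  apply tendsto_tsum_of_dominated_convergence (hf.norm.mul_left ((poc p p)⁻¹ * (poc p p)⁻¹))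
  · intro n
    exact (bb_tendsto hp hp1 n).mul_const _
  · exact Eventually.of_forall fun N n => bb_norm hp hp1 N n (f n)

lemma bb_rec {p : ℝ} (hp : 0 < p) (hp1 : p < 1) (N : ℕ) (n : ℤ) :
    (1 + p ^ (2 * N + 1)) * bb p N n + p ^ N * p ^ (1 - n) * bb p N (n - 1)
      + p ^ (N + 1) * p ^ n * bb p N (n + 1) =
    (1 - p ^ (2 * N + 1)) * (1 - p ^ (2 * N + 2)) * bb p (N + 1) n := by
  unfold bb
  push_cast
  have e1 := rp_rec hp hp1 (N + 1 + n)
  have e2 := rp_rec hp hp1 (N + n)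
  have e3 := rp_rec hp hp1 (N + 1 - n)
  have e4 := rp_rec hp hp1 (N - n)
  rw [show (N : ℤ) + 1 + n - 1 = N + n by ring] at e1
  rw [show (N : ℤ) + 1 - n - 1 = N - n by ring] at e3
  rw [show (N : ℤ) + n - 1 = N + (n - 1) by ring] at e2
  rw [show (N : ℤ) - n - 1 = N - (n + 1) by ring] at e4
  rw [show (N : ℤ) - (n - 1) = N + 1 - n by ring, show (N : ℤ) + (n + 1) = N + 1 + n by ring,
    e2, e4, e1, e3]
  have hn := (zpow_pos hp n).ne'
  have f1 : p ^ ((N : ℤ) + 1 + n) = p ^ N * p * p ^ n := by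
    rw [zpow_add₀ hp.ne', zpow_add₀ hp.ne']; simp
  have f2 : p ^ ((N : ℤ) + 1 - n) = p ^ N * p / p ^ n := by
    rw [zpow_sub₀ hp.ne', zpow_add₀ hp.ne']; simp
  have f3 : p ^ ((N : ℤ) + n) = p ^ N * p ^ n := by
    rw [zpow_add₀ hp.ne']; simp
  have f4 : p ^ ((N : ℤ) - n) = p ^ N / p ^ n := by
    rw [zpow_sub₀ hp.ne']; simp
  have f5 : p ^ (1 - n) = p / p ^ n := by
    rw [zpow_sub₀ hp.ne']; simp
  rw [f1, f2, f3, f4, f5]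
  rw [pow_succ p (2 * N + 1), pow_succ p (2 * N), pow_succ p N, pow_mul', sq]
  field_simp
  ring

lemma bb_zero_summable {p : ℝ} (N : ℕ) (f : ℤ → ℝ) : Summable (fun n => bb p N n * f n) := by
  apply summable_of_ne_finset_zero (s := Finset.Icc (-(N : ℤ)) N)
  intro n hn
  have : bb p N n = 0 := by
    unfold bb rp
    simp only [Finset.mem_Icc] at hn
    by_cases h : (0 : ℤ) ≤ N + n
    · rw [if_neg (by omega : ¬ (0 : ℤ) ≤ N - n)]; simp
    · rw [if_neg h]; simp
  rw [this, zero_mul]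

/-- basic recurrence for weighted sums -/
lemma bb_sum_rec {p : ℝ} (hp : 0 < p) (hp1 : p < 1) (N : ℕ) (f : ℤ → ℝ) :
    (1 - p ^ (2 * N + 1)) * (1 - p ^ (2 * N + 2)) * ∑' n, bb p (N + 1) n * f n =
    ∑' n, bb p N n * ((1 + p ^ (2 * N + 1)) * f n + p ^ N * p ^ (-n) * f (n + 1)
      + p ^ (N + 1) * p ^ (n - 1) * f (n - 1)) := by
  rw [← tsum_mul_left]
  have h1 : ∀ n, (1 - p ^ (2 * N + 1)) * (1 - p ^ (2 * N + 2)) * (bb p (N + 1) n * f n) =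
    (bb p N n * ((1 + p ^ (2 * N + 1)) * f n) + bb p N (n - 1) * (p ^ N * p ^ (1 - n) * f n))
      + bb p N (n + 1) * (p ^ (N + 1) * p ^ n * f n) := by
    intro n
    linear_combination (-f n) * bb_rec hp hp1 N n
  simp_rw [h1]
  have s1 := bb_zero_summable (p := p) N (fun n => ((1 + p ^ (2 * N + 1)) * f n))
  have s2' := bb_zero_summable (p := p) N (fun n => p ^ N * p ^ (-n) * f (n + 1))
  have s3' := bb_zero_summable (p := p) N (fun n => p ^ (N + 1) * p ^ (n - 1) * f (n - 1))
  have e2 : ∀ n : ℤ, bb p N (n - 1) * (p ^ N * p ^ (1 - n) * f n) =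
     (fun n => bb p N n * (p ^ N * p ^ (-n) * f (n + 1))) (Equiv.subRight (1 : ℤ) n) := by
    intro n; simp
  have e3 : ∀ n : ℤ, bb p N (n + 1) * (p ^ (N + 1) * p ^ n * f n) =
     (fun n => bb p N n * (p ^ (N + 1) * p ^ (n - 1) * f (n - 1))) (Equiv.addRight (1 : ℤ) n) := by
    intro n; simp
  have t2 := ((Equiv.subRight (1 : ℤ)).hasSum_iff).2 s2'.hasSum
  have t3 := ((Equiv.addRight (1 : ℤ)).hasSum_iff).2 s3'.hasSum
  have t := (s1.hasSum.add t2).add t3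
  rw [← Summable.tsum_add s1 s2', ← Summable.tsum_add (s1.add s2') s3'] at t
  simp_rw [e2, e3]
  refine (t.tsum_eq).trans ?_
  apply tsum_congr
  intro n; ring

lemma bb_zero_left {p : ℝ} (f : ℤ → ℝ) : ∑' n, bb p 0 n * f n = f 0 := by
  rw [tsum_eq_single 0]
  · simp [bb, rp, pocN]
  · intro n hn
    have : bb p 0 n = 0 := by
      unfold bb rp
      by_cases h : (0 : ℤ) ≤ n
      · rw [if_neg (by push_cast; omega : ¬ (0 : ℤ) ≤ ((0 : ℕ) : ℤ) - n)]; simp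
      · rw [if_neg (by push_cast; omega)]; simp
    rw [this, zero_mul]

lemma jt_pred {p z : ℝ} (hp : 0 < p) (hz : z ≠ 0) (n : ℤ) :
    p ^ (n - 1) * jt p z (n - 1) = - z⁻¹ * jt p z n := by
  have := jt_succ hp hz (n - 1)
  rw [sub_add_cancel] at this
  rw [this]; field_simp

lemma jt_succ' {p z : ℝ} (hp : 0 < p) (hz : z ≠ 0) (n : ℤ) :
    p ^ (-n) * jt p z (n + 1) = - z * jt p z n := by
  rw [jt_succ hp hz, zpow_neg]
  have := (zpow_pos hp n).ne'
  field_simp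

lemma pocN2 {p : ℝ} (N : ℕ) : pocN p p (2 * (N + 1)) =
    pocN p p (2 * N) * ((1 - p ^ (2 * N + 1)) * (1 - p ^ (2 * N + 2))) := by
  rw [show 2 * (N + 1) = 2 * N + 1 + 1 by ring, pocN_succ, pocN_succ]; ring

/-- finite Jacobi triple product -/
lemma fin_jtp {p z : ℝ} (hp : 0 < p) (hp1 : p < 1) (hz : z ≠ 0) (N : ℕ) :
    pocN p z N * pocN p (p / z) N = pocN p p (2 * N) * ∑' n, bb p N n * jt p z n := by
  induction N with
  | zero => rw [bb_zero_left]; simp [pocN, jt, tri]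
  | succ N ih =>
    rw [pocN2, mul_assoc, bb_sum_rec hp hp1]
    have h : ∀ n : ℤ, bb p N n * ((1 + p ^ (2 * N + 1)) * jt p z n + p ^ N * p ^ (-n) * jt p z (n + 1)
      + p ^ (N + 1) * p ^ (n - 1) * jt p z (n - 1)) =
      ((1 - z * p ^ N) * (1 - p / z * p ^ N)) * (bb p N n * jt p z n) := by
      intro n
      have e1 := jt_succ' hp hz n
      have e2 := jt_pred hp hz n
      have : (1 - z * p ^ N) * (1 - p / z * p ^ N) = (1 + p ^ (2 * N + 1)) - z * p ^ N - z⁻¹ * p ^ (N + 1) := by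
        field_simp; ring
      rw [this]
      linear_combination (bb p N n * p ^ N) * e1 + (bb p N n * p ^ (N + 1)) * e2
    simp_rw [h]
    rw [tsum_mul_left, pocN_succ, pocN_succ]
    linear_combination (1 - z * p ^ N) * (1 - p / z * p ^ N) * ih

lemma tendsto_two_mul : Tendsto (fun N : ℕ => 2 * N) atTop atTop :=
  tendsto_atTop.2 fun b => by
    filter_upwards [eventually_ge_atTop b] with N hN; omega

lemma jtp {p z : ℝ} (hp : 0 < p) (hp1 : p < 1) (hz : z ≠ 0) :
    j p z = poc p p * poc p z * poc p (p / z) := by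
  have h1 := (poc_tendsto hp hp1 z).mul (poc_tendsto hp hp1 (p / z))
  have h2 := ((poc_tendsto hp hp1 p).comp tendsto_two_mul).mul (bb_lim hp hp1 (jt_summable hp hp1 hz))
  have h3 := tendsto_nhds_unique h1 (h2.congr fun N => (fin_jtp hp hp1 hz N).symm)
  have := (poc_pos hp hp1 hp1).ne'
  unfold j
  rw [mul_assoc, h3]; field_simp

/-- (p;p)^3 as a series -/
noncomputable def J3 (p : ℝ) : ℝ := - ∑' n : ℤ, n * jt p 1 n

lemma fin_J3 {p : ℝ} (hp : 0 < p) (hp1 : p < 1) (N : ℕ) :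
    pocN p p N * pocN p p (N + 1) = - (pocN p p (2 * (N + 1)) * ∑' n : ℤ, bb p (N + 1) n * (n * jt p 1 n)) := by
  have key : ∀ N : ℕ, (1 - p ^ (2 * N + 1)) * (1 - p ^ (2 * N + 2)) * ∑' n : ℤ, bb p (N + 1) n * (n * jt p 1 n)
     = (1 - p ^ N) * (1 - p ^ (N + 1)) * (∑' n : ℤ, bb p N n * (n * jt p 1 n)) +
       (p ^ (N + 1) - p ^ N) * (∑' n : ℤ, bb p N n * jt p 1 n) := by
    intro N
    rw [bb_sum_rec hp hp1, ← tsum_mul_left, ← tsum_mul_left, ← Summable.tsum_add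
      ((bb_zero_summable N _).mul_left _) ((bb_zero_summable N _).mul_left _)]
    apply tsum_congr
    intro n
    have e1 := jt_succ' hp one_ne_zero n
    have e2 := jt_pred hp one_ne_zero n
    push_cast
    have : p ^ (2 * N + 1) = p ^ N * p ^ (N + 1) := by ring
    rw [this]
    linear_combination (bb p N n * p ^ N * (n + 1)) * e1 + (bb p N n * p ^ (N + 1) * (n - 1)) * e2
  induction N with
  | zero =>
    rw [pocN2, mul_assoc, key, bb_zero_left, bb_zero_left]
    simp [pocN, jt, tri]
  | succ N ih =>
    have h0 := fin_jtp hp hp1 one_ne_zero (N + 1)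
    have hz : pocN p 1 (N + 1) = 0 := by
      unfold pocN; apply Finset.prod_eq_zero (i := 0) <;> simp
    rw [hz, zero_mul] at h0
    have h1 := (mul_eq_zero.1 h0.symm).resolve_left (pocN_pos hp hp1 hp1 _).ne'
    rw [pocN2, mul_assoc, key, h1, pocN_succ p p (N + 1), pocN_succ p p N]
    rw [pocN_succ p p N] at ih
    linear_combination (1 - p ^ (N + 1)) * (1 - p ^ (N + 1 + 1)) * ih

lemma jt_n_summable {p z : ℝ} (hp : 0 < p) (hp1 : p < 1) (hz : z ≠ 0) :
    Summable (fun n : ℤ => n * jt p z n) := by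
  have a1 := (jt_summable hp hp1 (z := 2 * z) (by positivity)).norm
  have a2 := (jt_summable hp hp1 (z := z / 2) (by positivity)).norm
  apply Summable.of_norm_bounded (a1.add a2)
  intro n
  simp only [jt_norm, norm_mul, abs_mul, abs_div, mul_zpow, div_zpow]
  have h : ‖(n : ℝ)‖ ≤ |(2 : ℝ)| ^ n + (|(2 : ℝ)| ^ n)⁻¹ := by
    rw [abs_two, Real.norm_eq_abs]
    have h0 : ∀ m : ℕ, (m : ℝ) ≤ 2 ^ m := fun m => by exact_mod_cast Nat.lt_two_pow_self.le
    rcases Int.le_total 0 n with h | h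
    · obtain ⟨m, rfl⟩ := Int.eq_ofNat_of_zero_le h
      have := h0 m
      have h3 : (0 : ℝ) < (2 ^ m)⁻¹ := by positivity
      simp; linarith
    · obtain ⟨m, rfl⟩ : ∃ m : ℕ, n = -m := ⟨n.natAbs, by omega⟩
      have := h0 m
      have h3 : (0 : ℝ) < (2 ^ m)⁻¹ := by positivity
      simp; linarith
  have h2 : 0 ≤ |p| ^ tri n * |z| ^ n := by positivity
  calc _ ≤ (|(2 : ℝ)| ^ n + (|(2 : ℝ)| ^ n)⁻¹) * (|p| ^ tri n * |z| ^ n) := mul_le_mul_of_nonneg_right h h2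
    _ = _ := by ring

lemma J3_eq {p : ℝ} (hp : 0 < p) (hp1 : p < 1) : J3 p = poc p p ^ 3 := by
  have h1 := (poc_tendsto hp hp1 p).mul ((tendsto_add_atTop_iff_nat 1).2 (poc_tendsto hp hp1 p))
  have h2 := (((poc_tendsto hp hp1 p).comp tendsto_two_mul).mul (bb_lim hp hp1 (jt_n_summable hp hp1 one_ne_zero))).neg
  have h2' := (tendsto_add_atTop_iff_nat 1).2 h2
  have h3 := tendsto_nhds_unique h1 (h2'.congr fun N => (fin_J3 hp hp1 N).symm)
  have := (poc_pos hp hp1 hp1).ne'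
  unfold J3
  field_simp at h3
  linarith

open Filter Topology

/-- tail sums -/
noncomputable def kapN (p : ℝ) (i : ℕ) : ℝ := - ∑' l : ℕ, jt p 1 ((l + i + 1 : ℕ) : ℤ)
noncomputable def kap (p : ℝ) (i : ℤ) : ℝ := kapN p i.natAbs

lemma jt_shift_summable {p : ℝ} (hp : 0 < p) (hp1 : p < 1) (i : ℕ) :
    Summable (fun l : ℕ => jt p 1 ((l + i : ℕ) : ℤ)) :=
  (summable_nat_add_iff (f := fun l : ℕ => jt p 1 (l : ℤ)) i).2 (jt_summable_nat hp hp1 one_ne_zero)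

lemma kapN_succ {p : ℝ} (hp : 0 < p) (hp1 : p < 1) (i : ℕ) :
    kapN p (i + 1) - kapN p i = jt p 1 ((i + 1 : ℕ) : ℤ) := by
  unfold kapN
  have h := jt_shift_summable hp hp1 (i + 1)
  have := h.tsum_eq_zero_add
  simp only [zero_add] at this
  simp only [← add_assoc] at this
  rw [this]
  have e : ∀ l : ℕ, l + (i + 1) + 1 = l + 1 + i + 1 := fun l => by ring
  simp_rw [e]; ring

lemma jt_one_one_sub {p : ℝ} (n : ℤ) : jt p 1 (1 - n) = - jt p 1 n := by
  unfold jt; rw [tri_one_sub]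
  have : ((-1 : ℝ)) ^ (1 - n) = - (-1) ^ n := by
    rw [zpow_sub₀ (by norm_num)]
    have h3 : ((-1 : ℝ)) ^ n ≠ 0 := zpow_ne_zero n (by norm_num)
    have := neg_one_zpow_mul_self n
    field_simp; simp [sq, this]
  rw [this]; simp

lemma kap_rec {p : ℝ} (hp : 0 < p) (hp1 : p < 1) (i : ℤ) :
    kap p i - kap p (i - 1) = jt p 1 i := by
  unfold kap
  rcases lt_or_ge 0 i with h | h
  · obtain ⟨m, rfl⟩ : ∃ m : ℕ, i = m + 1 := ⟨(i-1).toNat, by omega⟩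
    have := kapN_succ hp hp1 m
    rw [show ((m : ℤ) + 1).natAbs = m + 1 by omega, show ((m : ℤ) + 1 - 1).natAbs = m by omega, this]
    simp
  · obtain ⟨m, rfl⟩ : ∃ m : ℕ, i = -m := ⟨i.natAbs, by omega⟩
    have := kapN_succ hp hp1 m
    rw [show (-(m : ℤ)).natAbs = m by omega, show (-(m : ℤ) - 1).natAbs = m + 1 by omega]
    have e := jt_one_one_sub (p := p) (-m)
    rw [show (1 : ℤ) - -m = ((m + 1 : ℕ) : ℤ) by push_cast; ring] at e
    linarith

lemma tri_le_add {p : ℝ} (hp : 0 < p) (hp1 : p < 1) {a b : ℤ} (h : b ≤ a) : p ^ a ≤ p ^ b :=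
  zpow_le_zpow_right_of_le_one₀ hp hp1.le h

lemma kap_bound {p : ℝ} (hp : 0 < p) (hp1 : p < 1) (i : ℤ) :
    |kap p i| ≤ (1 - p)⁻¹ * p ^ tri i := by
  unfold kap kapN
  rw [abs_neg]
  set m := i.natAbs with hm
  have hb : ∀ l : ℕ, ‖jt p 1 ((l + m + 1 : ℕ) : ℤ)‖ ≤ p ^ tri i * p ^ l := by
    intro l
    rw [jt_norm, abs_of_pos hp]
    simp only [abs_one, one_zpow, mul_one]
    rw [← zpow_natCast p l, ← zpow_add₀ hp.ne']
    apply tri_le_add hp hp1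
    have h1 := two_tri i
    have h2 := two_tri ((l + m + 1 : ℕ) : ℤ)
    have : (m : ℤ) = i ∨ (m : ℤ) = -i := by omega
    have hm0 : (0 : ℤ) ≤ m := by omega
    have hl0 : (0 : ℤ) ≤ l := by omega
    push_cast at h2 ⊢
    rcases this with h | h
    · rw [← h] at h1 ⊢
      nlinarith [mul_nonneg hm0 hl0, mul_nonneg hl0 hl0]
    · have : i = -m := by omega
      rw [this] at h1 ⊢
      have : (l : ℤ) ≤ l * l := by exact_mod_cast Nat.le_mul_self l
      nlinarith [mul_nonneg hm0 hl0, mul_nonneg hl0 hl0]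
  have hg := (summable_geometric_of_lt_one hp.le hp1).mul_left (p ^ tri i)
  have := tsum_of_norm_bounded (hg.hasSum) hb
  rw [tsum_mul_left, tsum_geometric_of_lt_one hp.le hp1, mul_comm] at this
  exact this

noncomputable def kt (p w : ℝ) (i : ℤ) : ℝ := kap p i * w ^ i

lemma kt_norm {p : ℝ} (hp : 0 < p) (hp1 : p < 1) (w : ℝ) (i : ℤ) : ‖kt p w i‖ ≤ (1 - p)⁻¹ * ‖jt p w i‖ := by
  unfold kt
  rw [jt_norm, norm_mul, norm_zpow, abs_of_pos hp, ← mul_assoc]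
  exact mul_le_mul_of_nonneg_right (kap_bound hp hp1 i) (by positivity)

lemma kt_summable {p w : ℝ} (hp : 0 < p) (hp1 : p < 1) (hw : w ≠ 0) : Summable (kt p w) :=
  Summable.of_norm_bounded ((jt_summable hp hp1 hw).norm.mul_left _) (kt_norm hp hp1 w)

noncomputable def kapf (p w : ℝ) : ℝ := ∑' i, kt p w i

lemma jt_abs {p z : ℝ} (n : ℤ) : |jt p z n| = |p| ^ tri n * |z| ^ n := jt_norm n

lemma jt_kt {p w : ℝ} (hp : 0 < p) (hp1 : p < 1) (hw : w ≠ 0) (i : ℤ) :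
    jt p w i = kt p w i - w * kt p w (i - 1) := by
  have e : jt p w i = jt p 1 i * w ^ i := by simp [jt]
  have h : w ^ i = w ^ (i - 1) * w := by rw [zpow_sub₀ hw, zpow_one]; field_simp
  simp only [kt]
  rw [e, ← kap_rec hp hp1 i, h]; ring

lemma kapf_mul {p w : ℝ} (hp : 0 < p) (hp1 : p < 1) (hw : w ≠ 0) :
    (1 - w) * kapf p w = j p w := by
  have h1 : HasSum (kt p w) (kapf p w) := (kt_summable hp hp1 hw).hasSum
  have h2 : HasSum (fun i : ℤ => kt p w (i - 1)) (kapf p w) :=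
    ((Equiv.subRight (1 : ℤ)).hasSum_iff (f := kt p w)).2 h1
  have h3 := h1.sub (h2.mul_left w)
  have h4 := (jt_hasSum hp hp1 hw)
  have e : jt p w = fun i => kt p w i - w * kt p w (i - 1) := funext fun i => jt_kt hp hp1 hw i
  rw [e] at h4
  rw [h4.unique h3]; ring

lemma kapf_one {p : ℝ} (hp : 0 < p) (hp1 : p < 1) : kapf p 1 = J3 p := by
  have h1 := kt_summable hp hp1 one_ne_zero
  have hn : Summable (fun i : ℤ => i * kt p 1 i) := by
    apply Summable.of_norm_bounded ((jt_n_summable hp hp1 one_ne_zero).norm.mul_left (1 - p)⁻¹)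
    intro i
    have := kt_norm hp hp1 1 i
    rw [norm_mul, norm_mul]
    nlinarith [norm_nonneg (i : ℝ)]
  have hs : HasSum (fun i : ℤ => ((i : ℤ) : ℝ) * kt p 1 (i - 1)) (∑' i : ℤ, (i * kt p 1 i + kt p 1 i)) := by
    have := (hn.add h1).hasSum
    rw [← (Equiv.subRight (1 : ℤ)).hasSum_iff] at this
    convert this using 1
    funext i
    simp only [Function.comp, Equiv.subRight_apply]
    push_cast; ring
  have e : ∑' n : ℤ, (n : ℝ) * jt p 1 n = ∑' n : ℤ, ((n : ℝ) * kt p 1 n - n * kt p 1 (n - 1)) := by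
    apply tsum_congr
    intro n
    have := kap_rec hp hp1 n
    unfold kt
    rw [← this]; simp; ring
  unfold J3
  rw [e, Summable.tsum_sub hn hs.summable, hs.tsum_eq, Summable.tsum_add hn h1]
  unfold kapf; ring

lemma jt_zpow {p w : ℝ} (hp : 0 < p) (hw : w ≠ 0) (a n : ℤ) :
    jt p w (n + a) = ((-1) ^ a * p ^ tri a * w ^ a) * jt p (p ^ a * w) n := by
  have e1 : p ^ tri (n + a) = p ^ tri a * p ^ tri n * (p ^ a) ^ n := by
    rw [← zpow_mul, ← zpow_add₀ hp.ne', ← zpow_add₀ hp.ne']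
    congr 1
    apply tri_of
    have := two_tri n
    have := two_tri a
    linear_combination two_tri n + two_tri a
  unfold jt
  rw [e1, zpow_add₀ hw, zpow_add₀ (by norm_num : (-1 : ℝ) ≠ 0), mul_zpow]
  ring

lemma j_zpow {p w : ℝ} (hp : 0 < p) (hw : w ≠ 0) (a : ℤ) :
    j p w = ((-1) ^ a * p ^ tri a * w ^ a) * j p (p ^ a * w) := by
  unfold j
  rw [← (Equiv.addRight a).tsum_eq, ← tsum_mul_left]
  apply tsum_congr
  intro n
  exact jt_zpow hp hw a n

lemma j_zpow_zero {p : ℝ} (hp : 0 < p) (a : ℤ) : j p (p ^ a) = 0 := by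
  have h := j_zpow hp (zpow_ne_zero (-a) hp.ne') (a)
  have h2 := j_zpow hp (one_ne_zero) (a)
  rw [j_one hp] at h2
  have h3 : ((-1 : ℝ)) ^ a ≠ 0 := zpow_ne_zero a (by norm_num)
  have h4 := (zpow_pos hp (tri a)).ne'
  simpa [h3, h4] using h2.symm

lemma kapf_zpow {p : ℝ} (hp : 0 < p) (hp1 : p < 1) (a : ℤ) (ha : a ≠ 0) : kapf p (p ^ a) = 0 := by
  have h := kapf_mul hp hp1 (zpow_ne_zero a hp.ne')
  rw [j_zpow_zero hp] at h
  have : (1 : ℝ) - p ^ a ≠ 0 := by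
    intro h
    have h' : p ^ a = p ^ (0 : ℤ) := by simp; linarith
    exact ha (zpow_right_injective₀ hp hp1.ne h')
  exact (mul_eq_zero.1 h).resolve_left this

/-- double series term -/
noncomputable def gt (p x z : ℝ) (a : ℤ × ℤ) : ℝ :=
  p ^ (a.1 * a.1 + a.1 * a.2) * (x * z ^ 2) ^ a.1 * ((x * z) ^ a.2 * kap p a.2)

def shearEquiv : ℤ × ℤ ≃ ℤ × ℤ where
  toFun := fun a => (a.1 + 1, a.1 + a.2)
  invFun := fun b => (b.1 - 1, b.2 - b.1 + 1)
  left_inv := by rintro ⟨m, i⟩; simp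
  right_inv := by rintro ⟨m, i⟩; simp

lemma gt_summable {p x z : ℝ} (hp : 0 < p) (hp1 : p < 1) (hx : x ≠ 0) (hz : z ≠ 0) :
    Summable (gt p x z) := by
  have h := (j_mul_j hp hp1 hp hp1 hz (mul_ne_zero hx hz)).1.norm
  have h2 := (shearEquiv.summable_iff).2 h
  apply Summable.of_norm_bounded (h2.mul_left ((1 - p)⁻¹ * |z|⁻¹))
  rintro ⟨m, i⟩
  have hk := kap_bound hp hp1 i
  simp only [gt, shearEquiv, Function.comp, Equiv.coe_fn_mk, norm_mul, jt_abs, norm_zpow, norm_pow, Real.norm_eq_abs, abs_of_pos hp]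
  have hz' : 0 < |z| := abs_pos.2 hz
  have hx' : 0 < |x| := abs_pos.2 hx
  have e : p ^ tri (m + 1) * p ^ tri (m + i) = p ^ (m * m + m * i) * p ^ tri i := by
    rw [← zpow_add₀ hp.ne', ← zpow_add₀ hp.ne']
    congr 1
    have := two_tri (m + 1); have := two_tri (m + i); have := two_tri i
    nlinarith
  calc _ ≤ p ^ (m * m + m * i) * (|x| * |z| ^ 2) ^ m * ((|x| * |z|) ^ i * ((1 - p)⁻¹ * p ^ tri i)) := by
        gcongr
    _ = (1 - p)⁻¹ * |z|⁻¹ * ((p ^ tri (m + 1) * p ^ tri (m + i)) * (|z| ^ (m + 1) * (|x| * |z|) ^ (m + i))) := by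
        rw [e, zpow_add₀ hz'.ne', zpow_add₀ (by positivity : |x| * |z| ≠ 0), mul_zpow, mul_zpow, sq, mul_zpow]
        simp; field_simp; rw [mul_zpow]; ring
    _ = _ := by simp only [abs_mul]; ring

def evoEquiv : (ℤ × ℤ) ⊕ (ℤ × ℤ) ≃ ℤ × ℤ where
  toFun := Sum.elim (fun a => (a.1 - a.2, 2 * a.2)) (fun a => (a.1 - a.2, 2 * a.2 + 1))
  invFun := fun b => if b.2 % 2 = 0 then Sum.inl (b.1 + b.2 / 2, b.2 / 2)
    else Sum.inr (b.1 + b.2 / 2, b.2 / 2)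
  left_inv := by
    rintro (⟨s, t⟩ | ⟨s, t⟩)
    · have h : (2 * t) % 2 = 0 := by omega
      simp only [Sum.elim_inl, h, if_true]
      congr 2 <;> omega
    · have h : ¬ (2 * t + 1) % 2 = 0 := by omega
      simp only [Sum.elim_inr, h, if_false]
      congr 2 <;> omega
  right_inv := by
    rintro ⟨m, n⟩
    dsimp only
    split_ifs with h
    · simp only [Sum.elim_inl, Prod.mk.injEq]; omega
    · simp only [Sum.elim_inr, Prod.mk.injEq]; omega

lemma tsum_evo {f : ℤ × ℤ → ℝ} (hf : Summable f) :
    ∑' a, f a = ∑' a : ℤ × ℤ, f (a.1 - a.2, 2 * a.2) +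
      ∑' a : ℤ × ℤ, f (a.1 - a.2, 2 * a.2 + 1) := by
  rw [← evoEquiv.tsum_eq f]
  have h := (evoEquiv.summable_iff (f := f)).2 hf
  exact Summable.tsum_sum (f := f ∘ evoEquiv)
    (h.comp_injective Sum.inl_injective) (h.comp_injective Sum.inr_injective)

noncomputable def e0t (p x : ℝ) (s : ℤ) : ℝ := kap p (2 * s) * x ^ s * p ^ (-(s * s))
noncomputable def e1t (p x : ℝ) (s : ℤ) : ℝ := kap p (2 * s + 1) * x ^ (s + 1) * p ^ (-(s * s + s))

lemma e0_summable {p x : ℝ} (hp : 0 < p) (hp1 : p < 1) (hx : x ≠ 0) : Summable (e0t p x) := by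
  have h := (jt_summable (p := p ^ 2) (z := x) (by positivity) (by nlinarith) hx).norm
  apply Summable.of_norm_bounded (h.mul_left (1 - p)⁻¹)
  intro s
  have hx' : 0 < |x| := abs_pos.2 hx
  have hk := kap_bound hp hp1 (2 * s)
  have e : (p ^ 2) ^ tri s = p ^ tri (2 * s) * p ^ (-(s * s)) := by
    simp only [zpow_exp hp, zpow_exp (by positivity : 0 < p ^ 2), ← Real.exp_add, Real.log_pow, tri_cast]
    congr 1; push_cast; ring
  simp only [e0t, jt_abs, norm_mul, norm_zpow, Real.norm_eq_abs, abs_of_pos hp, abs_of_pos (by positivity : 0 < p ^ 2)]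
  rw [e]
  calc _ ≤ ((1 - p)⁻¹ * p ^ tri (2 * s)) * |x| ^ s * p ^ (-(s * s)) := by gcongr
    _ = _ := by ring

lemma e1_summable {p x : ℝ} (hp : 0 < p) (hp1 : p < 1) (hx : x ≠ 0) : Summable (e1t p x) := by
  have h := (jt_summable (p := p ^ 2) (z := p * x) (by positivity) (by nlinarith) (by positivity)).norm
  apply Summable.of_norm_bounded (h.mul_left ((1 - p)⁻¹ * |x|))
  intro s
  have hx' : 0 < |x| := abs_pos.2 hx
  have hk := kap_bound hp hp1 (2 * s + 1)
  have e : (p ^ 2) ^ tri s * p ^ s = p ^ tri (2 * s + 1) * p ^ (-(s * s + s)) := by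
    simp only [zpow_exp hp, zpow_exp (by positivity : 0 < p ^ 2), ← Real.exp_add, Real.log_pow, tri_cast]
    congr 1; push_cast; ring
  simp only [e1t, jt_abs, norm_mul, norm_zpow, Real.norm_eq_abs, abs_mul, abs_of_pos hp, abs_of_pos (by positivity : 0 < p ^ 2), mul_zpow, zpow_add₀ hx'.ne']
  calc _ ≤ ((1 - p)⁻¹ * p ^ tri (2 * s + 1)) * (|x| ^ s * |x| ^ (1 : ℤ)) * p ^ (-(s * s + s)) := by gcongr
    _ = (1 - p)⁻¹ * |x| * (|x| ^ s * ((p ^ 2) ^ tri s * p ^ s)) := by rw [e, zpow_one]; ring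
    _ = _ := by ring

noncomputable def Th0 (p x z : ℝ) : ℝ := j (p ^ 2) (-(p * x * z ^ 2))
noncomputable def Th1 (p x z : ℝ) : ℝ := j (p ^ 2) (-(p ^ 2 * x * z ^ 2))
noncomputable def GG (p x z : ℝ) : ℝ := ∑' a, gt p x z a

lemma GG_eq {p x z : ℝ} (hp : 0 < p) (hp1 : p < 1) (hx : x ≠ 0) (hz : z ≠ 0) :
    GG p x z = (∑' s, e0t p x s) * Th0 p x z + (∑' s, e1t p x s) * (z * Th1 p x z) := by
  have hp2 : 0 < p ^ 2 := by positivity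
  have hp21 : p ^ 2 < 1 := by nlinarith
  unfold GG Th0 Th1 j
  rw [tsum_evo (gt_summable hp hp1 hx hz)]
  have s0 := (jt_summable hp2 hp21 (z := -(p * x * z ^ 2)) (by simp [hp.ne', hx, hz])).norm
  have s1 := (jt_summable hp2 hp21 (z := -(p ^ 2 * x * z ^ 2)) (by simp [hp.ne', hx, hz])).norm
  have t0 := (e0_summable hp hp1 hx).norm
  have t1 := (e1_summable hp hp1 hx).norm
  have hxz : x * z ^ 2 ≠ 0 := by positivity
  have hxz' : x * z ≠ 0 := by positivity
  congr 1
  · rw [mul_comm, tsum_mul_tsum_of_summable_norm s0 t0]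
    apply tsum_congr
    rintro ⟨M, s⟩
    simp only [gt, jt_neg, e0t]
    have e1 : p ^ ((M - s) * (M - s) + (M - s) * (2 * s)) = (p ^ 2) ^ tri M * p ^ M * p ^ (-(s * s)) := by
      simp only [zpow_exp hp, zpow_exp hp2, ← Real.exp_add, Real.log_pow, tri_cast]
      congr 1; push_cast; ring
    have e2 : (x * z ^ 2) ^ (M - s) * (x * z) ^ (2 * s) = (x * z ^ 2) ^ M * x ^ s := by
      rw [zpow_sub₀ hxz, two_mul, zpow_add₀ hxz', ← mul_zpow, show x * z * (x * z) = (x * z ^ 2) * x by ring, mul_zpow _ x]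
      have := zpow_ne_zero s hxz
      field_simp
    have e3 : (p * x * z ^ 2) ^ M = p ^ M * (x * z ^ 2) ^ M := by rw [mul_assoc, mul_zpow]
    rw [e1, e3]
    linear_combination ((p ^ 2) ^ tri M * p ^ M * p ^ (-(s * s)) * kap p (2 * s)) * e2
  · rw [← mul_assoc, mul_comm, mul_comm _ z, ← tsum_mul_left, tsum_mul_tsum_of_summable_norm s1 (by simpa using t1.mul_left ‖z‖)]
    apply tsum_congr
    rintro ⟨M, s⟩
    simp only [gt, jt_neg, e1t]
    have e1 : p ^ ((M - s) * (M - s) + (M - s) * (2 * s + 1)) = (p ^ 2) ^ tri M * (p ^ 2) ^ M * p ^ (-(s * s + s)) := by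
      simp only [zpow_exp hp, zpow_exp hp2, ← Real.exp_add, Real.log_pow, tri_cast]
      congr 1; push_cast; ring
    have e2 : (x * z ^ 2) ^ (M - s) * (x * z) ^ (2 * s + 1) = (x * z ^ 2) ^ M * (z * x ^ (s + 1)) := by
      rw [zpow_sub₀ hxz, zpow_add₀ hxz', two_mul, zpow_add₀ hxz', ← mul_zpow, show x * z * (x * z) = (x * z ^ 2) * x by ring, mul_zpow _ x, zpow_add₀ hx]
      have := zpow_ne_zero s hxz
      field_simp
    have e3 : (p ^ 2 * x * z ^ 2) ^ M = (p ^ 2) ^ M * (x * z ^ 2) ^ M := by rw [mul_assoc, mul_zpow]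
    rw [e1, e3]
    linear_combination ((p ^ 2) ^ tri M * (p ^ 2) ^ M * p ^ (-(s * s + s)) * kap p (2 * s + 1)) * e2

lemma GG_rows {p x z : ℝ} (hp : 0 < p) (hp1 : p < 1) (hx : x ≠ 0) (hz : z ≠ 0) :
    GG p x z = ∑' m : ℤ, p ^ (m * m) * (x * z ^ 2) ^ m * kapf p (p ^ m * (x * z)) := by
  unfold GG
  rw [(gt_summable hp hp1 hx hz).tsum_prod]
  apply tsum_congr
  intro m
  unfold kapf
  rw [← tsum_mul_left]
  apply tsum_congr
  intro i
  simp only [gt, kt]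
  rw [zpow_add₀ hp.ne', mul_zpow (p ^ m), ← zpow_mul p]; ring

lemma GG_special {p x : ℝ} (hp : 0 < p) (hp1 : p < 1) (hx : x ≠ 0) :
    GG p x x⁻¹ = J3 p := by
  rw [GG_rows hp hp1 hx (inv_ne_zero hx), mul_inv_cancel₀ hx, tsum_eq_single 0]
  · simp [kapf_one hp hp1]
  · intro m hm
    rw [mul_one, kapf_zpow hp hp1 m hm, mul_zero]

/-- Appell sum -/
noncomputable def AA (p x z : ℝ) : ℝ := ∑' n : ℤ, jt p z n / (1 - p ^ (n - 1) * (x * z))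

lemma AA_mul_p {p x z : ℝ} (hp : 0 < p) (hz : z ≠ 0) :
    AA p x (p * z) = -z⁻¹ * AA p x z := by
  unfold AA
  rw [← (Equiv.addRight (1 : ℤ)).tsum_eq (fun n : ℤ => jt p z n / (1 - p ^ (n - 1) * (x * z))), ← tsum_mul_left]
  apply tsum_congr
  intro n
  rw [jt_mul_p hp hz]
  simp only [Equiv.coe_addRight, add_sub_cancel_right]
  rw [show p ^ (n - 1) * (x * (p * z)) = p ^ n * (x * z) by rw [zpow_sub₀ hp.ne']; field_simp]
  ring

lemma AA_E {p x z : ℝ} (hp : 0 < p) (hp1 : p < 1) (hx : x ≠ 0) (hz : z ≠ 0)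
    (h : ∀ n : ℤ, p ^ n * (x * z) ≠ 1) : j p (x * z) * AA p x z = - z * GG p x z := by
  have hxz : x * z ≠ 0 := mul_ne_zero hx hz
  rw [GG_rows hp hp1 hx hz]
  unfold AA
  rw [← (Equiv.addRight (1 : ℤ)).tsum_eq (fun n : ℤ => jt p z n / (1 - p ^ (n - 1) * (x * z))), ← tsum_mul_left, ← tsum_mul_left]
  apply tsum_congr
  intro m
  simp only [Equiv.coe_addRight, add_sub_cancel_right]
  have h1 := kapf_mul hp hp1 (w := p ^ m * (x * z)) (mul_ne_zero (zpow_ne_zero _ hp.ne') hxz)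
  rw [j_zpow hp hxz m, ← h1]
  have h2 : 1 - p ^ m * (x * z) ≠ 0 := sub_ne_zero.2 (h m).symm
  have e : p ^ (m * m) = p ^ tri m * p ^ tri (m + 1) := by
    rw [← zpow_add₀ hp.ne']; congr 1
    have := two_tri m; have := two_tri (m + 1); nlinarith
  have h3 := neg_one_zpow_mul_self m
  have hzz : (z ^ 2) ^ m = z ^ m * z ^ m := by rw [sq, mul_zpow]
  rw [e, mul_zpow, mul_zpow, hzz]
  unfold jt
  rw [zpow_add₀ (by norm_num : (-1 : ℝ) ≠ 0), zpow_add₀ hz]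
  field_simp
  have h5 : ((-1 : ℝ) ^ m) ^ 2 = 1 := by rw [sq]; exact h3
  rw [h5]; simp
  exact mul_div_cancel_left₀ _ (by rwa [mul_assoc])

lemma poc_ne_zero' {p a : ℝ} (hp : 0 < p) (hp1 : p < 1) (ha : ∀ i : ℕ, a * p ^ i ≠ 1) : poc p a ≠ 0 := by
  unfold poc
  simp_rw [sub_eq_add_neg]
  apply tprod_one_add_ne_zero_of_summable
  · intro i h
    apply ha i; linarith
  · simp only [norm_neg, norm_mul, norm_pow]
    apply Summable.mul_left
    apply summable_geometric_of_lt_one (norm_nonneg _)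
    simpa [abs_of_pos hp] using hp1

lemma j_ne_zero {p z : ℝ} (hp : 0 < p) (hp1 : p < 1) (hz : z ≠ 0) (h : ∀ n : ℤ, p ^ n * z ≠ 1) : j p z ≠ 0 := by
  rw [jtp hp hp1 hz]
  refine mul_ne_zero (mul_ne_zero (poc_pos hp hp1 hp1).ne' (poc_ne_zero' hp hp1 ?_)) (poc_ne_zero' hp hp1 ?_)
  · intro i hi
    apply h i; rw [mul_comm]; simpa using hi
  · intro i hi
    apply h (-(i + 1))
    rw [zpow_neg, zpow_add₀ hp.ne']
    field_simp at hi ⊢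
    simp; linarith

lemma AA_diff' {p x z0 z1 : ℝ} (hp : 0 < p) (hp1 : p < 1) (hx : x ≠ 0) (h0 : z0 ≠ 0) (h1 : z1 ≠ 0)
    (a0 : ∀ n : ℤ, p ^ n * (x * z0) ≠ 1) (a1 : ∀ n : ℤ, p ^ n * (x * z1) ≠ 1) :
    j p z0 * j p (x * z0) * (j p (x * z1) * AA p x z1) - j p z1 * j p (x * z1) * (j p (x * z0) * AA p x z0) =
      z0 * J3 p * j p (z1 / z0) * j p (x * z0 * z1) := by
  have hp2 : 0 < p ^ 2 := by positivity
  rw [AA_E hp hp1 hx h1 a1, AA_E hp hp1 hx h0 a0, GG_eq hp hp1 hx h0, GG_eq hp hp1 hx h1]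
  have hs := GG_special hp hp1 hx
  rw [GG_eq hp hp1 hx (inv_ne_zero hx)] at hs
  set e0 := ∑' s, e0t p x s
  set e1 := ∑' s, e1t p x s
  have B : ∀ z : ℝ, z ≠ 0 → j (p ^ 2) (-(x * z ^ 2)) = x * z ^ 2 * Th1 p x z := by
    intro z hz
    have := j_mul_p hp2 (z := -(x * z ^ 2)) (by simp [hx, hz])
    unfold Th1
    rw [show -(p ^ 2 * x * z ^ 2) = p ^ 2 * -(x * z ^ 2) by ring, this]
    field_simp; try ring
  have T : ∀ z : ℝ, z ≠ 0 → j p z * j p (x * z) = x * z ^ 2 * Th1 p x z * Th0 p x 1 - z * (Th0 p x z * (x * Th1 p x 1)) := by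
    intro z hz
    rw [T2 hp hp1 hz (mul_ne_zero hx hz), ← B z hz]
    have := B 1 one_ne_zero
    simp only [one_pow, mul_one] at this
    rw [← this]
    unfold Th0
    congr 2
    · congr 1; ring
    · congr 1; field_simp
    · congr 2
      · ring
      · congr 1; field_simp
  have P : z0 * (j p (z1 / z0) * j p (x * z0 * z1)) = x * z1 ^ 2 * Th1 p x z1 * (z0 * Th0 p x z0) - z1 * Th0 p x z1 * (x * z0 ^ 2 * Th1 p x z0) := by
    have h := T2 hp hp1 (x := z1 / z0) (y := x * z0 * z1) (by positivity) (by positivity)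
    rw [h, ← B z1 h1, ← B z0 h0]
    unfold Th0
    rw [show z1 / z0 * (x * z0 * z1) = x * z1 ^ 2 by field_simp,
      show p * (x * z0 * z1) / (z1 / z0) = p * x * z0 ^ 2 by field_simp,
      show p * (z1 / z0) * (x * z0 * z1) = p * x * z1 ^ 2 by field_simp,
      show (x * z0 * z1) / (z1 / z0) = x * z0 ^ 2 by field_simp]
    field_simp
  have S0 : Th0 p x x⁻¹ = Th0 p x 1 := by
    unfold Th0
    have := j_inv_p hp2 (z := -(p * x)) (by simp [hp.ne', hx])
    rw [show -(p * x * 1 ^ 2) = -(p * x) by ring, ← this]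
    congr 1; field_simp
  have S1 : x⁻¹ * Th1 p x x⁻¹ = Th1 p x 1 := by
    unfold Th1
    have h1 := j_inv_p hp2 (z := -(p ^ 2 * x * 1 ^ 2)) (by simp [hp.ne', hx])
    have h2 := j_mul_p hp2 (z := -x⁻¹) (by simp [hx])
    rw [← h1]
    rw [show -(p ^ 2 * x * x⁻¹ ^ 2) = p ^ 2 * -x⁻¹ by field_simp, h2]
    rw [show p ^ 2 / -(p ^ 2 * x * 1 ^ 2) = -x⁻¹ by field_simp]
    field_simp; try ring
  rw [S0, S1] at hs
  rw [T z0 h0, T z1 h1]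
  linear_combination (-J3 p) * P + ((x * z1 ^ 2 * Th1 p x z1 * (z0 * Th0 p x z0) - z1 * Th0 p x z1 * (x * z0 ^ 2 * Th1 p x z0))) * hs

lemma AA_diff {p x z0 z1 : ℝ} (hp : 0 < p) (hp1 : p < 1) (hx : x ≠ 0) (h0 : z0 ≠ 0) (h1 : z1 ≠ 0)
    (a0 : ∀ n : ℤ, p ^ n * (x * z0) ≠ 1) (a1 : ∀ n : ℤ, p ^ n * (x * z1) ≠ 1) :
    j p z0 * AA p x z1 - j p z1 * AA p x z0 =
      z0 * J3 p * j p (z1 / z0) * j p (x * z0 * z1) / (j p (x * z0) * j p (x * z1)) := by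
  have n0 := j_ne_zero hp hp1 (mul_ne_zero hx h0) a0
  have n1 := j_ne_zero hp hp1 (mul_ne_zero hx h1) a1
  rw [← AA_diff' hp hp1 hx h0 h1 a0 a1]
  field_simp

open Filter Topology

lemma zpow_ne_one_of {q : ℝ} (hq : 0 < q) (hq1 : q < 1) {e : ℤ} (he : e ≠ 0) : q ^ e ≤ q ∨ q⁻¹ ≤ q ^ e := by
  rcases lt_or_gt_of_ne he with h | h
  · right
    have := zpow_le_zpow_right_of_le_one₀ hq hq1.le (show e ≤ -1 by omega)
    simpa using this
  · left
    have := zpow_le_zpow_right_of_le_one₀ hq hq1.le (show (1 : ℤ) ≤ e by omega)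
    simpa using this

lemma denom_bound {q t : ℝ} (hq : 0 < q) (hq1 : q < 1) {e : ℤ} (he : e ≠ 0)
    (h1 : (1 + q) / 2 ≤ t) (h2 : t ≤ 2 / (1 + q)) : (1 - q) / 2 ≤ |1 - q ^ e * t| := by
  have h3 : t * (1 + q) ≤ 2 := by rwa [le_div_iff₀ (by positivity)] at h2
  rcases zpow_ne_one_of hq hq1 he with h | h
  · rw [le_abs]; left
    have : q ^ e * t ≤ q * t := mul_le_mul_of_nonneg_right h (by linarith)
    nlinarith
  · rw [le_abs]; right
    have : q⁻¹ * t ≤ q ^ e * t := mul_le_mul_of_nonneg_right h (by linarith)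
    have h4 : (1 + q) / 2 * q⁻¹ ≤ q⁻¹ * t := by
      rw [mul_comm]; exact mul_le_mul_of_nonneg_left h1 (by positivity)
    have h5 : 1 + (1 - q) / 2 ≤ (1 + q) / 2 * q⁻¹ := by
      rw [← div_eq_mul_inv, le_div_iff₀ hq]; nlinarith
    linarith

lemma near_one {q : ℝ} (hq : 0 < q) (hq1 : q < 1) :
    ∀ᶠ t in 𝓝 (1 : ℝ), (1 + q) / 2 ≤ t ∧ t ≤ 2 / (1 + q) := by
  have h1 : (1 + q) / 2 < 1 := by linarith
  have h2 : 1 < 2 / (1 + q) := by rw [lt_div_iff₀ (by positivity)]; linarith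
  filter_upwards [lt_mem_nhds h1, gt_mem_nhds h2] with t a b using ⟨a.le, b.le⟩

/-- continuity at 1 of Appell-type sums -/
lemma appell_cont {q : ℝ} (hq : 0 < q) (hq1 : q < 1) {f : ℤ → ℝ} (hf : Summable f) (e : ℤ → ℤ)
    (he : ∀ n, f n ≠ 0 → e n ≠ 0) :
    Tendsto (fun t : ℝ => ∑' n, f n / (1 - q ^ (e n) * t)) (𝓝 1) (𝓝 (∑' n, f n / (1 - q ^ (e n)))) := by
  apply tendsto_tsum_of_dominated_convergence (hf.norm.mul_left (2 / (1 - q)))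
  · intro n
    by_cases h0 : f n = 0
    · simp [h0]
    have hne : 1 - q ^ (e n) ≠ 0 := by
      have := denom_bound (t := 1) hq hq1 (he n h0) (by linarith) (by rw [le_div_iff₀ (by positivity)]; linarith)
      intro h; rw [mul_one, h, abs_zero] at this; linarith
    have : ContinuousAt (fun t : ℝ => f n / (1 - q ^ (e n) * t)) 1 := by
      apply ContinuousAt.div
      · fun_prop
      · fun_prop
      · simpa using hne
    have := this.tendsto
    simpa using this
  · filter_upwards [near_one hq hq1] with t ht n
    by_cases h0 : f n = 0
    · simp [h0]
    have := denom_bound hq hq1 (he n h0) ht.1 ht.2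
    rw [norm_div, Real.norm_eq_abs (1 - _)]
    have hpos : 0 < (1 - q) / 2 := by linarith
    calc ‖f n‖ / |1 - q ^ e n * t| ≤ ‖f n‖ / ((1 - q) / 2) := by gcongr
      _ = _ := by field_simp

lemma zpow_sub_one_bound {t : ℝ} (h1 : 1 / 2 ≤ t) (h2 : t ≤ 2) (n : ℤ) :
    |t ^ n - 1| ≤ 2 * ((4 : ℝ) ^ n + ((4 : ℝ) ^ n)⁻¹) * |t - 1| := by
  have key : ∀ (s : ℝ), 0 ≤ s → s ≤ 2 → ∀ m : ℕ, |s ^ m - 1| ≤ 4 ^ m * |s - 1| := by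
    intro s hs0 hs m
    induction m with
    | zero => simp
    | succ m ih =>
      have : s ^ (m + 1) - 1 = s * (s ^ m - 1) + (s - 1) := by ring
      rw [this]
      calc _ ≤ |s * (s ^ m - 1)| + |s - 1| := abs_add_le _ _
        _ ≤ 2 * (4 ^ m * |s - 1|) + |s - 1| := by
          rw [abs_mul, abs_of_nonneg hs0]; gcongr
        _ ≤ 4 ^ (m + 1) * |s - 1| := by
          have h4 : (1 : ℝ) ≤ 4 ^ m := one_le_pow₀ (by norm_num)
          rw [pow_succ]
          nlinarith [abs_nonneg (s - 1)]
  have ht : 0 < t := by linarith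
  rcases Int.le_total 0 n with h | h
  · obtain ⟨m, rfl⟩ := Int.eq_ofNat_of_zero_le h
    have := key t ht.le h2 m
    have h3 : (0 : ℝ) < (4 ^ m)⁻¹ := by positivity
    have h4 : (0 : ℝ) < (4 ^ m) := by positivity
    simp only [Int.ofNat_eq_natCast, zpow_natCast]
    nlinarith [abs_nonneg (t - 1), mul_nonneg h3.le (abs_nonneg (t - 1)), mul_nonneg h4.le (abs_nonneg (t - 1))]
  · obtain ⟨m, rfl⟩ : ∃ m : ℕ, n = -m := ⟨n.natAbs, by omega⟩
    have := key t⁻¹ (by positivity) (by rw [inv_le_comm₀ ht (by norm_num)]; linarith) m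
    have h3 : (0 : ℝ) < (4 ^ m)⁻¹ := by positivity
    have h4 : (0 : ℝ) < (4 ^ m) := by positivity
    simp only [zpow_neg, zpow_natCast, inv_inv]
    have h5 : |t⁻¹ - 1| ≤ 2 * |t - 1| := by
      have : t⁻¹ - 1 = -(t⁻¹ * (t - 1)) := by field_simp; ring
      rw [this, abs_neg, abs_mul, abs_of_pos (inv_pos.2 ht)]
      gcongr
      rw [inv_le_comm₀ ht (by norm_num)]; linarith
    rw [inv_pow] at this
    calc _ ≤ 4 ^ m * |t⁻¹ - 1| := this
      _ ≤ 4 ^ m * (2 * |t - 1|) := by gcongr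
      _ ≤ _ := by nlinarith [abs_nonneg (t - 1), mul_nonneg h3.le (abs_nonneg (t - 1)), mul_nonneg h4.le (abs_nonneg (t - 1))]

lemma j_deriv {p c : ℝ} (hp : 0 < p) (hp1 : p < 1) (hc : c ≠ 0) :
    Tendsto (fun t : ℝ => (j p (t * c) - j p c) / (1 - t)) (𝓝[≠] 1) (𝓝 (- ∑' n : ℤ, n * jt p c n)) := by
  have a1 := (jt_summable hp hp1 (z := 4 * c) (by positivity)).norm
  have a2 := (jt_summable hp hp1 (z := c / 4) (by positivity)).norm
  rw [← tsum_neg]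
  have hnear : ∀ᶠ t in 𝓝[≠] (1 : ℝ), 1 / 2 ≤ t ∧ t ≤ 2 := by
    apply eventually_nhdsWithin_of_eventually_nhds
    filter_upwards [lt_mem_nhds (show (1 : ℝ) / 2 < 1 by norm_num), gt_mem_nhds (show (1 : ℝ) < 2 by norm_num)] with t a b using ⟨a.le, b.le⟩
  have hT : Tendsto (fun t : ℝ => ∑' n : ℤ, jt p c n * ((t ^ n - 1) / (1 - t))) (𝓝[≠] 1) (𝓝 (∑' n : ℤ, -(n * jt p c n))) := by
    apply tendsto_tsum_of_dominated_convergence ((a1.add a2).mul_left 2)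
    · intro n
      have h := (hasDerivAt_zpow n (1 : ℝ) (Or.inl one_ne_zero)).tendsto_slope
      have h2 := (h.neg).const_mul (jt p c n)
      have e : jt p c n * -((n : ℝ) * 1 ^ (n - 1)) = -(n * jt p c n) := by simp; ring
      rw [e] at h2
      refine h2.congr fun t => ?_
      rw [slope_def_field]; simp
      rw [← mul_neg, ← div_neg]; congr 2; ring
    · filter_upwards [hnear, self_mem_nhdsWithin] with t ht hne n
      have hb := zpow_sub_one_bound ht.1 ht.2 n
      have hpos : 0 < |1 - t| := abs_pos.2 (sub_ne_zero.2 (Ne.symm hne))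
      rw [norm_mul, norm_div, Real.norm_eq_abs (t ^ n - 1), Real.norm_eq_abs (1 - t)]
      have : |t ^ n - 1| / |1 - t| ≤ 2 * ((4 : ℝ) ^ n + ((4 : ℝ) ^ n)⁻¹) := by
        rw [div_le_iff₀ hpos, abs_sub_comm 1 t]; exact hb
      calc _ ≤ ‖jt p c n‖ * (2 * ((4 : ℝ) ^ n + ((4 : ℝ) ^ n)⁻¹)) := by gcongr
        _ = _ := by
          simp only [jt_norm, abs_mul, abs_div, mul_zpow, div_zpow]
          rw [show |(4 : ℝ)| = 4 by norm_num]; field_simp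
  refine hT.congr' ?_
  filter_upwards [hnear] with t ht
  have ht0 : t ≠ 0 := by linarith [ht.1]
  unfold j
  rw [← Summable.tsum_sub (jt_summable hp hp1 (mul_ne_zero ht0 hc)) (jt_summable hp hp1 hc), ← tsum_div_const]
  apply tsum_congr
  intro n
  unfold jt; rw [mul_zpow]; ring

lemma j_cont {p c : ℝ} (hp : 0 < p) (hp1 : p < 1) (hc : c ≠ 0) :
    Tendsto (fun t : ℝ => j p (t * c)) (𝓝[≠] 1) (𝓝 (j p c)) := by
  have h := j_deriv hp hp1 hc
  have h1 : Tendsto (fun t : ℝ => 1 - t) (𝓝[≠] 1) (𝓝 0) := by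
    have : Tendsto (fun t : ℝ => 1 - t) (𝓝 1) (𝓝 (1 - 1)) := by
      apply Tendsto.sub tendsto_const_nhds tendsto_id
    rw [sub_self] at this
    exact this.mono_left nhdsWithin_le_nhds
  have h2 := (h.mul h1).add_const (j p c)
  rw [mul_zero, zero_add] at h2
  refine h2.congr' ?_
  filter_upwards [self_mem_nhdsWithin] with t hne
  have : 1 - t ≠ 0 := sub_ne_zero.2 (Ne.symm hne)
  field_simp; ring

lemma j_kap {p : ℝ} (hp : 0 < p) (hp1 : p < 1) :
    Tendsto (fun t : ℝ => j p t / (1 - t)) (𝓝[≠] 1) (𝓝 (J3 p)) := by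
  have := j_deriv hp hp1 one_ne_zero
  simpa [j_one hp, J3] using this

/-- single difference formula in the form used for the limit -/
lemma AA_diff_t {p t z0 z1 : ℝ} (hp : 0 < p) (hp1 : p < 1) (ht : t ≠ 0) (h0 : z0 ≠ 0) (h1 : z1 ≠ 0)
    (a0 : ∀ n : ℤ, p ^ n * (t * (z0 / z1)) ≠ 1) (a1 : ∀ n : ℤ, p ^ n * t ≠ 1)
    (n0 : j p z0 ≠ 0) :
    AA p (t * (p / z1)) z1 - j p z1 / j p z0 * AA p (t * (p / z1)) z0 =
      J3 p * t * (j p (t * z0) / j p z0) * (j p (z0 / z1) / j p (t * (z0 / z1))) / j p t := by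
  have b0 : ∀ n : ℤ, p ^ n * (t * (p / z1) * z0) ≠ 1 := by
    intro n
    have := a0 (n + 1)
    rw [zpow_add₀ hp.ne', zpow_one] at this
    intro h; apply this; rw [← h]; field_simp
  have b1 : ∀ n : ℤ, p ^ n * (t * (p / z1) * z1) ≠ 1 := by
    intro n
    have := a1 (n + 1)
    rw [zpow_add₀ hp.ne', zpow_one] at this
    intro h; apply this; rw [← h]; field_simp
  have hc : z0 / z1 ≠ 0 := by positivity
  have d := AA_diff hp hp1 (x := t * (p / z1)) (by positivity) h0 h1 b0 b1
  have nt := j_ne_zero hp hp1 ht a1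
  have ntc := j_ne_zero hp hp1 (mul_ne_zero ht hc) a0
  have q1 : j p (t * (p / z1) * z1) = -t⁻¹ * j p t := by
    rw [← j_mul_p hp ht]; congr 1; field_simp
  have q2 : j p (t * (p / z1) * z0) = -(t * (z0 / z1))⁻¹ * j p (t * (z0 / z1)) := by
    rw [← j_mul_p hp (mul_ne_zero ht hc)]; congr 1; field_simp
  have q3 : j p (t * (p / z1) * z0 * z1) = -(t * z0)⁻¹ * j p (t * z0) := by
    rw [← j_mul_p hp (mul_ne_zero ht h0)]; congr 1; field_simp
  have q4 : j p (z1 / z0) = -(z0 / z1)⁻¹ * j p (z0 / z1) := by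
    rw [← j_inv hp hc, inv_div]
  rw [q1, q2, q3, q4] at d
  have : AA p (t * (p / z1)) z1 - j p z1 / j p z0 * AA p (t * (p / z1)) z0 =
    (j p z0 * AA p (t * (p / z1)) z1 - j p z1 * AA p (t * (p / z1)) z0) / j p z0 := by field_simp
  rw [this, d]
  field_simp

lemma limit_zero {p a b c d : ℝ} (hp : 0 < p) (hp1 : p < 1) (ha : a ≠ 0) (hb : b ≠ 0) (hc : c ≠ 0) (hd : d ≠ 0)
    (na : j p a ≠ 0) (nb : j p b ≠ 0) (nc : j p c ≠ 0) (nd : j p d ≠ 0) :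
    Tendsto (fun t : ℝ => J3 p * t * (j p (t * a) / j p a - j p (t * b) / j p b) *
      (j p c / j p (t * c) - j p d / j p (t * d)) / j p t) (𝓝[≠] 1) (𝓝 0) := by
  have hJ : J3 p ≠ 0 := by rw [J3_eq hp hp1]; exact pow_ne_zero _ (poc_pos hp hp1 hp1).ne'
  have k := j_kap hp hp1
  have t1 : Tendsto (fun t : ℝ => t) (𝓝[≠] 1) (𝓝 1) := tendsto_id.mono_left nhdsWithin_le_nhds
  have da := (j_deriv hp hp1 ha).div_const (j p a)
  have db := (j_deriv hp hp1 hb).div_const (j p b)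
  have cc := (tendsto_const_nhds (x := j p c)).div (j_cont hp hp1 hc) nc
  have cd := (tendsto_const_nhds (x := j p d)).div (j_cont hp hp1 hd) nd
  have m := (((t1.const_mul (J3 p)).div k hJ).mul (da.sub db)).mul (cc.sub cd)
  rw [div_self nc, div_self nd, sub_self, mul_zero] at m
  refine m.congr' ?_
  have hk : ∀ᶠ t in 𝓝[≠] (1 : ℝ), j p t / (1 - t) ≠ 0 := k.eventually_ne hJ
  filter_upwards [self_mem_nhdsWithin, hk] with t hne hjt
  have h1 : 1 - t ≠ 0 := sub_ne_zero.2 (Ne.symm hne)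
  have h2 : j p t ≠ 0 := fun h => hjt (by rw [h, zero_div])
  simp only [Pi.div_apply]
  field_simp
  ring

open Filter Topology

lemma p20_zpow (q : ℝ) (n : ℤ) : (q ^ 20) ^ n = q ^ (20 * n) := by
  rw [← zpow_natCast q 20, ← zpow_mul]; norm_num

lemma zpow_eq_one_iff' {q : ℝ} (hq : 0 < q) (hq1 : q < 1) (e : ℤ) : q ^ e = 1 ↔ e = 0 := by
  constructor
  · intro h
    have h' : q ^ e = q ^ (0 : ℤ) := by simpa using h
    exact zpow_right_injective₀ hq hq1.ne h'
  · rintro rfl; simp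

lemma jq_ne_zero {q : ℝ} (hq : 0 < q) (hq1 : q < 1) (k : ℤ) (hk : k % 20 ≠ 0) : j (q ^ 20) (q ^ k) ≠ 0 := by
  apply j_ne_zero (by positivity) (pow_lt_one₀ hq.le hq1 (by norm_num)) (by positivity)
  intro n
  rw [p20_zpow, ← zpow_add₀ hq.ne', Ne, zpow_eq_one_iff' hq hq1]
  omega

lemma AA_t {q t : ℝ} (hq : 0 < q) (k1 k0 : ℤ) :
    AA (q ^ 20) (t * ((q ^ 20) / q ^ k1)) (q ^ k0) = ∑' n : ℤ, jt (q ^ 20) (q ^ k0) n / (1 - q ^ (20 * n + k0 - k1) * t) := by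
  unfold AA
  apply tsum_congr
  intro n
  congr 2
  rw [p20_zpow, mul_sub, zpow_sub₀ hq.ne', zpow_sub₀ hq.ne', zpow_add₀ hq.ne']
  field_simp
  simp
  norm_cast
  ring

lemma AA_t_lim {q : ℝ} (hq : 0 < q) (hq1 : q < 1) (k1 k0 : ℤ) (h : (k0 - k1) % 20 ≠ 0) :
    Tendsto (fun t : ℝ => AA (q ^ 20) (t * ((q ^ 20) / q ^ k1)) (q ^ k0)) (𝓝[≠] 1)
      (𝓝 (AA (q ^ 20) ((q ^ 20) / q ^ k1) (q ^ k0))) := by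
  have e : AA (q ^ 20) ((q ^ 20) / q ^ k1) (q ^ k0) = AA (q ^ 20) (1 * ((q ^ 20) / q ^ k1)) (q ^ k0) := by rw [one_mul]
  rw [e]
  simp only [AA_t hq, mul_one]
  apply (appell_cont hq hq1 (jt_summable (by positivity) (pow_lt_one₀ hq.le hq1 (by norm_num)) (by positivity)) _ _).mono_left nhdsWithin_le_nhds
  intro n _; omega

lemma AA_t_sing {q : ℝ} (hq : 0 < q) (hq1 : q < 1) (k : ℤ) :
    Tendsto (fun t : ℝ => AA (q ^ 20) (t * ((q ^ 20) / q ^ k)) (q ^ k) - (1 - t)⁻¹) (𝓝[≠] 1)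
      (𝓝 (AA (q ^ 20) ((q ^ 20) / q ^ k) (q ^ k))) := by
  have e : AA (q ^ 20) ((q ^ 20) / q ^ k) (q ^ k) = AA (q ^ 20) (1 * ((q ^ 20) / q ^ k)) (q ^ k) := by rw [one_mul]
  rw [e]
  simp only [AA_t hq, mul_one]
  have hs : Summable (jt (q ^ 20) (q ^ k)) := (jt_summable (by positivity) (pow_lt_one₀ hq.le hq1 (by norm_num)) (by positivity))
  have hs' : Summable (fun n : ℤ => if n = 0 then 0 else jt (q ^ 20) (q ^ k) n) := by
    apply Summable.of_norm_bounded hs.norm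
    intro n; split_ifs <;> simp
  have h := (appell_cont hq hq1 hs' (fun n => 20 * n + k - k) (by intro n hn; simp at hn; omega)).mono_left
    (nhdsWithin_le_nhds (s := {1}ᶜ))
  have e2 : ∑' n : ℤ, (if n = 0 then 0 else jt (q ^ 20) (q ^ k) n) / (1 - q ^ (20 * n + k - k)) =
     ∑' n : ℤ, jt (q ^ 20) (q ^ k) n / (1 - q ^ (20 * n + k - k)) := by
    apply tsum_congr
    intro n
    split_ifs with h0
    · subst h0; simp
    · rfl
  rw [e2] at h
  refine h.congr' ?_
  filter_upwards [self_mem_nhdsWithin, eventually_nhdsWithin_of_eventually_nhds (near_one hq hq1)] with t hne ht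
  have hsum : Summable (fun n : ℤ => jt (q ^ 20) (q ^ k) n / (1 - q ^ (20 * n + k - k) * t)) := by
    have : Summable (fun n : ℤ => (if n = 0 then 0 else jt (q ^ 20) (q ^ k) n) / (1 - q ^ (20 * n + k - k) * t)) := by
      apply Summable.of_norm_bounded (hs.norm.mul_left (2 / (1 - q)))
      intro n
      split_ifs with h0
      · simp; have : 0 < 1 - q := by linarith
        positivity
      · have hb := denom_bound hq hq1 (show 20 * n + k - k ≠ 0 by omega) ht.1 ht.2
        rw [norm_div, Real.norm_eq_abs (1 - _)]
        have hpos : 0 < (1 - q) / 2 := by linarith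
        calc _ ≤ ‖jt (q ^ 20) (q ^ k) n‖ / ((1 - q) / 2) := by gcongr
          _ = _ := by field_simp
    apply (summable_congr_cofinite ?_).1 this
    have : {x : ℤ | x ≠ 0} ∈ cofinite := by
      rw [mem_cofinite]
      exact (Set.finite_singleton (0:ℤ)).subset (by intro x hx; simpa using hx)
    filter_upwards [this] with n hn
    have hn' : n ≠ 0 := hn
    rw [if_neg hn']
  rw [hsum.tsum_eq_add_tsum_ite 0]
  have : jt (q ^ 20) (q ^ k) 0 / (1 - q ^ (20 * 0 + k - k) * t) = (1 - t)⁻¹ := by simp [jt, tri]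
  rw [this, add_sub_cancel_left]
  apply tsum_congr
  intro n
  split_ifs <;> simp

/-- the regularised singular combination -/
lemma singular_combo {q : ℝ} (hq : 0 < q) (hq1 : q < 1) :
    let p := q ^ 20
    let A := fun k1 k0 : ℤ => AA p (p / q ^ k1) (q ^ k0)
    let jj := fun k : ℤ => j p (q ^ k);
    -A 11 11 - A 19 19 + 2 * A 15 15 =
      - (jj 11 / jj 3 * A 11 3) - (jj 19 / jj 7 * A 19 7) + jj 15 / jj 3 * A 15 3 + jj 15 / jj 7 * A 15 7 := by
  intro p A jj
  have hp : 0 < p := by positivity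
  have hp1 : p < 1 := pow_lt_one₀ hq.le hq1 (by norm_num)
  have D : ∀ k1 k0 : ℤ, (k0 - k1) % 20 ≠ 0 → k0 % 20 ≠ 0 → ∀ t : ℝ, t ≠ 1 → (1 + q) / 2 ≤ t ∧ t ≤ 2 / (1 + q) →
      AA p (t * (p / q ^ k1)) (q ^ k1) - jj k1 / jj k0 * AA p (t * (p / q ^ k1)) (q ^ k0) =
      J3 p * t * (j p (t * q ^ k0) / j p (q ^ k0)) * (j p (q ^ (k0 - k1)) / j p (t * q ^ (k0 - k1))) / j p t := by
    intro k1 k0 h1 h0 t hne ht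
    have hb : ∀ e : ℤ, q ^ e * t ≠ 1 := by
      intro e
      by_cases he : e = 0
      · subst he; simpa using hne
      · have := denom_bound hq hq1 he ht.1 ht.2
        intro h; rw [h, sub_self, abs_zero] at this; linarith
    rw [zpow_sub₀ hq.ne']
    apply AA_diff_t hp hp1 (by linarith [ht.1]) (by positivity) (by positivity)
    · intro n
      have := hb (20 * n + k0 - k1)
      rw [zpow_sub₀ hq.ne', zpow_add₀ hq.ne', ← p20_zpow] at this
      intro h; apply this; rw [← h]; ring
    · intro n
      have := hb (20 * n)
      rwa [← p20_zpow] at this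
    · exact jq_ne_zero hq hq1 k0 h0
  have L1 := (((AA_t_sing hq hq1 11).neg.sub (AA_t_sing hq hq1 19)).add ((AA_t_sing hq hq1 15).const_mul 2))
  have L2 := (((AA_t_lim hq hq1 11 3 (by norm_num)).const_mul (jj 11 / jj 3)).add ((AA_t_lim hq hq1 19 7 (by norm_num)).const_mul (jj 19 / jj 7))).sub
    (((AA_t_lim hq hq1 15 3 (by norm_num)).const_mul (jj 15 / jj 3)).add ((AA_t_lim hq hq1 15 7 (by norm_num)).const_mul (jj 15 / jj 7)))
  have L := L1.add L2
  have Z := limit_zero hp hp1 (a := q ^ (3 : ℤ)) (b := q ^ (7 : ℤ)) (c := q ^ (-12 : ℤ)) (d := q ^ (-8 : ℤ))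
    (by positivity) (by positivity) (by positivity) (by positivity)
    (jq_ne_zero hq hq1 3 (by norm_num)) (jq_ne_zero hq hq1 7 (by norm_num))
    (jq_ne_zero hq hq1 (-12) (by norm_num)) (jq_ne_zero hq hq1 (-8) (by norm_num))
  have : Tendsto (fun t : ℝ => J3 p * t * (j p (t * q ^ (3 : ℤ)) / j p (q ^ (3 : ℤ)) - j p (t * q ^ (7 : ℤ)) / j p (q ^ (7 : ℤ))) *
      (j p (q ^ (-12 : ℤ)) / j p (t * q ^ (-12 : ℤ)) - j p (q ^ (-8 : ℤ)) / j p (t * q ^ (-8 : ℤ))) / j p t) (𝓝[≠] 1)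
      (𝓝 (-A 11 11 - A 19 19 + 2 * A 15 15 + (jj 11 / jj 3 * A 11 3 + jj 19 / jj 7 * A 19 7 -
        (jj 15 / jj 3 * A 15 3 + jj 15 / jj 7 * A 15 7)))) := by
    refine Tendsto.congr' ?_ L
    filter_upwards [self_mem_nhdsWithin, eventually_nhdsWithin_of_eventually_nhds (near_one hq hq1)] with t hne ht
    have d1 := D 11 3 (by norm_num) (by norm_num) t hne ht
    have d2 := D 19 7 (by norm_num) (by norm_num) t hne ht
    have d3 := D 15 3 (by norm_num) (by norm_num) t hne ht
    have d4 := D 15 7 (by norm_num) (by norm_num) t hne ht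
    norm_num only at d1 d2 d3 d4
    linear_combination -d1 - d2 + d3 + d4
  have := tendsto_nhds_unique this Z
  linear_combination this

open Filter Topology

lemma pocN_split (p a : ℝ) (k N : ℕ) :
    pocN p a (k * N) = ∏ i ∈ Finset.range k, pocN (p ^ k) (a * p ^ i) N := by
  induction N with
  | zero => simp [pocN]
  | succ N ih =>
    simp only [pocN_succ, Finset.prod_mul_distrib]
    rw [← ih, mul_add, mul_one]
    unfold pocN
    rw [Finset.prod_range_add]
    congr 1
    apply Finset.prod_congr rfl
    intro i _
    rw [pow_add, ← pow_mul]; ring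

lemma poc_split {p : ℝ} (hp : 0 < p) (hp1 : p < 1) (a : ℝ) (k : ℕ) (hk : 0 < k) :
    poc p a = ∏ i ∈ Finset.range k, poc (p ^ k) (a * p ^ i) := by
  have h1 : Tendsto (fun N : ℕ => pocN p a (k * N)) atTop (𝓝 (poc p a)) :=
    (poc_tendsto hp hp1 a).comp (tendsto_id.const_mul_atTop' hk)
  simp only [pocN_split] at h1
  refine tendsto_nhds_unique h1 ?_
  apply tendsto_finsetProd
  intro i _
  exact poc_tendsto (by positivity) (pow_lt_one₀ hp.le hp1 hk.ne') _

lemma poc_split2 {p : ℝ} (hp : 0 < p) (hp1 : p < 1) (a : ℝ) :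
    poc p a = poc (p ^ 2) a * poc (p ^ 2) (p * a) := by
  rw [poc_split hp hp1 a 2 (by norm_num)]
  simp [Finset.prod_range_succ, mul_comm]

lemma poc_pm {p : ℝ} (hp : 0 < p) (hp1 : p < 1) (a : ℝ) :
    poc p a * poc p (-a) = poc (p ^ 2) (a ^ 2) := by
  refine tendsto_nhds_unique ((poc_tendsto hp hp1 a).mul (poc_tendsto hp hp1 (-a))) ?_
  have := poc_tendsto (p := p ^ 2) (by positivity) (pow_lt_one₀ hp.le hp1 (by norm_num)) (a ^ 2)
  refine this.congr ?_
  intro N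
  unfold pocN
  rw [← Finset.prod_mul_distrib]
  apply Finset.prod_congr rfl
  intro i _
  rw [← pow_mul]; ring

lemma j_split2 {p z : ℝ} (hp : 0 < p) (hp1 : p < 1) (hz : z ≠ 0) :
    poc (p ^ 2) (p ^ 2) * j p z = poc (p ^ 2) p * (j (p ^ 2) z * j (p ^ 2) (p * z)) := by
  have h2 : 0 < p ^ 2 := by positivity
  have h2' : p ^ 2 < 1 := pow_lt_one₀ hp.le hp1 (by norm_num)
  rw [jtp hp hp1 hz, jtp h2 h2' hz, jtp h2 h2' (mul_ne_zero hp.ne' hz), poc_split2 hp hp1 p,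
    poc_split2 hp hp1 z, poc_split2 hp hp1 (p / z)]
  have e1 : p ^ 2 / (p * z) = p / z := by field_simp
  have e2 : p * (p / z) = p ^ 2 / z := by field_simp
  rw [e1, e2, ← pow_two p]
  ring

lemma j_pm {p z : ℝ} (hp : 0 < p) (hp1 : p < 1) (hz : z ≠ 0) :
    j p z * j p (-z) = j (p ^ 2) (z ^ 2) * j (p ^ 2) p := by
  have h2 : 0 < p ^ 2 := by positivity
  have h2' : p ^ 2 < 1 := pow_lt_one₀ hp.le hp1 (by norm_num)
  rw [jtp hp hp1 hz, jtp hp hp1 (neg_ne_zero.2 hz), jtp h2 h2' (pow_ne_zero 2 hz), jtp h2 h2' hp.ne', div_neg,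
    poc_split2 hp hp1 p]
  have e1 : p ^ 2 / p = p := by field_simp
  have e2 : p ^ 2 / z ^ 2 = (p / z) ^ 2 := by field_simp
  rw [e1, e2, ← poc_pm hp hp1 z, ← poc_pm hp hp1 (p / z), ← pow_two p]
  ring

/-- normalised thetas -/
noncomputable def sk (r : ℝ) (k : ℤ) : ℝ := r ^ ((10 - k) ^ 2) * j ((r ^ 40) ^ 20) ((r ^ 40) ^ k)

lemma sk_hasSum {r : ℝ} (hr : 0 < r) (hr1 : r < 1) (k : ℤ) :
    HasSum (fun n : ℤ => (-1 : ℝ) ^ n * r ^ ((20 * n + k - 10) ^ 2)) (sk r k) := by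
  have := (jt_hasSum (p := (r ^ 40) ^ 20) (z := (r ^ 40) ^ k) (by positivity)
    (pow_lt_one₀ (by positivity) (pow_lt_one₀ hr.le hr1 (by norm_num)) (by norm_num)) (by positivity)).mul_left (r ^ ((10 - k) ^ 2))
  refine this.congr_fun ?_
  intro n
  unfold jt
  have : (r ^ 40) ^ 20 = r ^ (800 : ℤ) := by norm_cast; rw [← pow_mul]
  have h2 : r ^ 40 = r ^ (40 : ℤ) := by norm_cast
  rw [this, h2, ← zpow_mul, ← zpow_mul, ← zpow_mul]
  have : r ^ ((20 * n + k - 10) ^ 2) = r ^ ((10 - k) ^ 2) * r ^ (800 * tri n) * r ^ (40 * k * n) := by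
    rw [← zpow_add₀ hr.ne', ← zpow_add₀ hr.ne']
    congr 1
    have := two_tri n
    linear_combination (-400) * this
  rw [this]; ring

lemma sk_reflect {r : ℝ} (hr : 0 < r) (hr1 : r < 1) (k : ℤ) : sk r (20 - k) = sk r k := by
  refine HasSum.unique (sk_hasSum hr hr1 _) ?_
  rw [← (Equiv.neg ℤ).hasSum_iff]
  refine (sk_hasSum hr hr1 k).congr_fun ?_
  intro n
  simp only [Function.comp, Equiv.neg_apply]
  rw [show 20 * -n + (20 - k) - 10 = -(20 * n + k - 10) by ring, neg_sq, zpow_neg, ← inv_zpow]; norm_num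

lemma sk_add {r : ℝ} (hr : 0 < r) (hr1 : r < 1) (k : ℤ) : sk r (k + 20) = - sk r k := by
  refine HasSum.unique (sk_hasSum hr hr1 _) ?_
  have := ((Equiv.addRight (1 : ℤ)).hasSum_iff.2 (sk_hasSum hr hr1 k)).neg
  refine this.congr_fun ?_
  intro n
  simp only [Function.comp, Equiv.coe_addRight]
  rw [zpow_add_one₀ (by norm_num)]
  have : 20 * (n + 1) + k - 10 = 20 * n + (k + 20) - 10 := by ring
  rw [this]; ring

lemma sk_neg {r : ℝ} (hr : 0 < r) (hr1 : r < 1) (k : ℤ) : sk r (-k) = - sk r k := by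
  rw [← sk_reflect hr hr1 (-k), ← sk_add hr hr1 k]; congr 1; ring

lemma zlt1 {q : ℝ} (hq : 0 < q) (hq1 : q < 1) {k : ℤ} (h : 0 < k) : q ^ k < 1 := by
  have := zpow_lt_zpow_right_of_lt_one₀ hq hq1 h
  simpa using this

lemma sk_pos {r : ℝ} (hr : 0 < r) (hr1 : r < 1) (k : ℤ) (h0 : 0 < k) (h1 : k < 20) : 0 < sk r k := by
  unfold sk
  have hq : 0 < r ^ 40 := by positivity
  have hq1 : r ^ 40 < 1 := pow_lt_one₀ hr.le hr1 (by norm_num)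
  have hp1 : (r ^ 40) ^ 20 < 1 := pow_lt_one₀ hq.le hq1 (by norm_num)
  rw [jtp (by positivity) hp1 (by positivity)]
  have a1 : (r ^ 40) ^ k < 1 := zlt1 hq hq1 h0
  have a2 : (r ^ 40) ^ 20 / (r ^ 40) ^ k < 1 := by
    have : (r ^ 40) ^ 20 / (r ^ 40) ^ k = (r ^ 40) ^ (20 - k) := by
      rw [zpow_sub₀ hq.ne']; norm_cast
    rw [this]
    exact zlt1 hq hq1 (by omega)
  have := poc_pos (p := (r ^ 40) ^ 20) (by positivity) hp1 hp1
  have := poc_pos (p := (r ^ 40) ^ 20) (by positivity) hp1 a1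
  have := poc_pos (p := (r ^ 40) ^ 20) (by positivity) hp1 a2
  positivity

lemma sk_ne {r : ℝ} (hr : 0 < r) (hr1 : r < 1) (k : ℤ) (h : k % 20 ≠ 0) : sk r k ≠ 0 := by
  unfold sk
  exact mul_ne_zero (by positivity) (jq_ne_zero (by positivity) (pow_lt_one₀ hr.le hr1 (by norm_num)) k h)

lemma jk_eq {r : ℝ} (hr : 0 < r) (k : ℤ) : j ((r ^ 40) ^ 20) ((r ^ 40) ^ k) = r ^ (-(10 - k) ^ 2) * sk r k := by
  unfold sk
  rw [← mul_assoc, ← zpow_add₀ hr.ne']; simp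

/-- the three term relation -/
lemma sk_rel {r : ℝ} (hr : 0 < r) (hr1 : r < 1) (a b : ℤ) (hb : b % 20 ≠ 0) (hb' : (10 - b) % 20 ≠ 0) :
    sk r a * sk r (10 - a) * sk r (2 * b) * sk r 10 =
      sk r b * sk r (10 - b) * (sk r (a + b) * sk r (10 + a - b) + sk r (10 + a + b) * sk r (a - b)) := by
  have hq : 0 < r ^ 40 := by positivity
  have hq1 : r ^ 40 < 1 := pow_lt_one₀ hr.le hr1 (by norm_num)
  set q := r ^ 40 with hqd
  have hP : 0 < q ^ 10 := by positivity
  have hP1 : q ^ 10 < 1 := pow_lt_one₀ hq.le hq1 (by norm_num)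
  have hP2 : (q ^ 10) ^ 2 = q ^ 20 := by rw [← pow_mul]
  have ha0 : q ^ a ≠ 0 := by positivity
  have hb0 : q ^ b ≠ 0 := by positivity
  have t := T2 hP hP1 ha0 (neg_ne_zero.2 hb0)
  have s1 := j_split2 hP hP1 ha0
  have s2 := j_split2 hP hP1 hb0
  have s3 := j_pm hP hP1 hb0
  have hc : poc ((q ^ 10) ^ 2) (q ^ 10) ≠ 0 := poc_ne_zero (by positivity) (pow_lt_one₀ hP.le hP1 (by norm_num)) hP1
  have hd : poc ((q ^ 10) ^ 2) ((q ^ 10) ^ 2) ≠ 0 := poc_ne_zero (by positivity) (pow_lt_one₀ hP.le hP1 (by norm_num)) (pow_lt_one₀ hP.le hP1 (by norm_num))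
  set c := poc ((q ^ 10) ^ 2) (q ^ 10)
  set d := poc ((q ^ 10) ^ 2) ((q ^ 10) ^ 2)
  have q10 : q ^ 10 = q ^ (10 : ℤ) := by norm_cast
  have z1 : -(q ^ a * -q ^ b) = q ^ (a + b) := by rw [zpow_add₀ hq.ne']; ring
  have z2 : -(q ^ 10 * -q ^ b / q ^ a) = q ^ (10 - a + b) := by
    rw [zpow_add₀ hq.ne', zpow_sub₀ hq.ne', q10]; field_simp
  have z3 : -(q ^ 10 * q ^ a * -q ^ b) = q ^ (10 + a + b) := by
    rw [zpow_add₀ hq.ne', zpow_add₀ hq.ne', q10]; ring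
  have z4 : -(-q ^ b / q ^ a) = q ^ (b - a) := by
    rw [zpow_sub₀ hq.ne']; field_simp
  have z5 : q ^ 10 * q ^ a = q ^ (10 + a) := by rw [zpow_add₀ hq.ne', q10]
  have z6 : q ^ 10 * q ^ b = q ^ (10 + b) := by rw [zpow_add₀ hq.ne', q10]
  have z7 : (q ^ b) ^ 2 = q ^ (2 * b) := by rw [mul_comm, zpow_mul]; norm_cast
  rw [z1, z2, z3, z4] at t
  rw [z5] at s1
  rw [z6] at s2
  rw [z7] at s3
  rw [hP2] at t s1 s2 s3
  rw [q10] at s3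
  rw [show j (q ^ (10:ℤ)) = j (q ^ 10) by rw [q10]] at s3
  simp only [hqd] at t s1 s2 s3
  simp only [jk_eq hr] at t s1 s2 s3
  have hsb := sk_ne hr hr1 b hb
  have hsb' := sk_ne hr hr1 (10 - b) hb'
  have e1 : sk r (10 + a) = sk r (10 - a) := by rw [← sk_reflect hr hr1]; congr 1; ring
  have e2 : sk r (10 + b) = sk r (10 - b) := by rw [← sk_reflect hr hr1]; congr 1; ring
  have e3 : sk r (10 - a + b) = sk r (10 + a - b) := by rw [← sk_reflect hr hr1]; congr 1; ring
  have e4 : sk r (b - a) = - sk r (a - b) := by rw [← sk_neg hr hr1]; congr 1; ring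
  rw [e1] at s1
  rw [e2] at s2
  rw [e3, e4] at t
  have hA : j ((r ^ 40) ^ 10) ((r ^ 40) ^ b) ≠ 0 := by
    intro h
    rw [h, mul_zero] at s2
    have : r ^ (-(10 - b) ^ 2) ≠ 0 := by positivity
    have : r ^ (-(10 - (10 + b)) ^ 2) ≠ 0 := by positivity
    simp_all
  have key : (r ^ (-(10 - a) ^ 2) * sk r a * (r ^ (-(10 - (10 + a)) ^ 2) * sk r (10 - a))) *
      (r ^ (-(10 - 2 * b) ^ 2) * sk r (2 * b) * (r ^ (-(10 - 10) ^ 2 : ℤ) * sk r 10)) =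
      (r ^ (-(10 - b) ^ 2) * sk r b * (r ^ (-(10 - (10 + b)) ^ 2) * sk r (10 - b))) *
      (r ^ (-(10 - (a + b)) ^ 2) * sk r (a + b) * (r ^ (-(10 - (10 - a + b)) ^ 2) * sk r (10 + a - b)) -
        (r ^ 40) ^ a * (r ^ (-(10 - (10 + a + b)) ^ 2) * sk r (10 + a + b) * (r ^ (-(10 - (b - a)) ^ 2) * -sk r (a - b)))) := by
    apply mul_left_cancel₀ hc
    linear_combination (-(r ^ (-(10 - 2 * b) ^ 2) * sk r (2 * b) * (r ^ (-(10 - 10) ^ 2 : ℤ) * sk r 10))) * s1 +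
      d * j ((r ^ 40) ^ 10) ((r ^ 40) ^ b) * t - d * j ((r ^ 40) ^ 10) ((r ^ 40) ^ a) * s3 + (r ^ (-(10 - (a + b)) ^ 2) * sk r (a + b) * (r ^ (-(10 - (10 - a + b)) ^ 2) * sk r (10 + a - b)) -
        (r ^ 40) ^ a * (r ^ (-(10 - (10 + a + b)) ^ 2) * sk r (10 + a + b) * (r ^ (-(10 - (b - a)) ^ 2) * -sk r (a - b)))) * s2
  have E1 : r ^ (-(10 - a) ^ 2) * r ^ (-(10 - (10 + a)) ^ 2) * r ^ (-(10 - 2 * b) ^ 2) * r ^ (-(10 - 10) ^ 2 : ℤ) =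
     r ^ (-(100 - 20 * a - 20 * b + 2 * a ^ 2 + 2 * b ^ 2) - 100 + 20 * b - 2 * b ^ 2) := by
    simp only [← zpow_add₀ hr.ne']; congr 1; ring
  have E2 : r ^ (-(10 - b) ^ 2) * r ^ (-(10 - (10 + b)) ^ 2) * r ^ (-(10 - (a + b)) ^ 2) * r ^ (-(10 - (10 - a + b)) ^ 2) =
     r ^ (-(100 - 20 * a - 20 * b + 2 * a ^ 2 + 2 * b ^ 2) - 100 + 20 * b - 2 * b ^ 2) := by
    simp only [← zpow_add₀ hr.ne']; congr 1; ring
  have E3 : r ^ (-(10 - b) ^ 2) * r ^ (-(10 - (10 + b)) ^ 2) * (r ^ 40) ^ a * r ^ (-(10 - (10 + a + b)) ^ 2) * r ^ (-(10 - (b - a)) ^ 2) =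
     r ^ (-(100 - 20 * a - 20 * b + 2 * a ^ 2 + 2 * b ^ 2) - 100 + 20 * b - 2 * b ^ 2) := by
    have : (r ^ 40) ^ a = r ^ (40 * a) := by rw [zpow_mul]; norm_cast
    rw [this]
    simp only [← zpow_add₀ hr.ne']; congr 1; ring
  have hE : r ^ (-(100 - 20 * a - 20 * b + 2 * a ^ 2 + 2 * b ^ 2) - 100 + 20 * b - 2 * b ^ 2) ≠ 0 := by positivity
  apply mul_left_cancel₀ hE
  linear_combination key - (sk r a * sk r (10 - a) * sk r (2 * b) * sk r 10) * E1 +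
    (sk r b * sk r (10 - b) * (sk r (a + b) * sk r (10 + a - b))) * E2 + (sk r b * sk r (10 - b) * (sk r (10 + a + b) * sk r (a - b))) * E3

open Filter Topology

def latC : Fin 5 → ℤ × ℤ := ![(0, 0), (1, 0), (0, -1), (0, 1), (-1, 0)]

def latF (x : Fin 5 × (ℤ × ℤ)) : ℤ × ℤ :=
  ((latC x.1).1 + 2 * x.2.1 + x.2.2, (latC x.1).2 + x.2.1 - 2 * x.2.2)

lemma latF_bij : Function.Bijective latF := by
  constructor
  · rintro ⟨i, a, b⟩ ⟨i', a', b'⟩ h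
    simp only [latF, Prod.mk.injEq] at h
    obtain ⟨h1, h2⟩ := h
    have : i = i' ∧ a = a' ∧ b = b' := by
      fin_cases i <;> fin_cases i' <;> simp [latC] at h1 h2 ⊢ <;> omega
    obtain ⟨rfl, rfl, rfl⟩ := this
    rfl
  · rintro ⟨m, n⟩
    have h : (m - 2 * n) % 5 = 0 ∨ (m - 2 * n) % 5 = 1 ∨ (m - 2 * n) % 5 = 2 ∨ (m - 2 * n) % 5 = 3 ∨ (m - 2 * n) % 5 = 4 := by omega
    rcases h with h | h | h | h | h
    · refine ⟨(0, (2 * m + n) / 5, (m - 2 * n) / 5), ?_⟩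
      simp [latF, latC]; omega
    · refine ⟨(1, (2 * m + n - 2) / 5, (m - 2 * n - 1) / 5), ?_⟩
      simp [latF, latC]; omega
    · refine ⟨(2, (2 * m + n + 1) / 5, (m - 2 * n - 2) / 5), ?_⟩
      simp [latF, latC]; omega
    · refine ⟨(3, (2 * m + n - 1) / 5, (m - 2 * n + 2) / 5), ?_⟩
      simp [latF, latC]; omega
    · refine ⟨(4, (2 * m + n + 2) / 5, (m - 2 * n + 1) / 5), ?_⟩
      simp [latF, latC]; omega

lemma prod_hasSum {f g : ℤ → ℝ} {x y : ℝ} (hf : HasSum f x) (hg : HasSum g y) :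
    HasSum (fun a : ℤ × ℤ => f a.1 * g a.2) (x * y) := by
  have h1 := summable_mul_of_summable_norm hf.summable.norm hg.summable.norm
  rw [h1.hasSum_iff, ← hf.summable.tsum_mul_tsum hg.summable h1, hf.tsum_eq, hg.tsum_eq]

noncomputable def phi (r : ℝ) : ℝ := j ((r ^ 40) ^ 4) ((r ^ 40) ^ 2)

lemma phi_hasSum {r : ℝ} (hr : 0 < r) (hr1 : r < 1) :
    HasSum (fun n : ℤ => (-1 : ℝ) ^ n * r ^ (80 * n ^ 2)) (phi r) := by
  have := (jt_hasSum (p := (r ^ 40) ^ 4) (z := (r ^ 40) ^ 2) (by positivity)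
    (pow_lt_one₀ (by positivity) (pow_lt_one₀ hr.le hr1 (by norm_num)) (by norm_num)) (by positivity))
  refine this.congr_fun ?_
  intro n
  unfold jt
  have : (r ^ 40) ^ 4 = r ^ (160 : ℤ) := by norm_cast; rw [← pow_mul]
  have h2 : (r ^ 40) ^ 2 = r ^ (80 : ℤ) := by norm_cast; rw [← pow_mul]
  rw [this, h2, ← zpow_mul, ← zpow_mul, mul_assoc, ← zpow_add₀ hr.ne']
  congr 2
  have := two_tri n
  linear_combination (-80) * this

set_option maxHeartbeats 2000000 in
lemma phi_sq {r : ℝ} (hr : 0 < r) (hr1 : r < 1) :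
    phi r ^ 2 = sk r 10 ^ 2 - 4 * (sk r 2 * sk r 6) := by
  have h1 := prod_hasSum (phi_hasSum hr hr1) (phi_hasSum hr hr1)
  rw [← (Equiv.ofBijective latF latF_bij).hasSum_iff] at h1
  have H : ∀ (k l : ℤ), HasSum (fun a : ℤ × ℤ => ((-1 : ℝ) ^ a.1 * r ^ ((20 * a.1 + k - 10) ^ 2)) * ((-1 : ℝ) ^ a.2 * r ^ ((20 * a.2 + l - 10) ^ 2))) (sk r k * sk r l) :=
    fun k l => prod_hasSum (sk_hasSum hr hr1 k) (sk_hasSum hr hr1 l)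
  have h2 := h1.summable.tsum_prod' (fun i => h1.summable.comp_injective (Prod.mk_right_injective i))
  rw [h1.tsum_eq, tsum_fintype, Fin.sum_univ_five] at h2
  have e18 : sk r 18 = sk r 2 := by rw [← sk_reflect hr hr1]; norm_num
  have e14 : sk r 14 = sk r 6 := by rw [← sk_reflect hr hr1]; norm_num
  have key : ∀ (i : Fin 5) (k l : ℤ) (ε : ℝ), (∀ a b : ℤ, (-1 : ℝ) ^ (latF (i, (a, b))).1 * (-1) ^ (latF (i, (a, b))).2 = ε * ((-1) ^ a * (-1) ^ b)) →
     (∀ a b : ℤ, 80 * (latF (i, (a, b))).1 ^ 2 + 80 * (latF (i, (a, b))).2 ^ 2 = (20 * a + k - 10) ^ 2 + (20 * b + l - 10) ^ 2) →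
     ∑' c : ℤ × ℤ, ((fun a : ℤ × ℤ => ((-1 : ℝ) ^ a.1 * r ^ (80 * a.1 ^ 2)) * ((-1 : ℝ) ^ a.2 * r ^ (80 * a.2 ^ 2))) ∘ (Equiv.ofBijective latF latF_bij)) (i, c) = ε * (sk r k * sk r l) := by
    intro i k l ε hs he
    refine (((H k l).mul_left ε).congr_fun ?_).tsum_eq
    rintro ⟨a, b⟩
    simp only [Function.comp, Equiv.ofBijective_apply]
    have := hs a b
    have e := he a b
    have : r ^ (80 * (latF (i, (a, b))).1 ^ 2) * r ^ (80 * (latF (i, (a, b))).2 ^ 2) = r ^ ((20 * a + k - 10) ^ 2) * r ^ ((20 * b + l - 10) ^ 2) := by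
      rw [← zpow_add₀ hr.ne', ← zpow_add₀ hr.ne', e]
    linear_combination (r ^ (80 * (latF (i, (a, b))).1 ^ 2) * r ^ (80 * (latF (i, (a, b))).2 ^ 2)) * hs a b + ε * ((-1) ^ a * (-1) ^ b) * this
  have hm : (-1 : ℝ) ≠ 0 := by norm_num
  have sg : ∀ b : ℤ, ((-1 : ℝ) ^ b) ^ 2 = 1 := by
    intro b; rcases Int.even_or_odd b with h | h
    · simp [h.neg_one_zpow]
    · simp [h.neg_one_zpow]
  have sgn : ∀ (x y a b : ℤ), (-1 : ℝ) ^ (x + 2 * a + b) * (-1) ^ (y + a - 2 * b) = (-1) ^ (x + y) * ((-1) ^ a * (-1) ^ b) := by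
    intro x y a b
    rw [← zpow_add₀ hm, show x + 2 * a + b + (y + a - 2 * b) = x + y + (a + b) + 2 * (a - b) by ring, zpow_add₀ hm,
      zpow_add₀ hm (x + y), zpow_add₀ hm a, mul_comm (2 : ℤ), zpow_mul]
    have := sg (a - b)
    norm_cast at this ⊢
    rw [this, mul_one]
  rw [key 0 10 10 1, key 1 18 14 (-1), key 2 6 18 (-1), key 3 14 2 (-1), key 4 2 6 (-1), e18, e14] at h2
  · linear_combination h2
  all_goals first
    | (intro a b; simp only [latF]; rw [sgn]; simp [latC]; done)
    | (intro a b; simp only [latF, latC]; simp; ring)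

lemma phi_prod {r : ℝ} (hr : 0 < r) (hr1 : r < 1) :
    phi r * poc ((r ^ 40) ^ 20) ((r ^ 40) ^ 20) ^ 6 * r ^ 200 = sk r 2 ^ 2 * sk r 4 * sk r 6 ^ 2 * sk r 8 * sk r 10 := by
  have hq : 0 < r ^ 40 := by positivity
  have hq1 : r ^ 40 < 1 := pow_lt_one₀ hr.le hr1 (by norm_num)
  unfold phi sk
  set q := r ^ 40 with hqd
  have h4 : 0 < q ^ 4 := by positivity
  have h41 : q ^ 4 < 1 := pow_lt_one₀ hq.le hq1 (by norm_num)
  have hp : 0 < q ^ 20 := by positivity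
  have hp1 : q ^ 20 < 1 := pow_lt_one₀ hq.le hq1 (by norm_num)
  have e0 : q ^ 4 / q ^ 2 = q ^ 2 := by field_simp
  have jj : ∀ k l : ℕ, k + l = 20 → j (q ^ 20) (q ^ (k : ℤ)) = poc (q ^ 20) (q ^ 20) * poc (q ^ 20) (q ^ k) * poc (q ^ 20) (q ^ l) := by
    intro k l h
    rw [jtp hp hp1 (by positivity)]
    have e1 : q ^ 20 / q ^ (k : ℤ) = q ^ l := by
      rw [← h, zpow_natCast, pow_add]; field_simp
    rw [e1, zpow_natCast]
  have j2 := jj 2 18 (by norm_num)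
  have j4 := jj 4 16 (by norm_num)
  have j6 := jj 6 14 (by norm_num)
  have j8 := jj 8 12 (by norm_num)
  have j10 := jj 10 10 (by norm_num)
  push_cast at j2 j4 j6 j8 j10
  rw [jtp h4 h41 (by positivity), e0, j2, j4, j6, j8, j10, poc_split h4 h41 _ 5 (by norm_num), poc_split h4 h41 (q ^ 2) 5 (by norm_num)]
  simp only [Finset.prod_range_succ, Finset.prod_range_zero, one_mul, ← pow_mul, ← pow_add]
  norm_num
  have e : r ^ 200 = (r ^ 64) ^ 2 * r ^ 36 * (r ^ 16) ^ 2 * r ^ 4 := by ring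
  rw [e]
  ring

/-- normalised cube of the eta product -/
noncomputable def GJ (r : ℝ) : ℝ := r ^ 100 * J3 ((r ^ 40) ^ 20)

lemma GJ_pos {r : ℝ} (hr : 0 < r) (hr1 : r < 1) : 0 < GJ r := by
  have hp1 : (r ^ 40) ^ 20 < 1 := pow_lt_one₀ (by positivity) (pow_lt_one₀ hr.le hr1 (by norm_num)) (by norm_num)
  unfold GJ
  rw [J3_eq (by positivity) hp1]
  have := poc_pos (by positivity) hp1 hp1
  positivity

lemma GJ_rel {r : ℝ} (hr : 0 < r) (hr1 : r < 1) :
    GJ r ^ 4 * (sk r 10 ^ 2 - 4 * (sk r 2 * sk r 6)) = (sk r 2 ^ 2 * sk r 4 * sk r 6 ^ 2 * sk r 8 * sk r 10) ^ 2 := by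
  have hp1 : (r ^ 40) ^ 20 < 1 := pow_lt_one₀ (by positivity) (pow_lt_one₀ hr.le hr1 (by norm_num)) (by norm_num)
  rw [← phi_prod hr hr1, ← phi_sq hr hr1]
  unfold GJ
  rw [J3_eq (by positivity) hp1]
  ring

noncomputable def alt0 (s1 s2 s3 s4 s5 s6 s7 s8 s9 s10 G : ℝ) : ℝ :=
  (G^5 * s4^2 * s6^2 * s10^1) / (s1^2 * s2^2 * s3^4 * s5^1 * s7^4 * s8^4 * s9^2)

noncomputable def alF1 (s1 s2 s3 s4 s5 s6 s7 s8 s9 s10 G : ℝ) : ℝ :=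
  2 * ((G^5 * s10^1) / (s1^2 * s3^3 * s4^1 * s5^3 * s7^3 * s8^1 * s9^2))

noncomputable def alt2 (s1 s2 s3 s4 s5 s6 s7 s8 s9 s10 G : ℝ) : ℝ :=
  (G^5 * s2^2 * s10^1) / (s1^4 * s3^2 * s4^2 * s5^1 * s6^2 * s7^2 * s9^4)

noncomputable def alF3 (s1 s2 s3 s4 s5 s6 s7 s8 s9 s10 G : ℝ) : ℝ :=
  (G^5 * s6^1 * s10^1) / (s1^2 * s2^1 * s3^4 * s5^1 * s7^4 * s8^2 * s9^2)

noncomputable def alF4 (s1 s2 s3 s4 s5 s6 s7 s8 s9 s10 G : ℝ) : ℝ :=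
  (G^5 * s2^1 * s10^1) / (s1^3 * s3^3 * s4^2 * s5^1 * s6^1 * s7^3 * s9^3)

set_option maxHeartbeats 4000000 in
lemma theta_alg (s1 s2 s3 s4 s5 s6 s7 s8 s9 s10 G : ℝ) (h1 : 0 < s1) (h2 : 0 < s2) (h3 : 0 < s3) (h4 : 0 < s4) (h5 : 0 < s5) (h6 : 0 < s6) (h7 : 0 < s7)
    (h8 : 0 < s8) (h9 : 0 < s9) (h10 : 0 < s10) (hG : 0 < G)
    (r1 : s1*s9*s4*s10 = s2*s8*(s3*s9-s1*s7))
    (r2 : s8*s2*s2*s10 = s1*s9*(s3*s9+s1*s7))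
    (r3 : s3*s7*s8*s10 = s4*s6*(s7*s9-s1*s3))
    (r4 : s6*s4*s6*s10 = s3*s7*(s7*s9+s1*s3))
    (r5 : s5*s5*s4*s10 = s2*s8*(s7^2+s3^2))
    (r6 : s2*s8*s10*s10 = s5*s5*(s7^2-s3^2))
    (r7 : s5*s5*s8*s10 = s4*s6*(s9^2+s1^2))
    (r8 : s4*s6*s10*s10 = s5*s5*(s9^2-s1^2))
    (rK : G^4 * (s10^2 - 4*(s2*s6)) = (s2^2*s4*s6^2*s8*s10)^2) :
    (s9+s1) * alt0 s1 s2 s3 s4 s5 s6 s7 s8 s9 s10 G - (s7-s3) * alF4 s1 s2 s3 s4 s5 s6 s7 s8 s9 s10 G - s5 * alt2 s1 s2 s3 s4 s5 s6 s7 s8 s9 s10 G = -(G * s4 * (s7*s9+s1*s3) / (s3*s7*s8^2)) ∧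
    (s9+s1) * alF1 s1 s2 s3 s4 s5 s6 s7 s8 s9 s10 G - (s7-s3) * alt0 s1 s2 s3 s4 s5 s6 s7 s8 s9 s10 G - s5 * alF3 s1 s2 s3 s4 s5 s6 s7 s8 s9 s10 G = G * (s3*s9+s1*s7) / (s3*s7*s8) ∧
    (s9+s1) * alt2 s1 s2 s3 s4 s5 s6 s7 s8 s9 s10 G - (s7-s3) * alF1 s1 s2 s3 s4 s5 s6 s7 s8 s9 s10 G - s5 * alF4 s1 s2 s3 s4 s5 s6 s7 s8 s9 s10 G = -(G * (s3*s9+s1*s7) / (s3*s4*s7)) + -(G * (s7^2-s3^2) / (s3*s7*s8)) ∧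
    (s9+s1) * alF3 s1 s2 s3 s4 s5 s6 s7 s8 s9 s10 G - (s7-s3) * alt2 s1 s2 s3 s4 s5 s6 s7 s8 s9 s10 G - s5 * alt0 s1 s2 s3 s4 s5 s6 s7 s8 s9 s10 G = G * (s7^2-s3^2) / (s3*s4*s7) + G * (s7+s3) * s4 * s5 / (s3*s7*s8^2) ∧
    (s9+s1) * alF4 s1 s2 s3 s4 s5 s6 s7 s8 s9 s10 G - (s7-s3) * alF3 s1 s2 s3 s4 s5 s6 s7 s8 s9 s10 G - s5 * alF1 s1 s2 s3 s4 s5 s6 s7 s8 s9 s10 G = 0 := by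
  obtain ⟨x1, rfl⟩ : ∃ x, Real.exp x = s1 := ⟨_, Real.exp_log h1⟩
  obtain ⟨x2, rfl⟩ : ∃ x, Real.exp x = s2 := ⟨_, Real.exp_log h2⟩
  obtain ⟨x3, rfl⟩ : ∃ x, Real.exp x = s3 := ⟨_, Real.exp_log h3⟩
  obtain ⟨x4, rfl⟩ : ∃ x, Real.exp x = s4 := ⟨_, Real.exp_log h4⟩
  obtain ⟨x5, rfl⟩ : ∃ x, Real.exp x = s5 := ⟨_, Real.exp_log h5⟩
  obtain ⟨x6, rfl⟩ : ∃ x, Real.exp x = s6 := ⟨_, Real.exp_log h6⟩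
  obtain ⟨x7, rfl⟩ : ∃ x, Real.exp x = s7 := ⟨_, Real.exp_log h7⟩
  obtain ⟨x8, rfl⟩ : ∃ x, Real.exp x = s8 := ⟨_, Real.exp_log h8⟩
  obtain ⟨x9, rfl⟩ : ∃ x, Real.exp x = s9 := ⟨_, Real.exp_log h9⟩
  obtain ⟨x10, rfl⟩ : ∃ x, Real.exp x = s10 := ⟨_, Real.exp_log h10⟩
  obtain ⟨ga, rfl⟩ : ∃ x, Real.exp x = G := ⟨_, Real.exp_log hG⟩
  have P : ∀ x y : ℝ, 0 < y → Real.exp x * 1 = y * 1 → x = Real.log y := by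
    intro x y _ h; rw [← Real.log_exp x]; congr 1; linarith
  have pos := Real.exp_pos
  obtain ⟨u, hu⟩ : ∃ u, u = Real.exp (x1 - x9) := ⟨_, rfl⟩
  obtain ⟨v, hv⟩ : ∃ v, v = Real.exp (x3 - x7) := ⟨_, rfl⟩
  have e1 : Real.exp x1 = Real.exp x9 * u := by rw [hu, ← Real.exp_add]; ring_nf
  have e3 : Real.exp x3 = Real.exp x7 * v := by rw [hv, ← Real.exp_add]; ring_nf
  have hu0 : 0 < u := by rw [hu]; positivity
  have hv0 : 0 < v := by rw [hv]; positivity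
  have fac : ∀ {a b c : ℝ}, 0 < a → 0 < b → a = b * c → 0 < c := by
    intro a b c ha hb h; by_contra hc; push Not at hc; nlinarith [mul_nonneg hb.le (neg_nonneg.2 hc)]
  have p1 : 0 < Real.exp x3 * Real.exp x9 - Real.exp x1 * Real.exp x7 := fac (by positivity) (by positivity) r1
  have p6 : 0 < Real.exp x7 ^ 2 - Real.exp x3 ^ 2 := fac (by positivity) (by positivity) r6
  have huv : u < v := by
    rw [e1, e3] at p1
    have : 0 < (Real.exp x7 * Real.exp x9) * (v - u) := by linarith
    have := (pos_iff_pos_of_mul_pos this).1 (by positivity)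
    linarith
  have hv1 : v < 1 := by
    rw [e3] at p6
    have : 0 < Real.exp x7 ^ 2 * (1 - v ^ 2) := by linarith
    have := (pos_iff_pos_of_mul_pos this).1 (by positivity)
    nlinarith
  have hu1 : u < 1 := huv.trans hv1
  have huv1 : u * v < 1 := by nlinarith
  obtain ⟨U, hU⟩ : ∃ x, Real.exp x = u := ⟨_, Real.exp_log (by positivity)⟩
  obtain ⟨V, hV⟩ : ∃ x, Real.exp x = v := ⟨_, Real.exp_log (by positivity)⟩
  obtain ⟨a1, ha1⟩ : ∃ x, Real.exp x = (1-u) := ⟨_, Real.exp_log (by linarith)⟩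
  obtain ⟨a2, ha2⟩ : ∃ x, Real.exp x = (1+u) := ⟨_, Real.exp_log (by positivity)⟩
  obtain ⟨a3, ha3⟩ : ∃ x, Real.exp x = (1+u^2) := ⟨_, Real.exp_log (by positivity)⟩
  obtain ⟨b1, hb1⟩ : ∃ x, Real.exp x = (1-v) := ⟨_, Real.exp_log (by linarith)⟩
  obtain ⟨b2, hb2⟩ : ∃ x, Real.exp x = (1+v) := ⟨_, Real.exp_log (by positivity)⟩
  obtain ⟨b3, hb3⟩ : ∃ x, Real.exp x = (1+v^2) := ⟨_, Real.exp_log (by positivity)⟩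
  obtain ⟨d1, hd1⟩ : ∃ x, Real.exp x = (v-u) := ⟨_, Real.exp_log (by linarith)⟩
  obtain ⟨d2, hd2⟩ : ∃ x, Real.exp x = (v+u) := ⟨_, Real.exp_log (by positivity)⟩
  obtain ⟨f1, hf1⟩ : ∃ x, Real.exp x = (1-u*v) := ⟨_, Real.exp_log (by linarith)⟩
  obtain ⟨f2, hf2⟩ : ∃ x, Real.exp x = (1+u*v) := ⟨_, Real.exp_log (by positivity)⟩
  have lu : x1 = x9 + U := by
    rw [← Real.exp_eq_exp, Real.exp_add, hU, e1]
  have lv : x3 = x7 + V := by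
    rw [← Real.exp_eq_exp, Real.exp_add, hV, e3]
  simp only [e1, e3] at r1 r2 r3 r4 r5 r6 r7 r8
  have ee1 := e1.symm
  have ee3 := e3.symm
  have l1 : x1+x9+x4+x10 = x2+x8+x7+x9+d1 := by
    rw [← Real.exp_eq_exp]; simp only [Real.exp_add, e1, e3, hd1, hd2, hf1, hf2, hb1, hb2, hb3, ha1, ha2, ha3]
    linear_combination r1
  have l2 : x8+x2+x2+x10 = x1+x9+x7+x9+d2 := by
    rw [← Real.exp_eq_exp]; simp only [Real.exp_add, e1, e3, hd1, hd2, hf1, hf2, hb1, hb2, hb3, ha1, ha2, ha3]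
    linear_combination r2
  have l3 : x3+x7+x8+x10 = x4+x6+x7+x9+f1 := by
    rw [← Real.exp_eq_exp]; simp only [Real.exp_add, e1, e3, hd1, hd2, hf1, hf2, hb1, hb2, hb3, ha1, ha2, ha3]
    linear_combination r3
  have l4 : x6+x4+x6+x10 = x3+x7+x7+x9+f2 := by
    rw [← Real.exp_eq_exp]; simp only [Real.exp_add, e1, e3, hd1, hd2, hf1, hf2, hb1, hb2, hb3, ha1, ha2, ha3]
    linear_combination r4
  have l5 : x5+x5+x4+x10 = x2+x8+x7+x7+b3 := by
    rw [← Real.exp_eq_exp]; simp only [Real.exp_add, e1, e3, hd1, hd2, hf1, hf2, hb1, hb2, hb3, ha1, ha2, ha3]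
    linear_combination r5
  have l6 : x2+x8+x10+x10 = x5+x5+x7+x7+b1+b2 := by
    rw [← Real.exp_eq_exp]; simp only [Real.exp_add, e1, e3, hd1, hd2, hf1, hf2, hb1, hb2, hb3, ha1, ha2, ha3]
    linear_combination r6
  have l7 : x5+x5+x8+x10=x4+x6+x9+x9+a3 := by
    rw [← Real.exp_eq_exp]; simp only [Real.exp_add, e1, e3, hd1, hd2, hf1, hf2, hb1, hb2, hb3, ha1, ha2, ha3]
    linear_combination r7
  have l8 : x4+x6+x10+x10=x5+x5+x9+x9+a1+a2 := by
    rw [← Real.exp_eq_exp]; simp only [Real.exp_add, e1, e3, hd1, hd2, hf1, hf2, hb1, hb2, hb3, ha1, ha2, ha3]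
    linear_combination r8
  have E1l : ((2:ℕ):ℝ)*d1 + d2 + ((2:ℕ):ℝ)*f1 + f2 = U + V + (a1+a2+a3) + (b1+b2+b3) := by
    push_cast; linarith
  have E1p := congrArg Real.exp E1l
  simp only [Real.exp_add, Real.exp_nat_mul, hU, hV, hd1, hd2, hf1, hf2, hb1, hb2, hb3, ha1, ha2, ha3] at E1p
  have hR : (1)*u^0*v^2 + (-1)*u^1*v^0 + (-1)*u^1*v^1 + (-1)*u^1*v^2 + (1)*u^2*v^1 + (1)*u^2*v^2 + (1)*u^2*v^3 + (-1)*u^3*v^1 = 0 := by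
    have hR' : 0 < v + u*v - u*v^2 - u^2 + u^2*v - u^2*v^2 - u^3*v^2 + u*v^3 := by
      have i1 : 0 < v - u^2 := by
        have j1 : 0 < u * (1 - u) := mul_pos hu0 (by linarith)
        have j2 : 0 < v - u := by linarith
        linear_combination j1 + j2
      have i2 : 0 ≤ u*v*(1-v) := mul_nonneg (by positivity) (by linarith)
      have i3 : 0 ≤ u^2*v*(1-v) := mul_nonneg (by positivity) (by linarith)
      have i4 : 0 < u*v^2*(v-u^2) := by positivity
      linear_combination i1 + i2 + i3 + i4
    apply (mul_eq_zero.1 ?_).resolve_right hR'.ne'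
    linear_combination (1) * E1p
  have E2l : ((3:ℕ):ℝ)*V + d1 + ((2:ℕ):ℝ)*a1 + a2 + ((2:ℕ):ℝ)*a3 = ((2:ℕ):ℝ)*U + b2 + b3 + ((3:ℕ):ℝ)*f1 + f2 := by
    rw [← Real.exp_eq_exp]
    simp only [Real.exp_add, Real.exp_nat_mul, hU, hV, hd1, hd2, hf1, hf2, hb1, hb2, hb3, ha1, ha2, ha3]
    linear_combination ((1)*u^0*v^2 + (1)*u^1*v^0 + (-1)*u^2*v^1 + (-1)*u^2*v^3 + (-1)*u^3*v^1 + (-1)*u^3*v^3 + (1)*u^4*v^4 + (1)*u^5*v^2) * hR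
  have E3l : ((3:ℕ):ℝ)*V + ((2:ℕ):ℝ)*a3 + a2 + ((3:ℕ):ℝ)*a1 = U + d2 + ((3:ℕ):ℝ)*f1 + ((2:ℕ):ℝ)*f2 := by
    rw [← Real.exp_eq_exp]
    simp only [Real.exp_add, Real.exp_nat_mul, hU, hV, hd1, hd2, hf1, hf2, hb1, hb2, hb3, ha1, ha2, ha3]
    linear_combination ((1)*u^0*v^1 + (1)*u^1*v^0 + (-1)*u^1*v^1 + (-1)*u^2*v^2 + (-1)*u^3*v^1 + (-1)*u^4*v^2 + (1)*u^4*v^3 + (1)*u^5*v^2) * hR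
  push_cast at E1l E2l E3l
  have hA : Real.exp x9 + Real.exp x1 = Real.exp (x3+x4+x7+x10-x2-x5-x8) := by
    have : x3+x4+x7+x10-x2-x5-x8 = x9 + a2 := by linarith
    rw [this, Real.exp_add, e1, ha2]; ring
  have hB : Real.exp x7 - Real.exp x3 = Real.exp (x1+x8+x9+x10-x4-x5-x6) := by
    have : x1+x8+x9+x10-x4-x5-x6 = x7 + b1 := by linarith
    rw [this, Real.exp_add, e3, hb1]; ring
  have hB2 : Real.exp x7 + Real.exp x3 = Real.exp (x7 + b2) := by
    rw [Real.exp_add, e3, hb2]; ring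
  have hC : Real.exp x3 * Real.exp x9 + Real.exp x1 * Real.exp x7 = Real.exp (x7 + x9 + d2) := by
    simp only [Real.exp_add, e1, e3, hd2]; ring
  have hD : Real.exp x7 * Real.exp x9 + Real.exp x1 * Real.exp x3 = Real.exp (x7 + x9 + f2) := by
    simp only [Real.exp_add, e1, e3, hf2]; ring
  have hE : Real.exp x7 ^ 2 - Real.exp x3 ^ 2 = Real.exp (x7 + x7 + b1 + b2) := by
    simp only [Real.exp_add, e3, hb1, hb2]; ring
  have k26 : Real.exp x2 * Real.exp x6 * ((v-u)*(1-u*v)) = Real.exp x10 ^ 2 * (u*v) := by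
    have : x2+x6+(d1+f1) = x10+x10+(U+V) := by linarith
    have := congrArg Real.exp this
    simp only [Real.exp_add, hU, hV, hd1, hf1] at this
    linear_combination this
  have kY : (Real.exp x10 ^ 2 - 4 * (Real.exp x2 * Real.exp x6)) * ((v-u)*(1-u*v)) = Real.exp x10 ^ 2 * ((v-u)*(1-u*v) - 4*(u*v)) := by
    linear_combination (-4) * k26
  have pY : 0 < (v-u)*(1-u*v) - 4*(u*v) := by
    have q1 : 0 < Real.exp x10 ^ 2 - 4 * (Real.exp x2 * Real.exp x6) := fac (a := (Real.exp x2^2*Real.exp x4*Real.exp x6^2*Real.exp x8*Real.exp x10)^2) (by positivity) (by positivity) rK.symm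
    have q2 : 0 < (v-u)*(1-u*v) := mul_pos (by linarith) (by linarith)
    exact fac (mul_pos q1 q2) (by positivity) kY
  obtain ⟨y, hy⟩ : ∃ x, Real.exp x = (v-u)*(1-u*v) - 4*(u*v) := ⟨_, Real.exp_log pY⟩
  have lK : 4*ga + x10 + x10 + y = 2*(2*x2+x4+2*x6+x8+x10) + d1 + f1 := by
    have : ((4:ℕ):ℝ)*ga + x10 + x10 + y = ((2:ℕ):ℝ)*(((2:ℕ):ℝ)*x2+x4+((2:ℕ):ℝ)*x6+x8+x10) + d1 + f1 := by
      rw [← Real.exp_eq_exp]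
      simp only [Real.exp_add, Real.exp_nat_mul, hy, hd1, hf1]
      linear_combination ((v-u)*(1-u*v)) * rK - Real.exp ga ^ 4 * kY
    push_cast at this; linarith
  refine ⟨?_, ?_, ?_, ?_, ?_⟩
  · obtain ⟨κ, hκ⟩ : ∃ κ : ℝ, κ = 5*ga + (-3)*x3 + (3)*x4 + (-3)*x7 + (2)*x10 + (-3)*x2 + (-2)*x5 + (-5)*x8 + (2)*x6 + (-2)*x1 + (-2)*x9 - (V + ((2:ℕ):ℝ) * a1 + a2 + ((2:ℕ):ℝ) * d1) := ⟨_, rfl⟩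
    push_cast at hκ
    have q0 : ((Real.exp x9)+(Real.exp x1)) * alt0 (Real.exp x1) (Real.exp x2) (Real.exp x3) (Real.exp x4) (Real.exp x5) (Real.exp x6) (Real.exp x7) (Real.exp x8) (Real.exp x9) (Real.exp x10) (Real.exp ga) = (Real.exp κ * Real.exp (V + ((2:ℕ):ℝ) * a1 + a2 + ((2:ℕ):ℝ) * d1)) := by
      simp only [hA, hB, hB2, hC, hD, hE, alt0, alF4, alt2, mul_left_comm _ (2:ℝ)]
      simp only [← Real.exp_add, ← Real.exp_sub, ← Real.exp_nat_mul]
      rw [Real.exp_eq_exp]; push_cast; linarith only [lu, lv, l1, l2, l3, l4, l5, l6, l7, l8, E1l, E2l, E3l, lK, hκ]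
    have q1 : ((Real.exp x7)-(Real.exp x3)) * alF4 (Real.exp x1) (Real.exp x2) (Real.exp x3) (Real.exp x4) (Real.exp x5) (Real.exp x6) (Real.exp x7) (Real.exp x8) (Real.exp x9) (Real.exp x10) (Real.exp ga) = (Real.exp κ * Real.exp (U + a1 + ((2:ℕ):ℝ) * b1 + d2 + f1)) := by
      simp only [hA, hB, hB2, hC, hD, hE, alt0, alF4, alt2, mul_left_comm _ (2:ℝ)]
      simp only [← Real.exp_add, ← Real.exp_sub, ← Real.exp_nat_mul]
      rw [Real.exp_eq_exp]; push_cast; linarith only [lu, lv, l1, l2, l3, l4, l5, l6, l7, l8, E1l, E2l, E3l, lK, hκ]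
    have q2 : (Real.exp x5) * alt2 (Real.exp x1) (Real.exp x2) (Real.exp x3) (Real.exp x4) (Real.exp x5) (Real.exp x6) (Real.exp x7) (Real.exp x8) (Real.exp x9) (Real.exp x10) (Real.exp ga) = (Real.exp κ * Real.exp (U + b1 + ((2:ℕ):ℝ) * d2 + f1)) := by
      simp only [hA, hB, hB2, hC, hD, hE, alt0, alF4, alt2, mul_left_comm _ (2:ℝ)]
      simp only [← Real.exp_add, ← Real.exp_sub, ← Real.exp_nat_mul]
      rw [Real.exp_eq_exp]; push_cast; linarith only [lu, lv, l1, l2, l3, l4, l5, l6, l7, l8, E1l, E2l, E3l, lK, hκ]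
    have q3 : (Real.exp ga) * (Real.exp x4) * ((Real.exp x7)*(Real.exp x9)+(Real.exp x1)*(Real.exp x3)) / ((Real.exp x3)*(Real.exp x7)*(Real.exp x8)^2) = (Real.exp κ * Real.exp (U + b1 + d1 + y)) := by
      simp only [hA, hB, hB2, hC, hD, hE, alt0, alF4, alt2, mul_left_comm _ (2:ℝ)]
      simp only [← Real.exp_add, ← Real.exp_sub, ← Real.exp_nat_mul]
      rw [Real.exp_eq_exp]; push_cast; linarith only [lu, lv, l1, l2, l3, l4, l5, l6, l7, l8, E1l, E2l, E3l, lK, hκ]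
    rw [q0, q1, q2]
    simp only [Real.exp_add, Real.exp_nat_mul, hU, hV, hd1, hd2, hf1, hf2, hb1, hb2, hb3, ha1, ha2, ha3, hy] at q0 q1 q2 q3 ⊢
    linear_combination Real.exp κ * ((1)*u^0*v^1 + (1)*u^1*v^0 + (-1)*u^1*v^1 + (-1)*u^2*v^0) * hR + q3
  · obtain ⟨κ, hκ⟩ : ∃ κ : ℝ, κ = 5*ga + (-2)*x3 + (-2)*x7 + (2)*x10 + (-1)*x2 + (-4)*x5 + (-2)*x8 + (-2)*x1 + (-2)*x9 - (V + a1 + a2 + f1 + f2) := ⟨_, rfl⟩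
    push_cast at hκ
    have q0 : ((Real.exp x9)+(Real.exp x1)) * alF1 (Real.exp x1) (Real.exp x2) (Real.exp x3) (Real.exp x4) (Real.exp x5) (Real.exp x6) (Real.exp x7) (Real.exp x8) (Real.exp x9) (Real.exp x10) (Real.exp ga) = 2 * (Real.exp κ * Real.exp (V + a1 + a2 + f1 + f2)) := by
      simp only [hA, hB, hB2, hC, hD, hE, alF1, alt0, alF3, mul_left_comm _ (2:ℝ)]
      simp only [← Real.exp_add, ← Real.exp_sub, ← Real.exp_nat_mul]
      congr 1; rw [Real.exp_eq_exp]; push_cast; linarith only [lu, lv, l1, l2, l3, l4, l5, l6, l7, l8, E1l, E2l, E3l, lK, hκ]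
    have q1 : ((Real.exp x7)-(Real.exp x3)) * alt0 (Real.exp x1) (Real.exp x2) (Real.exp x3) (Real.exp x4) (Real.exp x5) (Real.exp x6) (Real.exp x7) (Real.exp x8) (Real.exp x9) (Real.exp x10) (Real.exp ga) = (Real.exp κ * Real.exp (d1 + f1 + ((2:ℕ):ℝ) * f2)) := by
      simp only [hA, hB, hB2, hC, hD, hE, alF1, alt0, alF3, mul_left_comm _ (2:ℝ)]
      simp only [← Real.exp_add, ← Real.exp_sub, ← Real.exp_nat_mul]
      rw [Real.exp_eq_exp]; push_cast; linarith only [lu, lv, l1, l2, l3, l4, l5, l6, l7, l8, E1l, E2l, E3l, lK, hκ]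
    have q2 : (Real.exp x5) * alF3 (Real.exp x1) (Real.exp x2) (Real.exp x3) (Real.exp x4) (Real.exp x5) (Real.exp x6) (Real.exp x7) (Real.exp x8) (Real.exp x9) (Real.exp x10) (Real.exp ga) = (Real.exp κ * Real.exp (V + a3 + ((2:ℕ):ℝ) * f2)) := by
      simp only [hA, hB, hB2, hC, hD, hE, alF1, alt0, alF3, mul_left_comm _ (2:ℝ)]
      simp only [← Real.exp_add, ← Real.exp_sub, ← Real.exp_nat_mul]
      rw [Real.exp_eq_exp]; push_cast; linarith only [lu, lv, l1, l2, l3, l4, l5, l6, l7, l8, E1l, E2l, E3l, lK, hκ]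
    have q3 : (Real.exp ga) * ((Real.exp x3)*(Real.exp x9)+(Real.exp x1)*(Real.exp x7)) / ((Real.exp x3)*(Real.exp x7)*(Real.exp x8)) = (Real.exp κ * Real.exp (V + a3 + y)) := by
      simp only [hA, hB, hB2, hC, hD, hE, alF1, alt0, alF3, mul_left_comm _ (2:ℝ)]
      simp only [← Real.exp_add, ← Real.exp_sub, ← Real.exp_nat_mul]
      rw [Real.exp_eq_exp]; push_cast; linarith only [lu, lv, l1, l2, l3, l4, l5, l6, l7, l8, E1l, E2l, E3l, lK, hκ]
    rw [q0, q1, q2]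
    simp only [Real.exp_add, Real.exp_nat_mul, hU, hV, hd1, hd2, hf1, hf2, hb1, hb2, hb3, ha1, ha2, ha3, hy] at q0 q1 q2 q3 ⊢
    linear_combination Real.exp κ * ((-1)*u^0*v^0 + (1)*u^1*v^1) * hR - q3
  · obtain ⟨κ, hκ⟩ : ∃ κ : ℝ, κ = 5*ga + (-1)*x3 + (-1)*x4 + (-1)*x7 + (2)*x10 + (1)*x2 + (-2)*x5 + (-1)*x8 + (-4)*x1 + (-2)*x6 + (-4)*x9 - (a2 + ((2:ℕ):ℝ) * d2 + f1 + f2) := ⟨_, rfl⟩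
    push_cast at hκ
    have q0 : ((Real.exp x9)+(Real.exp x1)) * alt2 (Real.exp x1) (Real.exp x2) (Real.exp x3) (Real.exp x4) (Real.exp x5) (Real.exp x6) (Real.exp x7) (Real.exp x8) (Real.exp x9) (Real.exp x10) (Real.exp ga) = (Real.exp κ * Real.exp (a2 + ((2:ℕ):ℝ) * d2 + f1 + f2)) := by
      simp only [hA, hB, hB2, hC, hD, hE, alt2, alF1, alF4, mul_left_comm _ (2:ℝ)]
      simp only [← Real.exp_add, ← Real.exp_sub, ← Real.exp_nat_mul]
      rw [Real.exp_eq_exp]; push_cast; linarith only [lu, lv, l1, l2, l3, l4, l5, l6, l7, l8, E1l, E2l, E3l, lK, hκ]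
    have q1 : ((Real.exp x7)-(Real.exp x3)) * alF1 (Real.exp x1) (Real.exp x2) (Real.exp x3) (Real.exp x4) (Real.exp x5) (Real.exp x6) (Real.exp x7) (Real.exp x8) (Real.exp x9) (Real.exp x10) (Real.exp ga) = 2 * (Real.exp κ * Real.exp (V + ((3:ℕ):ℝ) * a1 + d1 + f1)) := by
      simp only [hA, hB, hB2, hC, hD, hE, alt2, alF1, alF4, mul_left_comm _ (2:ℝ)]
      simp only [← Real.exp_add, ← Real.exp_sub, ← Real.exp_nat_mul]
      congr 1; rw [Real.exp_eq_exp]; push_cast; linarith only [lu, lv, l1, l2, l3, l4, l5, l6, l7, l8, E1l, E2l, E3l, lK, hκ]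
    have q2 : (Real.exp x5) * alF4 (Real.exp x1) (Real.exp x2) (Real.exp x3) (Real.exp x4) (Real.exp x5) (Real.exp x6) (Real.exp x7) (Real.exp x8) (Real.exp x9) (Real.exp x10) (Real.exp ga) = (Real.exp κ * Real.exp (V + a1 + a3 + d2 + f2)) := by
      simp only [hA, hB, hB2, hC, hD, hE, alt2, alF1, alF4, mul_left_comm _ (2:ℝ)]
      simp only [← Real.exp_add, ← Real.exp_sub, ← Real.exp_nat_mul]
      rw [Real.exp_eq_exp]; push_cast; linarith only [lu, lv, l1, l2, l3, l4, l5, l6, l7, l8, E1l, E2l, E3l, lK, hκ]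
    have q3 : (Real.exp ga) * ((Real.exp x3)*(Real.exp x9)+(Real.exp x1)*(Real.exp x7)) / ((Real.exp x3)*(Real.exp x4)*(Real.exp x7)) = (Real.exp κ * Real.exp (V + a1 + a3 + y)) := by
      simp only [hA, hB, hB2, hC, hD, hE, alt2, alF1, alF4, mul_left_comm _ (2:ℝ)]
      simp only [← Real.exp_add, ← Real.exp_sub, ← Real.exp_nat_mul]
      rw [Real.exp_eq_exp]; push_cast; linarith only [lu, lv, l1, l2, l3, l4, l5, l6, l7, l8, E1l, E2l, E3l, lK, hκ]
    have q4 : (Real.exp ga) * ((Real.exp x7)^2-(Real.exp x3)^2) / ((Real.exp x3)*(Real.exp x7)*(Real.exp x8)) = (Real.exp κ * Real.exp (a1 + d1 + f1 + y)) := by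
      simp only [hA, hB, hB2, hC, hD, hE, alt2, alF1, alF4, mul_left_comm _ (2:ℝ)]
      simp only [← Real.exp_add, ← Real.exp_sub, ← Real.exp_nat_mul]
      rw [Real.exp_eq_exp]; push_cast; linarith only [lu, lv, l1, l2, l3, l4, l5, l6, l7, l8, E1l, E2l, E3l, lK, hκ]
    rw [q0, q1, q2]
    simp only [Real.exp_add, Real.exp_nat_mul, hU, hV, hd1, hd2, hf1, hf2, hb1, hb2, hb3, ha1, ha2, ha3, hy] at q0 q1 q2 q3 q4 ⊢
    linear_combination Real.exp κ * ((-2)*u^1*v^0 + (-2)*u^1*v^1) * hR + q3 + q4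
  · obtain ⟨κ, hκ⟩ : ∃ κ : ℝ, κ = 5*ga + (-3)*x3 + (1)*x4 + (-3)*x7 + (2)*x10 + (-2)*x2 + (-2)*x5 + (-3)*x8 + (1)*x6 + (-2)*x1 + (-2)*x9 - (a2 + b1 + d1 + d2 + f1 + ((2:ℕ):ℝ) * f2) := ⟨_, rfl⟩
    push_cast at hκ
    have q0 : ((Real.exp x9)+(Real.exp x1)) * alF3 (Real.exp x1) (Real.exp x2) (Real.exp x3) (Real.exp x4) (Real.exp x5) (Real.exp x6) (Real.exp x7) (Real.exp x8) (Real.exp x9) (Real.exp x10) (Real.exp ga) = (Real.exp κ * Real.exp (a2 + b1 + d1 + d2 + f1 + ((2:ℕ):ℝ) * f2)) := by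
      simp only [hA, hB, hB2, hC, hD, hE, alF3, alt2, alt0, mul_left_comm _ (2:ℝ)]
      simp only [← Real.exp_add, ← Real.exp_sub, ← Real.exp_nat_mul]
      rw [Real.exp_eq_exp]; push_cast; linarith only [lu, lv, l1, l2, l3, l4, l5, l6, l7, l8, E1l, E2l, E3l, lK, hκ]
    have q1 : ((Real.exp x7)-(Real.exp x3)) * alt2 (Real.exp x1) (Real.exp x2) (Real.exp x3) (Real.exp x4) (Real.exp x5) (Real.exp x6) (Real.exp x7) (Real.exp x8) (Real.exp x9) (Real.exp x10) (Real.exp ga) = (Real.exp κ * Real.exp (V + a1 + a2 + a3 + ((2:ℕ):ℝ) * b1 + ((2:ℕ):ℝ) * d2)) := by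
      simp only [hA, hB, hB2, hC, hD, hE, alF3, alt2, alt0, mul_left_comm _ (2:ℝ)]
      simp only [← Real.exp_add, ← Real.exp_sub, ← Real.exp_nat_mul]
      rw [Real.exp_eq_exp]; push_cast; linarith only [lu, lv, l1, l2, l3, l4, l5, l6, l7, l8, E1l, E2l, E3l, lK, hκ]
    have q2 : (Real.exp x5) * alt0 (Real.exp x1) (Real.exp x2) (Real.exp x3) (Real.exp x4) (Real.exp x5) (Real.exp x6) (Real.exp x7) (Real.exp x8) (Real.exp x9) (Real.exp x10) (Real.exp ga) = (Real.exp κ * Real.exp (((2:ℕ):ℝ) * d1 + d2 + f1 + ((2:ℕ):ℝ) * f2)) := by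
      simp only [hA, hB, hB2, hC, hD, hE, alF3, alt2, alt0, mul_left_comm _ (2:ℝ)]
      simp only [← Real.exp_add, ← Real.exp_sub, ← Real.exp_nat_mul]
      rw [Real.exp_eq_exp]; push_cast; linarith only [lu, lv, l1, l2, l3, l4, l5, l6, l7, l8, E1l, E2l, E3l, lK, hκ]
    have q3 : (Real.exp ga) * ((Real.exp x7)^2-(Real.exp x3)^2) / ((Real.exp x3)*(Real.exp x4)*(Real.exp x7)) = (Real.exp κ * Real.exp (V + a1 + a2 + a3 + ((2:ℕ):ℝ) * b1 + y)) := by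
      simp only [hA, hB, hB2, hC, hD, hE, alF3, alt2, alt0, mul_left_comm _ (2:ℝ)]
      simp only [← Real.exp_add, ← Real.exp_sub, ← Real.exp_nat_mul]
      rw [Real.exp_eq_exp]; push_cast; linarith only [lu, lv, l1, l2, l3, l4, l5, l6, l7, l8, E1l, E2l, E3l, lK, hκ]
    have q4 : (Real.exp ga) * ((Real.exp x7)+(Real.exp x3)) * (Real.exp x4) * (Real.exp x5) / ((Real.exp x3)*(Real.exp x7)*(Real.exp x8)^2) = (Real.exp κ * Real.exp (((2:ℕ):ℝ) * d1 + d2 + f1 + y)) := by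
      simp only [hA, hB, hB2, hC, hD, hE, alF3, alt2, alt0, mul_left_comm _ (2:ℝ)]
      simp only [← Real.exp_add, ← Real.exp_sub, ← Real.exp_nat_mul]
      rw [Real.exp_eq_exp]; push_cast; linarith only [lu, lv, l1, l2, l3, l4, l5, l6, l7, l8, E1l, E2l, E3l, lK, hκ]
    rw [q0, q1, q2]
    simp only [Real.exp_add, Real.exp_nat_mul, hU, hV, hd1, hd2, hf1, hf2, hb1, hb2, hb3, ha1, ha2, ha3, hy] at q0 q1 q2 q3 q4 ⊢
    linear_combination Real.exp κ * ((-1)*u^0*v^1 + (-1)*u^0*v^3 + (1)*u^1*v^0 + (-2)*u^1*v^1 + (1)*u^1*v^2 + (2)*u^1*v^3 + (2)*u^2*v^0 + (1)*u^2*v^1 + (-2)*u^2*v^2 + (1)*u^2*v^3 + (-1)*u^3*v^0 + (-1)*u^3*v^2) * hR - q3 - q4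
  · obtain ⟨κ, hκ⟩ : ∃ κ : ℝ, κ = 5*ga + (-2)*x3 + (-1)*x4 + (-2)*x7 + (2)*x10 + (-2)*x5 + (-1)*x8 + (-3)*x1 + (-1)*x6 + (-3)*x9 - (a2 + b1 + d2 + f2) := ⟨_, rfl⟩
    push_cast at hκ
    have q0 : ((Real.exp x9)+(Real.exp x1)) * alF4 (Real.exp x1) (Real.exp x2) (Real.exp x3) (Real.exp x4) (Real.exp x5) (Real.exp x6) (Real.exp x7) (Real.exp x8) (Real.exp x9) (Real.exp x10) (Real.exp ga) = (Real.exp κ * Real.exp (a2 + b1 + d2 + f2)) := by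
      simp only [hA, hB, hB2, hC, hD, hE, alF4, alF3, alF1, mul_left_comm _ (2:ℝ)]
      simp only [← Real.exp_add, ← Real.exp_sub, ← Real.exp_nat_mul]
      rw [Real.exp_eq_exp]; push_cast; linarith only [lu, lv, l1, l2, l3, l4, l5, l6, l7, l8, E1l, E2l, E3l, lK, hκ]
    have q1 : ((Real.exp x7)-(Real.exp x3)) * alF3 (Real.exp x1) (Real.exp x2) (Real.exp x3) (Real.exp x4) (Real.exp x5) (Real.exp x6) (Real.exp x7) (Real.exp x8) (Real.exp x9) (Real.exp x10) (Real.exp ga) = (Real.exp κ * Real.exp (a1 + b1 + d1 + f2)) := by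
      simp only [hA, hB, hB2, hC, hD, hE, alF4, alF3, alF1, mul_left_comm _ (2:ℝ)]
      simp only [← Real.exp_add, ← Real.exp_sub, ← Real.exp_nat_mul]
      rw [Real.exp_eq_exp]; push_cast; linarith only [lu, lv, l1, l2, l3, l4, l5, l6, l7, l8, E1l, E2l, E3l, lK, hκ]
    have q2 : (Real.exp x5) * alF1 (Real.exp x1) (Real.exp x2) (Real.exp x3) (Real.exp x4) (Real.exp x5) (Real.exp x6) (Real.exp x7) (Real.exp x8) (Real.exp x9) (Real.exp x10) (Real.exp ga) = 2 * (Real.exp κ * Real.exp (V + ((2:ℕ):ℝ) * a1 + d1)) := by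
      simp only [hA, hB, hB2, hC, hD, hE, alF4, alF3, alF1, mul_left_comm _ (2:ℝ)]
      simp only [← Real.exp_add, ← Real.exp_sub, ← Real.exp_nat_mul]
      congr 1; rw [Real.exp_eq_exp]; push_cast; linarith only [lu, lv, l1, l2, l3, l4, l5, l6, l7, l8, E1l, E2l, E3l, lK, hκ]
    rw [q0, q1, q2]
    simp only [Real.exp_add, Real.exp_nat_mul, hU, hV, hd1, hd2, hf1, hf2, hb1, hb2, hb3, ha1, ha2, ha3, hy] at q0 q1 q2 ⊢
    linear_combination Real.exp κ * ((-2)*u^0*v^0) * hR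

open Filter Topology

noncomputable def mu (r : ℝ) (a b : ℤ) : ℝ :=
  r ^ (-(10 - a) ^ 2) * AA ((r ^ 40) ^ 20) ((r ^ 40) ^ a) ((r ^ 40) ^ b) / j ((r ^ 40) ^ 20) ((r ^ 40) ^ b)

lemma r40_zpow (r : ℝ) (n : ℤ) : (r ^ 40) ^ n = r ^ (40 * n) := by
  rw [← zpow_natCast r 40, ← zpow_mul]; norm_num

lemma mu_shift {r : ℝ} (hr : 0 < r) (a b : ℤ) : mu r a (b + 20) = mu r a b := by
  unfold mu
  have hq : (0:ℝ) < r ^ 40 := by positivity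
  have e : (r ^ 40) ^ (b + 20) = (r ^ 40) ^ 20 * (r ^ 40) ^ b := by
    rw [zpow_add₀ hq.ne', mul_comm]; norm_cast
  rw [e, AA_mul_p (by positivity) (by positivity), j_mul_p (by positivity) (by positivity)]
  have : ((r ^ 40) ^ b : ℝ) ≠ 0 := by positivity
  by_cases hj : j ((r ^ 40) ^ 20) ((r ^ 40) ^ b) = 0
  · simp [hj]
  field_simp

lemma mu_diff {r : ℝ} (hr : 0 < r) (hr1 : r < 1) (a b c : ℤ) (hb : b % 20 ≠ 0) (hc : c % 20 ≠ 0)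
    (hab : (a + b) % 20 ≠ 0) (hac : (a + c) % 20 ≠ 0) :
    mu r a c - mu r a b = GJ r * sk r (c - b) * sk r (a + b + c) / (sk r b * sk r c * sk r (a + b) * sk r (a + c)) := by
  have hq : (0:ℝ) < r ^ 40 := by positivity
  have hq1 : r ^ 40 < 1 := pow_lt_one₀ hr.le hr1 (by norm_num)
  have hne : ∀ e : ℤ, e % 20 ≠ 0 → ∀ n : ℤ, ((r ^ 40) ^ 20) ^ n * (r ^ 40) ^ e ≠ 1 := by
    intro e he n
    rw [p20_zpow, ← zpow_add₀ hq.ne', Ne, zpow_eq_one_iff' hq hq1]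
    omega
  have A := AA_diff (p := (r ^ 40) ^ 20) (x := (r ^ 40) ^ a) (z0 := (r ^ 40) ^ b) (z1 := (r ^ 40) ^ c)
    (by positivity) (pow_lt_one₀ hq.le hq1 (by norm_num)) (by positivity) (by positivity) (by positivity)
    (by rw [← zpow_add₀ hq.ne']; exact hne _ hab) (by rw [← zpow_add₀ hq.ne']; exact hne _ hac)
  rw [← zpow_sub₀ hq.ne', ← zpow_add₀ hq.ne', ← zpow_add₀ hq.ne', ← zpow_add₀ hq.ne'] at A
  have jb := jq_ne_zero hq hq1 b hb
  have jc := jq_ne_zero hq hq1 c hc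
  have e : mu r a c - mu r a b = r ^ (-(10 - a) ^ 2) * (j ((r ^ 40) ^ 20) ((r ^ 40) ^ b) * AA ((r ^ 40) ^ 20) ((r ^ 40) ^ a) ((r ^ 40) ^ c) - j ((r ^ 40) ^ 20) ((r ^ 40) ^ c) * AA ((r ^ 40) ^ 20) ((r ^ 40) ^ a) ((r ^ 40) ^ b)) / (j ((r ^ 40) ^ 20) ((r ^ 40) ^ b) * j ((r ^ 40) ^ 20) ((r ^ 40) ^ c)) := by
    unfold mu
    rw [eq_div_iff (mul_ne_zero jb jc), sub_mul, mul_sub]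
    congr 1
    · rw [div_mul_eq_mul_div, div_eq_iff jc]; ring
    · rw [div_mul_eq_mul_div, div_eq_iff jb]; ring
  rw [e, A]
  simp only [jk_eq hr]
  have s1 := sk_ne hr hr1 _ hb
  have s2 := sk_ne hr hr1 _ hc
  have s3 := sk_ne hr hr1 _ hab
  have s4 := sk_ne hr hr1 _ hac
  unfold GJ
  rw [r40_zpow]
  set u := sk r (c - b)
  set v := sk r (a + b + c)
  have key : r ^ (-(10 - a) ^ 2) * (r ^ (40 * b) * (r ^ (-(10 - (c - b)) ^ 2)) * r ^ (-(10 - (a + b + c)) ^ 2)) =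
     r ^ (100:ℕ) * (r ^ (-(10 - (a + b)) ^ 2) * r ^ (-(10 - (a + c)) ^ 2)) * (r ^ (-(10 - b) ^ 2) * r ^ (-(10 - c) ^ 2)) := by
    rw [← zpow_natCast r 100]
    simp only [← zpow_add₀ hr.ne']
    congr 1
    push_cast
    ring
  have n1 : r ^ (-(10 - (a + b)) ^ 2) ≠ 0 := by positivity
  have n2 : r ^ (-(10 - (a + c)) ^ 2) ≠ 0 := by positivity
  have n3 : r ^ (-(10 - b) ^ 2) ≠ 0 := by positivity
  have n4 : r ^ (-(10 - c) ^ 2) ≠ 0 := by positivity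
  generalize r ^ (-(10 - (a + b)) ^ 2) = N1 at *
  generalize r ^ (-(10 - (a + c)) ^ 2) = N2' at *
  generalize r ^ (-(10 - b) ^ 2) = N3 at *
  generalize r ^ (-(10 - c) ^ 2) = N4 at *
  generalize r ^ (-(10 - a) ^ 2) = N5 at *
  generalize r ^ (-(10 - (c - b)) ^ 2) = N6 at *
  generalize r ^ (-(10 - (a + b + c)) ^ 2) = N7 at *
  generalize r ^ (40 * b) = N8 at *
  generalize r ^ 100 = N9 at *
  generalize J3 ((r ^ 40) ^ 20) = N10 at *
  rw [mul_div_assoc', div_div, div_eq_div_iff (by simp [*]) (by simp [*])]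
  linear_combination (N10 * u * v * sk r b * sk r c * sk r (a + b) * sk r (a + c)) * key

open Filter Topology

lemma hasSum_split5 {f : ℤ → ℝ} {a : Fin 5 → ℝ} (h : ∀ ρ : Fin 5, HasSum (fun k : ℤ => f (5 * k + (ρ:ℕ))) (a ρ)) :
    HasSum f (∑ ρ, a ρ) := by
  have inj : ∀ ρ : Fin 5, Function.Injective (fun k : ℤ => 5 * k + (ρ:ℕ)) := by
    intro ρ x y h; simp only at h; omega
  have h' : ∀ ρ : Fin 5, HasSum (fun n : ℤ => if n % 5 = (ρ:ℕ) then f n else 0) (a ρ) := by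
    intro ρ
    rw [← (inj ρ).hasSum_iff]
    · refine (h ρ).congr_fun ?_
      intro k
      have := ρ.2
      simp only [Function.comp]
      rw [if_pos (by omega)]
    · intro x hx
      rw [if_neg]
      intro hx'
      exact hx ⟨x / 5, by simp only; omega⟩
  refine (hasSum_sum (fun ρ (_ : ρ ∈ Finset.univ) => h' ρ)).congr_fun ?_
  intro n
  have hn : (n % 5).toNat < 5 := by omega
  rw [Finset.sum_eq_single (⟨(n % 5).toNat, hn⟩ : Fin 5)]
  · simp; omega
  · intro b _ hb
    rw [if_neg]
    intro h
    apply hb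
    ext; simp; omega
  · simp

lemma summable_div_one_sub {q : ℝ} (hq : 0 < q) (hq1 : q < 1) {f : ℤ → ℝ} (hf : Summable f) (e : ℤ → ℤ) :
    Summable (fun n => f n / (1 - q ^ (e n))) := by
  apply Summable.of_norm_bounded (hf.norm.mul_left (2 / (1 - q)))
  intro n
  have h1 : 0 < 1 - q := by linarith
  by_cases h : e n = 0
  · simp [h]; positivity
  have := denom_bound (t := 1) hq hq1 h (by linarith) (by rw [le_div_iff₀ (by positivity)]; linarith)
  rw [mul_one] at this
  rw [norm_div, Real.norm_eq_abs (1 - _), div_le_iff₀ (by linarith)]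
  have h2 : 1 ≤ 2 / (1 - q) * |1 - q ^ e n| := by
    rw [div_mul_eq_mul_div, le_div_iff₀ h1]; linarith
  nlinarith [norm_nonneg (f n)]

lemma comp_hasSum {r : ℝ} (hr : 0 < r) (hr1 : r < 1) (c ρ : ℤ) (hb : (11 + 4 * c + 4 * ρ) % 20 ≠ 0) :
    HasSum (fun k : ℤ => (-1 : ℝ) ^ (5 * k + ρ) * r ^ (8 * (2 * (5 * k + ρ) ^ 2 + (5 * k + ρ) + 4 * c * (5 * k + ρ))) /
      (1 - r ^ (160 * (5 * k + ρ)))) ((-1) ^ ρ * (sk r (11 + 4 * c + 4 * ρ) * mu r (9 - 4 * c) (11 + 4 * c + 4 * ρ))) := by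
  have hq : (0:ℝ) < r ^ 40 := by positivity
  have hq1 : r ^ 40 < 1 := pow_lt_one₀ hr.le hr1 (by norm_num)
  set b := 11 + 4 * c + 4 * ρ with hbdef
  set a := 9 - 4 * c with ha
  have hj := jq_ne_zero hq hq1 b hb
  have e : (-1) ^ ρ * (sk r b * mu r a b) = ((-1) ^ ρ * (r ^ ((10 - b) ^ 2) * r ^ (-(10 - a) ^ 2))) * AA ((r ^ 40) ^ 20) ((r ^ 40) ^ a) ((r ^ 40) ^ b) := by
    unfold sk mu
    generalize j ((r ^ 40) ^ 20) ((r ^ 40) ^ b) = J at *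
    generalize AA _ _ _ = A
    field_simp
  rw [e]
  have hp : (0:ℝ) < (r ^ 40) ^ 20 := by positivity
  have hp1 : (r ^ 40) ^ 20 < 1 := pow_lt_one₀ hq.le hq1 (by norm_num)
  have den : ∀ n : ℤ, ((r ^ 40) ^ 20) ^ (n - 1) * ((r ^ 40) ^ a * (r ^ 40) ^ b) = r ^ (160 * (5 * n + ρ)) := by
    intro n
    rw [p20_zpow]
    simp only [r40_zpow, ← zpow_add₀ hr.ne']
    congr 1
    rw [hbdef, ha]; ring
  have S := summable_div_one_sub hr hr1 (jt_summable hp hp1 (z := (r ^ 40) ^ b) (by positivity)) (fun n => 160 * (5 * n + ρ))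
  have HS := S.hasSum
  have : AA ((r ^ 40) ^ 20) ((r ^ 40) ^ a) ((r ^ 40) ^ b) = ∑' n, jt ((r ^ 40) ^ 20) ((r ^ 40) ^ b) n / (1 - r ^ (160 * (5 * n + ρ))) := by
    unfold AA; simp only [den]
  rw [← this] at HS
  refine (HS.mul_left _).congr_fun ?_
  intro k
  rw [mul_div_assoc']
  congr 1
  unfold jt
  rw [p20_zpow]
  have hm : (-1 : ℝ) ≠ 0 := by norm_num
  have e1 : (-1 : ℝ) ^ (5 * k + ρ) = (-1) ^ ρ * (-1) ^ k := by
    rw [← zpow_add₀ hm, show 5 * k + ρ = (ρ + k) + 2 * (2 * k) by ring, zpow_add₀ hm (ρ + k), zpow_mul (-1 : ℝ) 2]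
    norm_num
  have e2 : r ^ (8 * (2 * (5 * k + ρ) ^ 2 + (5 * k + ρ) + 4 * c * (5 * k + ρ))) = r ^ ((10 - b) ^ 2) * r ^ (-(10 - a) ^ 2) * ((r ^ 40) ^ (20 * tri k) * ((r ^ 40) ^ b) ^ k) := by
    rw [← zpow_mul]
    simp only [r40_zpow, ← zpow_add₀ hr.ne']
    congr 1
    rw [hbdef, ha]
    linear_combination -400 * two_tri k
  rw [e1, e2]; ring

/-- the numerator series -/
noncomputable def SS (Q : ℝ) : ℝ := - ∑' n : ℤ, (-1) ^ n * Q ^ (2 * n ^ 2 + n) * (1 - Q ^ (4 * n)) ^ 2 / (1 - Q ^ (20 * n))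

noncomputable def th (Q : ℝ) : ℝ := ∑' n : ℤ, (-1) ^ n * Q ^ (2 * n ^ 2 + n)

noncomputable def Om (r : ℝ) : ℝ := sk r 9 + sk r 1 - sk r 7 + sk r 3 - sk r 5

lemma r8_zpow (r : ℝ) (n : ℤ) : (r ^ 8) ^ n = r ^ (8 * n) := by
  rw [← zpow_natCast r 8, ← zpow_mul]; norm_num

lemma SS_terms_hasSum {r : ℝ} (hr : 0 < r) (hr1 : r < 1) :
    HasSum (fun n : ℤ => (-1) ^ n * (r ^ 8) ^ (2 * n ^ 2 + n) * (1 - (r ^ 8) ^ (4 * n)) ^ 2 / (1 - (r ^ 8) ^ (20 * n)))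
    (∑ ρ : Fin 5, ((-1) ^ ((ρ:ℕ):ℤ) * (sk r (11 + 4 * 0 + 4 * (ρ:ℕ)) * mu r (9 - 4 * 0) (11 + 4 * 0 + 4 * (ρ:ℕ)))
      - 2 * ((-1) ^ ((ρ:ℕ):ℤ) * (sk r (11 + 4 * 1 + 4 * (ρ:ℕ)) * mu r (9 - 4 * 1) (11 + 4 * 1 + 4 * (ρ:ℕ))))
      + ((-1) ^ ((ρ:ℕ):ℤ) * (sk r (11 + 4 * 2 + 4 * (ρ:ℕ)) * mu r (9 - 4 * 2) (11 + 4 * 2 + 4 * (ρ:ℕ)))))) := by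
  apply hasSum_split5
  intro ρ
  have h0 := comp_hasSum hr hr1 0 (ρ:ℕ) (by omega)
  have h1 := comp_hasSum hr hr1 1 (ρ:ℕ) (by omega)
  have h2 := comp_hasSum hr hr1 2 (ρ:ℕ) (by omega)
  refine ((h0.sub (h1.mul_left 2)).add h2).congr_fun ?_
  intro k
  generalize 5 * k + ((ρ:ℕ):ℤ) = n
  rw [mul_div_assoc', ← sub_div, ← add_div]
  simp only [r8_zpow]
  rw [show 8 * (20 * n) = 160 * n by ring]
  congr 1
  have : ∀ c : ℤ, r ^ (8 * (2 * n ^ 2 + n + 4 * c * n)) = r ^ (8 * (2 * n ^ 2 + n)) * (r ^ (8 * (4 * n))) ^ c := by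
    intro c
    rw [← zpow_mul, ← zpow_add₀ hr.ne']; congr 1; ring
  rw [this, this, this]
  norm_cast
  simp
  ring

lemma th_eq {r : ℝ} (hr : 0 < r) (hr1 : r < 1) : r * th (r ^ 8) = Om r := by
  have : HasSum (fun n : ℤ => r * ((-1) ^ n * (r ^ 8) ^ (2 * n ^ 2 + n))) (∑ ρ : Fin 5, (-1) ^ ((ρ:ℕ):ℤ) * sk r (11 + 4 * (ρ:ℕ))) := by
    apply hasSum_split5
    intro ρ
    refine ((sk_hasSum hr hr1 (11 + 4 * (ρ:ℕ))).mul_left ((-1) ^ ((ρ:ℕ):ℤ))).congr_fun ?_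
    intro k
    generalize ((ρ:ℕ):ℤ) = ρ
    have hm : (-1 : ℝ) ≠ 0 := by norm_num
    have e1 : (-1 : ℝ) ^ (5 * k + ρ) = (-1) ^ ρ * (-1) ^ k := by
      rw [← zpow_add₀ hm, show 5 * k + ρ = (ρ + k) + 2 * (2 * k) by ring, zpow_add₀ hm (ρ + k), zpow_mul (-1 : ℝ) 2]
      norm_num
    have e2 : r ^ ((20 * k + (11 + 4 * ρ) - 10) ^ 2) = r * (r ^ 8) ^ (2 * (5 * k + ρ) ^ 2 + (5 * k + ρ)) := by
      rw [r8_zpow, ← zpow_one_add₀ hr.ne']; congr 1; ring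
    rw [e1, e2]; ring
  unfold th
  rw [← tsum_mul_left, this.tsum_eq]
  simp only [Fin.sum_univ_five]
  have a11 : sk r 11 = sk r 9 := by rw [← sk_reflect hr hr1]; norm_num
  have a15 : sk r 15 = sk r 5 := by rw [← sk_reflect hr hr1]; norm_num
  have a19 : sk r 19 = sk r 1 := by rw [← sk_reflect hr hr1]; norm_num
  have a23 : sk r 23 = -sk r 3 := by rw [← sk_add hr hr1]; norm_num
  have a27 : sk r 27 = -sk r 7 := by rw [← sk_add hr hr1]; norm_num
  simp
  norm_num [zpow_ofNat]
  rw [a11, a15, a19, a23, a27]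
  unfold Om; ring

open Filter Topology

lemma corr_eq (s1 s2 s3 s4 s5 s6 s7 s8 s9 s10 G S m93 m17 m53 m57 m915 m919 m97 m13 m111 m115 m519 m511 : ℝ)
  (h1 : 0 < s1) (h2 : 0 < s2) (h3 : 0 < s3) (h4 : 0 < s4) (h5 : 0 < s5) (h6 : 0 < s6) (h7 : 0 < s7) (h8 : 0 < s8) (h9 : 0 < s9) (h10 : 0 < s10)
  (d1 : m915 - m93 = G * s8 * (-s7) / (s3 * s5 * s8 * (-s4)))
  (d2 : m919 - m93 = G * s4 * (-s9) / (s3 * s1 * s8 * (-s8)))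
  (d3 : m97 - m93 = G * s4 * s1 / (s3 * s7 * s8 * s4))
  (d4 : m13 - m17 = G * (-s4) * s9 / (s7 * s3 * s8 * s4))
  (d5 : m111 - m17 = G * s4 * s1 / (s7 * s9 * s8 * s8))
  (d6 : m115 - m17 = G * s8 * (-s3) / (s7 * s5 * s8 * s4))
  (d7 : m519 - m53 = G * s4 * (-s7) / (s3 * s1 * s8 * (-s4)))
  (d8 : m519 - m57 = G * s8 * (-s9) / (s7 * s1 * s8 * (-s4)))
  (d9 : m57 - m53 = G * s4 * s5 / (s3 * s7 * s8 * s8))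
  (d10 : m511 - m53 = G * s8 * s1 / (s3 * s9 * s8 * s4))
  (d11 : m511 - m57 = G * s4 * (-s3) / (s7 * s9 * s8 * s4))
  (hS : S = (-(s9 * m93) - s1 * m17 + s5 * m53 + s5 * m57) + (s5 * m915 - 2 * (s1 * m519) - s3 * m13)
     - (s1 * m919 + 2 * (s3 * m53) - s7 * m17) + (-(s3 * m93) + 2 * (s7 * m57) - s9 * m111) - (-(s7 * m97) + 2 * (s9 * m511) - s5 * m115)) :
  S = (s9 + s1 - s7 + s3 - s5) * (-m93 - m17 - m53 - m57) + 
   (-(G*s4*(s7*s9+s1*s3)/(s3*s7*s8^2)) + G*(s3*s9+s1*s7)/(s3*s7*s8) + (-(G*(s3*s9+s1*s7)/(s3*s4*s7)) + -(G*(s7^2-s3^2)/(s3*s7*s8)))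
     + (G*(s7^2-s3^2)/(s3*s4*s7) + G*(s7+s3)*s4*s5/(s3*s7*s8^2))) := by
  have : S = (s9 + s1 - s7 + s3 - s5) * (-m93 - m17 - m53 - m57) + (s5 * (m915 - m93) - s1 * (m919 - m93) + s7 * (m97 - m93)
     - s3 * (m13 - m17) - s9 * (m111 - m17) + s5 * (m115 - m17) - s1 * (m519 - m53) - s1 * (m519 - m57) + (s3 + s7) * (m57 - m53) 
     - s9 * (m511 - m53) - s9 * (m511 - m57)) := by rw [hS]; ring
  rw [this, d1, d2, d3, d4, d5, d6, d7, d8, d9, d10, d11]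
  congr 1
  field_simp
  ring

lemma main_theta {r : ℝ} (hr : 0 < r) (hr1 : r < 1) :
    SS (r ^ 8) = th (r ^ 8) * (r * (alt0 (sk r 1) (sk r 2) (sk r 3) (sk r 4) (sk r 5) (sk r 6) (sk r 7) (sk r 8) (sk r 9) (sk r 10) (GJ r)
      + alF1 (sk r 1) (sk r 2) (sk r 3) (sk r 4) (sk r 5) (sk r 6) (sk r 7) (sk r 8) (sk r 9) (sk r 10) (GJ r)
      + alt2 (sk r 1) (sk r 2) (sk r 3) (sk r 4) (sk r 5) (sk r 6) (sk r 7) (sk r 8) (sk r 9) (sk r 10) (GJ r)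
      + alF3 (sk r 1) (sk r 2) (sk r 3) (sk r 4) (sk r 5) (sk r 6) (sk r 7) (sk r 8) (sk r 9) (sk r 10) (GJ r)
      + alF4 (sk r 1) (sk r 2) (sk r 3) (sk r 4) (sk r 5) (sk r 6) (sk r 7) (sk r 8) (sk r 9) (sk r 10) (GJ r)
      - mu r 9 3 - mu r 1 7 - mu r 5 3 - mu r 5 7)) := by
  have R := fun k => sk_reflect hr hr1 k
  have A := fun k => sk_add hr hr1 k
  have N := fun k => sk_neg hr hr1 k
  have a11 : sk r 11 = sk r 9 := by rw [← R]; norm_num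
  have a12 : sk r 12 = sk r 8 := by rw [← R]; norm_num
  have a13 : sk r 13 = sk r 7 := by rw [← R]; norm_num
  have a14 : sk r 14 = sk r 6 := by rw [← R]; norm_num
  have a15 : sk r 15 = sk r 5 := by rw [← R]; norm_num
  have a16 : sk r 16 = sk r 4 := by rw [← R]; norm_num
  have a17 : sk r 17 = sk r 3 := by rw [← R]; norm_num
  have a18 : sk r 18 = sk r 2 := by rw [← R]; norm_num
  have a19 : sk r 19 = sk r 1 := by rw [← R]; norm_num
  have a21 : sk r 21 = -sk r 1 := by rw [← A]; norm_num
  have a22 : sk r 22 = -sk r 2 := by rw [← A]; norm_num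
  have a23 : sk r 23 = -sk r 3 := by rw [← A]; norm_num
  have a24 : sk r 24 = -sk r 4 := by rw [← A]; norm_num
  have a27 : sk r 27 = -sk r 7 := by rw [← A]; norm_num
  have a28 : sk r 28 = -sk r 8 := by rw [← A]; norm_num
  have a29 : sk r 29 = -sk r 9 := by rw [← A]; norm_num
  have a31 : sk r 31 = -sk r 9 := by rw [← a11, ← A]; norm_num
  have a35 : sk r 35 = -sk r 5 := by rw [← a15, ← A]; norm_num
  have n3 : sk r (-3) = -sk r 3 := N 3
  have n4 : sk r (-4) = -sk r 4 := N 4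
  have n7 : sk r (-7) = -sk r 7 := N 7
  have n1 : sk r (-1) = -sk r 1 := N 1
  have m23 : ∀ a, mu r a 23 = mu r a 3 := fun a => mu_shift hr a 3
  have m27 : ∀ a, mu r a 27 = mu r a 7 := fun a => mu_shift hr a 7
  have m31 : ∀ a, mu r a 31 = mu r a 11 := fun a => mu_shift hr a 11
  have m35 : ∀ a, mu r a 35 = mu r a 15 := fun a => mu_shift hr a 15
  have p : ∀ k : ℤ, 0 < k → k < 20 → 0 < sk r k := fun k => sk_pos hr hr1 k
  have D := fun a b c h1 h2 h3 h4 => mu_diff hr hr1 a b c h1 h2 h3 h4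
  have sing : sk r 9 * mu r 9 11 + sk r 1 * mu r 1 19 - 2 * (sk r 5 * mu r 5 15) = sk r 9 * mu r 9 3 + sk r 1 * mu r 1 7 - sk r 5 * mu r 5 3 - sk r 5 * mu r 5 7 := by
    have hq : (0:ℝ) < r ^ 40 := by positivity
    have hq1 : r ^ 40 < 1 := pow_lt_one₀ hr.le hr1 (by norm_num)
    have sc := singular_combo hq hq1
    have E : ∀ a b c : ℤ, a + c = 20 → b % 20 ≠ 0 → c % 20 ≠ 0 → j ((r ^ 40) ^ 20) ((r ^ 40) ^ c) / j ((r ^ 40) ^ 20) ((r ^ 40) ^ b) * AA ((r ^ 40) ^ 20) ((r ^ 40) ^ 20 / (r ^ 40) ^ c) ((r ^ 40) ^ b) = sk r c * mu r a b := by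
      intro a b c hac hb hc
      have : (r ^ 40) ^ 20 / (r ^ 40) ^ c = (r ^ 40) ^ a := by
        have : a = ((20:ℕ):ℤ) - c := by push_cast; omega
        rw [this, zpow_sub₀ hq.ne', zpow_natCast]
      rw [this]
      unfold sk mu
      have ee : r ^ ((10 - c) ^ 2) * r ^ (-(10 - a) ^ 2) = 1 := by
        rw [← zpow_add₀ hr.ne', show c = 20 - a by omega, show (10 - (20 - a)) ^ 2 + -(10 - a) ^ 2 = 0 by ring, zpow_zero]
      linear_combination (-(j ((r ^ 40) ^ 20) ((r ^ 40) ^ c) / j ((r ^ 40) ^ 20) ((r ^ 40) ^ b) * AA ((r ^ 40) ^ 20) ((r ^ 40) ^ a) ((r ^ 40) ^ b))) * ee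
    have E' : ∀ a c : ℤ, a + c = 20 → c % 20 ≠ 0 → AA ((r ^ 40) ^ 20) ((r ^ 40) ^ 20 / (r ^ 40) ^ c) ((r ^ 40) ^ c) = sk r c * mu r a c := by
      intro a c hac hc
      rw [← E a c c hac hc hc, div_self (jq_ne_zero hq hq1 c hc), one_mul]
    simp only at sc
    rw [E' 9 11 (by norm_num) (by norm_num), E' 1 19 (by norm_num) (by norm_num), E' 5 15 (by norm_num) (by norm_num),
      E 9 3 11 (by norm_num) (by norm_num) (by norm_num), E 1 7 19 (by norm_num) (by norm_num) (by norm_num),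
      E 5 3 15 (by norm_num) (by norm_num) (by norm_num), E 5 7 15 (by norm_num) (by norm_num) (by norm_num), a11, a15, a19] at sc
    linear_combination -sc
  have hS : SS (r ^ 8) = (-(sk r 9 * mu r 9 3) - sk r 1 * mu r 1 7 + sk r 5 * mu r 5 3 + sk r 5 * mu r 5 7) + (sk r 5 * mu r 9 15 - 2 * (sk r 1 * mu r 5 19) - sk r 3 * mu r 1 3)
     - (sk r 1 * mu r 9 19 + 2 * (sk r 3 * mu r 5 3) - sk r 7 * mu r 1 7) + (-(sk r 3 * mu r 9 3) + 2 * (sk r 7 * mu r 5 7) - sk r 9 * mu r 1 11) - (-(sk r 7 * mu r 9 7) + 2 * (sk r 9 * mu r 5 11) - sk r 5 * mu r 1 15) := by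
    unfold SS
    rw [(SS_terms_hasSum hr hr1).tsum_eq]
    simp only [Fin.sum_univ_five]
    simp
    norm_num [zpow_ofNat]
    simp only [a11, a15, a19, a23, a27, a31, a35, m23, m27, m31, m35]
    linear_combination -sing
  have F1 := corr_eq _ _ _ _ _ _ _ _ _ _ (GJ r) _ _ _ _ _ _ _ _ _ _ _ _ _
    (p 1 (by norm_num) (by norm_num)) (p 2 (by norm_num) (by norm_num)) (p 3 (by norm_num) (by norm_num)) (p 4 (by norm_num) (by norm_num))
    (p 5 (by norm_num) (by norm_num)) (p 6 (by norm_num) (by norm_num)) (p 7 (by norm_num) (by norm_num)) (p 8 (by norm_num) (by norm_num))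
    (p 9 (by norm_num) (by norm_num)) (p 10 (by norm_num) (by norm_num))
    (by rw [D 9 3 15 (by norm_num) (by norm_num) (by norm_num) (by norm_num)]; norm_num only [a12, a27, a15, a24])
    (by rw [D 9 3 19 (by norm_num) (by norm_num) (by norm_num) (by norm_num)]; norm_num only [a16, a31, a19, a28, a12])
    (by rw [D 9 3 7 (by norm_num) (by norm_num) (by norm_num) (by norm_num)]; norm_num only [a12, a19, a16])
    (by rw [D 1 7 3 (by norm_num) (by norm_num) (by norm_num) (by norm_num)]; norm_num only [n4, a11])
    (by rw [D 1 7 11 (by norm_num) (by norm_num) (by norm_num) (by norm_num)]; norm_num only [a11, a19, a12])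
    (by rw [D 1 7 15 (by norm_num) (by norm_num) (by norm_num) (by norm_num)]; norm_num only [a15, a23, a16])
    (by rw [D 5 3 19 (by norm_num) (by norm_num) (by norm_num) (by norm_num)]; norm_num only [a16, a27, a19, a24])
    (by rw [D 5 7 19 (by norm_num) (by norm_num) (by norm_num) (by norm_num)]; norm_num only [a12, a31, a19, a24])
    (by rw [D 5 3 7 (by norm_num) (by norm_num) (by norm_num) (by norm_num)]; norm_num only [a12, a15])
    (by rw [D 5 3 11 (by norm_num) (by norm_num) (by norm_num) (by norm_num)]; norm_num only [a11, a19, a16])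
    (by rw [D 5 7 11 (by norm_num) (by norm_num) (by norm_num) (by norm_num)]; norm_num only [a11, a23, a12, a16])
    hS
  have r1 : sk r 1*sk r 9*sk r 4*sk r 10 = sk r 2*sk r 8*(sk r 3*sk r 9-sk r 1*sk r 7) := by
    have h := sk_rel hr hr1 1 8 (by norm_num) (by norm_num)
    norm_num only [n1, n3, n4, n7, a11, a12, a13, a14, a15, a16, a17, a18, a19, a21, a22, a23] at h
    linear_combination h
  have r2 : sk r 8*sk r 2*sk r 2*sk r 10 = sk r 1*sk r 9*(sk r 3*sk r 9+sk r 1*sk r 7) := by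
    have h := sk_rel hr hr1 8 1 (by norm_num) (by norm_num)
    norm_num only [n1, n3, n4, n7, a11, a12, a13, a14, a15, a16, a17, a18, a19, a21, a22, a23] at h
    linear_combination h
  have r3 : sk r 3*sk r 7*sk r 8*sk r 10 = sk r 4*sk r 6*(sk r 7*sk r 9-sk r 1*sk r 3) := by
    have h := sk_rel hr hr1 3 6 (by norm_num) (by norm_num)
    norm_num only [n1, n3, n4, n7, a11, a12, a13, a14, a15, a16, a17, a18, a19, a21, a22, a23] at h
    linear_combination h
  have r4 : sk r 6*sk r 4*sk r 6*sk r 10 = sk r 3*sk r 7*(sk r 7*sk r 9+sk r 1*sk r 3) := by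
    have h := sk_rel hr hr1 6 3 (by norm_num) (by norm_num)
    norm_num only [n1, n3, n4, n7, a11, a12, a13, a14, a15, a16, a17, a18, a19, a21, a22, a23] at h
    linear_combination h
  have r5 : sk r 5*sk r 5*sk r 4*sk r 10 = sk r 2*sk r 8*(sk r 7^2+sk r 3^2) := by
    have h := sk_rel hr hr1 5 2 (by norm_num) (by norm_num)
    norm_num only [n1, n3, n4, n7, a11, a12, a13, a14, a15, a16, a17, a18, a19, a21, a22, a23] at h
    linear_combination h
  have r6 : sk r 2*sk r 8*sk r 10*sk r 10 = sk r 5*sk r 5*(sk r 7^2-sk r 3^2) := by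
    have h := sk_rel hr hr1 2 5 (by norm_num) (by norm_num)
    norm_num only [n1, n3, n4, n7, a11, a12, a13, a14, a15, a16, a17, a18, a19, a21, a22, a23] at h
    linear_combination h
  have r7 : sk r 5*sk r 5*sk r 8*sk r 10 = sk r 4*sk r 6*(sk r 9^2+sk r 1^2) := by
    have h := sk_rel hr hr1 5 4 (by norm_num) (by norm_num)
    norm_num only [n1, n3, n4, n7, a11, a12, a13, a14, a15, a16, a17, a18, a19, a21, a22, a23] at h
    linear_combination h
  have r8 : sk r 4*sk r 6*sk r 10*sk r 10 = sk r 5*sk r 5*(sk r 9^2-sk r 1^2) := by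
    have h := sk_rel hr hr1 4 5 (by norm_num) (by norm_num)
    norm_num only [n1, n3, n4, n7, a11, a12, a13, a14, a15, a16, a17, a18, a19, a21, a22, a23] at h
    linear_combination h
  obtain ⟨e0, e1, e2, e3, e4⟩ := theta_alg _ _ _ _ _ _ _ _ _ _ (GJ r)
    (p 1 (by norm_num) (by norm_num)) (p 2 (by norm_num) (by norm_num)) (p 3 (by norm_num) (by norm_num)) (p 4 (by norm_num) (by norm_num))
    (p 5 (by norm_num) (by norm_num)) (p 6 (by norm_num) (by norm_num)) (p 7 (by norm_num) (by norm_num)) (p 8 (by norm_num) (by norm_num))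
    (p 9 (by norm_num) (by norm_num)) (p 10 (by norm_num) (by norm_num)) (GJ_pos hr hr1) r1 r2 r3 r4 r5 r6 r7 r8 (GJ_rel hr hr1)
  rw [F1, ← mul_assoc, mul_comm (th _) r, th_eq hr hr1]
  unfold Om
  linear_combination -e0 - e1 - e2 - e3 - e4

def mrk (s : Multiset ℕ) : ℤ := (((s.sup + 1) / 2 : ℕ) : ℤ) - (Multiset.card s : ℤ)

def Mgood (s : Multiset ℕ) : Prop := 0 ∉ s ∧ ∀ j : ℕ, Odd j → s.count j ≤ 1

noncomputable def mPhi (m : ℤ) (s : Multiset ℕ) : Multiset ℕ :=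
  (s.erase s.sup).map (· + 2) + Multiset.replicate (((((s.sup + 1) / 2 : ℕ) : ℤ) - m - 1).toNat - Multiset.card (s.erase s.sup)) 2 +
    (if Even s.sup then {1} else 0)

noncomputable def mEll (m : ℤ) (t : Multiset ℕ) : ℕ :=
  (2 * (Multiset.card (t.filter (fun x => 2 ≤ x)) : ℤ) + 2 * m + 1 + (if 1 ∈ t then 1 else 0)).toNat

noncomputable def mPsi (m : ℤ) (t : Multiset ℕ) : Multiset ℕ :=
  if mEll m t = 0 then (t.filter (fun x => 2 < x)).map (· - 2) else mEll m t ::ₘ (t.filter (fun x => 2 < x)).map (· - 2)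

lemma sup_mem {s : Multiset ℕ} (h : s ≠ 0) : s.sup ∈ s := by
  induction s using Multiset.induction with
  | empty => simp at h
  | cons a s ih =>
    by_cases hs : s = 0
    · simp [hs]
    · have := ih hs
      rw [Multiset.sup_cons]
      rcases le_total a s.sup with h | h
      · rw [sup_eq_right.2 h]; exact Multiset.mem_cons_of_mem this
      · rw [sup_eq_left.2 h]; exact Multiset.mem_cons_self _ _

/-- basic data of `s` with rank ≥ m -/
lemma base_data {m : ℤ} {s : Multiset ℕ} (hs : Mgood s) (hr : m ≤ mrk s) (h0 : s = 0 → m < 0) :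
    ((Multiset.card (s.erase s.sup) : ℤ) ≤ (((s.sup + 1) / 2 : ℕ) : ℤ) - m - 1) ∧
    (s.erase s.sup).sum + s.sup = s.sum ∧ (∀ y ∈ s.erase s.sup, y ≤ s.sup ∧ (Odd s.sup → y < s.sup) ∧ 0 < y) := by
  by_cases h : s = 0
  · subst h
    have := h0 rfl
    simp; omega
  · have hm := sup_mem h
    refine ⟨?_, ?_, ?_⟩
    · rw [Multiset.card_erase_of_mem hm]
      unfold mrk at hr
      have : 0 < Multiset.card s := Multiset.card_pos.2 h
      rw [Nat.pred_eq_sub_one]; omega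
    · have := Multiset.sum_erase hm; omega
    · intro y hy
      have hy' := Multiset.mem_of_mem_erase hy
      have h1 : y ≤ s.sup := Multiset.le_sup hy'
      refine ⟨h1, ?_, ?_⟩
      · intro ho
        rcases h1.lt_or_eq with h | h
        · exact h
        · have := hs.2 _ ho
          rw [h] at hy
          have h3 : 1 ≤ (s.erase s.sup).count s.sup := Multiset.one_le_count_iff_mem.2 hy
          rw [Multiset.count_erase_self] at h3
          omega
      · rcases Nat.eq_zero_or_pos y with h | h
        · subst h; exact absurd hy' hs.1
        · exact h

lemma phi_mem {m : ℤ} {s : Multiset ℕ} (hs : Mgood s) (hr : m ≤ mrk s) (h0 : s = 0 → m < 0) :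
    Mgood (mPhi m s) ∧ mrk (mPhi m s) ≤ m + 1 ∧ ((mPhi m s).sum : ℤ) + (2 * m + 1) = s.sum := by
  obtain ⟨b1, b2, b3⟩ := base_data hs hr h0
  have hcount : ∀ j, Odd j → (s.erase s.sup).count j ≤ 1 := fun j hj =>
    (Multiset.count_le_of_le j (Multiset.erase_le _ _)).trans (hs.2 j hj)
  refine ⟨⟨?_, ?_⟩, ?_, ?_⟩
  · unfold mPhi
    intro h
    simp only [Multiset.mem_add, Multiset.mem_map, Multiset.mem_replicate] at h
    rcases h with (⟨a, _, h⟩ | h) | h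
    · omega
    · omega
    · split_ifs at h <;> simp at h
  · intro j hj
    unfold mPhi
    rw [Multiset.count_add, Multiset.count_add, Multiset.count_replicate, if_neg (by rintro rfl; exact absurd hj (by decide))]
    by_cases h1 : j = 1
    · subst h1
      rw [Multiset.count_eq_zero.2 (by simp)]
      split_ifs <;> simp
    · have : j = (j - 2) + 2 := by rcases hj with ⟨k, rfl⟩; omega
      have hj2 : Odd (j - 2) := by rcases hj with ⟨k, rfl⟩; exact ⟨k - 1, by omega⟩
      have e : ((s.erase s.sup).map (· + 2)).count j = (s.erase s.sup).count (j - 2) := by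
        conv_lhs => rw [this]
        exact Multiset.count_map_eq_count' _ _ (add_left_injective 2) _
      rw [e]
      have := hcount _ hj2
      split_ifs
      · rw [Multiset.count_singleton, if_neg h1]; omega
      · simpa using this
  · have hc : (Multiset.card (mPhi m s) : ℤ) = (((s.sup + 1) / 2 : ℕ) : ℤ) - m - 1 + (if Even s.sup then 1 else 0) := by
      unfold mPhi
      split_ifs
      · simp; omega
      · simp; omega
    have hsup : (mPhi m s).sup ≤ 2 * ((s.sup + 1) / 2 + (if Even s.sup then 1 else 0)) := by
      apply Multiset.sup_le.2
      intro x hx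
      unfold mPhi at hx
      simp only [Multiset.mem_add, Multiset.mem_map, Multiset.mem_replicate] at hx
      rcases hx with (⟨a, ha, h⟩ | h) | h
      · have := b3 a ha
        split_ifs with he
        · rcases he with ⟨k, hk⟩; omega
        · have h5 := this.2.1 (Nat.not_even_iff_odd.1 he)
          rcases Nat.not_even_iff_odd.1 he with ⟨k, hk⟩; omega
      · split_ifs with he
        · omega
        · have := Nat.not_even_iff_odd.1 he
          rcases this with ⟨k, hk⟩; omega
      · split_ifs at h ⊢ <;> simp at h
        omega
    unfold mrk
    rw [hc]
    split_ifs at hsup ⊢ <;> omega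
  · unfold mPhi
    rw [Multiset.sum_add, Multiset.sum_add, Multiset.sum_replicate, Multiset.sum_map_add]
    simp only [Multiset.map_id', Multiset.map_const', Multiset.sum_replicate, smul_eq_mul]
    generalize (s.erase s.sup).sum = A at *
    generalize s.sum = B at *
    split_ifs with he
    · rcases he with ⟨k, hk⟩
      simp only [Multiset.sum_singleton]; push_cast; omega
    · rcases Nat.not_even_iff_odd.1 he with ⟨k, hk⟩
      simp only [Multiset.sum_zero]; push_cast; omega

lemma psi_phi {m : ℤ} {s : Multiset ℕ} (hs : Mgood s) (hr : m ≤ mrk s) (h0 : s = 0 → m < 0) :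
    mPsi m (mPhi m s) = s := by
  obtain ⟨b1, b2, b3⟩ := base_data hs hr h0
  set s' := s.erase s.sup with hs'
  set k := ((((s.sup + 1) / 2 : ℕ) : ℤ) - m - 1).toNat - Multiset.card s' with hk
  have hphi : mPhi m s = s'.map (· + 2) + Multiset.replicate k 2 + (if Even s.sup then {1} else 0) := rfl
  have f1 : (mPhi m s).filter (fun x => 2 < x) = s'.map (· + 2) := by
    rw [hphi, Multiset.filter_add, Multiset.filter_add, Multiset.filter_eq_self.2, Multiset.filter_eq_nil.2, Multiset.filter_eq_nil.2]
    · simp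
    · intro a ha; split_ifs at ha <;> simp at ha; omega
    · intro a ha; have := Multiset.eq_of_mem_replicate ha; omega
    · intro a ha; obtain ⟨b, hb, rfl⟩ := Multiset.mem_map.1 ha; have := b3 b hb; omega
  have f2 : (mPhi m s).filter (fun x => 2 ≤ x) = s'.map (· + 2) + Multiset.replicate k 2 := by
    rw [hphi, Multiset.filter_add, Multiset.filter_add, Multiset.filter_eq_self.2, Multiset.filter_eq_self.2, Multiset.filter_eq_nil.2]
    · simp
    · intro a ha; split_ifs at ha <;> simp at ha; omega
    · intro a ha; have := Multiset.eq_of_mem_replicate ha; omega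
    · intro a ha; obtain ⟨b, hb, rfl⟩ := Multiset.mem_map.1 ha; omega
  have f3 : 1 ∈ mPhi m s ↔ Even s.sup := by
    rw [hphi]
    simp only [Multiset.mem_add, Multiset.mem_map, Multiset.mem_replicate]
    constructor
    · rintro ((⟨a, _, h⟩ | h) | h)
      · omega
      · omega
      · split_ifs at h with he
        · exact he
        · simp at h
    · intro h; right; simp [h]
  have f4 : mEll m (mPhi m s) = s.sup := by
    unfold mEll
    rw [f2]
    simp only [f3, Multiset.card_add, Multiset.card_map, Multiset.card_replicate]
    split_ifs with he
    · rcases he with ⟨i, hi⟩; push_cast; omega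
    · rcases Nat.not_even_iff_odd.1 he with ⟨i, hi⟩; push_cast; omega
  have f5 : (s'.map (· + 2)).map (· - 2) = s' := by
    rw [Multiset.map_map]; simp
  unfold mPsi
  rw [f4, f1, f5]
  by_cases h : s = 0
  · subst h; simp [hs']
  · have hm := sup_mem h
    rw [if_neg (by intro h; rw [h] at hm; exact hs.1 hm), hs', Multiset.cons_erase hm]

lemma filt2 (t : Multiset ℕ) : t.filter (fun x => 2 ≤ x) = t.filter (fun x => 2 < x) + Multiset.replicate (t.count 2) 2 := by
  ext x
  rw [Multiset.count_add, Multiset.count_replicate, Multiset.count_filter, Multiset.count_filter]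
  rcases lt_trichotomy x 2 with h | h | h
  · rw [if_neg (by omega), if_neg (by omega), if_neg (by omega)]
  · subst h; simp
  · rw [if_pos (by omega), if_pos (by omega), if_neg (by omega), add_zero]

lemma psi_data {m : ℤ} {t : Multiset ℕ} (ht : Mgood t) (hr : mrk t ≤ m + 1) (h0 : t = 0 → 0 ≤ m) (hm : m ≠ -1) :
    (mEll m t : ℤ) = 2 * (Multiset.card (t.filter (fun x => 2 ≤ x)) : ℤ) + 2 * m + 1 + (if 1 ∈ t then 1 else 0) ∧
    (∀ y ∈ (t.filter (fun x => 2 < x)).map (· - 2), y ≤ mEll m t ∧ (1 ∉ t → y < mEll m t) ∧ 0 < y) ∧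
    t = ((t.filter (fun x => 2 < x)).map (· - 2)).map (· + 2) + Multiset.replicate (t.count 2) 2 + (if 1 ∈ t then {1} else 0) := by
  have hmm : ((t.filter (fun x => 2 < x)).map (· - 2)).map (· + 2) = t.filter (fun x => 2 < x) := by
    rw [Multiset.map_map]
    conv_rhs => rw [← Multiset.map_id (t.filter (fun x => 2 < x))]
    apply Multiset.map_congr rfl
    intro x hx
    have := (Multiset.mem_filter.1 hx).2
    simp only [Function.comp, id]; omega
  have c1 : ∀ x : ℕ, (if 1 ∈ t then ({1} : Multiset ℕ) else 0).count x = if x = 1 then t.count 1 else 0 := by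
    intro x
    by_cases h : 1 ∈ t
    · have h1 := Multiset.one_le_count_iff_mem.2 h
      have h2 := ht.2 1 (by decide)
      rw [if_pos h, Multiset.count_singleton]
      split_ifs <;> omega
    · rw [if_neg h, Multiset.count_eq_zero_of_notMem h]; simp
  have f2 := filt2 t
  have hdec : t = t.filter (fun x => 2 < x) + Multiset.replicate (t.count 2) 2 + (if 1 ∈ t then {1} else 0) := by
    ext x
    rw [Multiset.count_add, ← f2, c1, Multiset.count_filter]
    rcases Nat.lt_or_ge x 2 with h | h
    · rw [if_neg (by omega)]
      interval_cases x
      · simp [ht.1]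
      · simp
    · rw [if_pos h, if_neg (by omega)]; simp
  have hc : (Multiset.card t : ℤ) = (Multiset.card (t.filter (fun x => 2 ≤ x)) : ℤ) + (if 1 ∈ t then 1 else 0) := by
    conv_lhs => rw [hdec, ← f2]
    split_ifs <;> simp
  have hel : ∀ x ∈ t, (((x + 1) / 2 : ℕ) : ℤ) ≤ m + 1 + (Multiset.card t : ℤ) := by
    intro x hx
    have := Multiset.le_sup hx
    unfold mrk at hr
    omega
  have hnn : (0:ℤ) ≤ 2 * (Multiset.card (t.filter (fun x => 2 ≤ x)) : ℤ) + 2 * m + 1 + (if 1 ∈ t then 1 else 0) := by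
    by_cases h : t = 0
    · have := h0 h
      subst h; simp; omega
    · by_cases h1 : t.filter (fun x => 2 ≤ x) = 0
      · have h2 : 1 ∈ t := by
          by_contra h2
          rw [← f2, h1, if_neg h2] at hdec
          exact h (by simpa using hdec)
        have := hel 1 h2
        rw [hc, h1, if_pos h2] at this
        simp at this
        rw [h1, if_pos h2]
        simp; omega
      · obtain ⟨x, hx⟩ := Multiset.exists_mem_of_ne_zero h1
        obtain ⟨hx1, hx2⟩ := Multiset.mem_filter.1 hx
        have := hel x hx1
        rw [hc] at this
        split_ifs at this ⊢ <;> omega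
  have hE : (mEll m t : ℤ) = 2 * (Multiset.card (t.filter (fun x => 2 ≤ x)) : ℤ) + 2 * m + 1 + (if 1 ∈ t then 1 else 0) := by
    unfold mEll; rw [Int.toNat_of_nonneg hnn]
  refine ⟨hE, ?_, ?_⟩
  · intro y hy
    obtain ⟨x, hx, rfl⟩ := Multiset.mem_map.1 hy
    obtain ⟨hx1, hx2⟩ := Multiset.mem_filter.1 hx
    have := hel x hx1
    rw [hc] at this
    refine ⟨?_, ?_, by omega⟩
    · split_ifs at this hE <;> omega
    · intro h; rw [if_neg h] at this hE; omega
  · rw [hmm]; exact hdec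

lemma psi_sup {m : ℤ} {t : Multiset ℕ} (ht : Mgood t) (hr : mrk t ≤ m + 1) (h0 : t = 0 → 0 ≤ m) (hm : m ≠ -1) :
    (mPsi m t).sup = mEll m t ∧ (mPsi m t).erase (mEll m t) = (t.filter (fun x => 2 < x)).map (· - 2) := by
  obtain ⟨b1, b2, b3⟩ := psi_data ht hr h0 hm
  unfold mPsi
  split_ifs with h
  · have : (t.filter (fun x => 2 < x)).map (· - 2) = 0 := by
      apply Multiset.eq_zero_of_forall_notMem
      intro y hy
      have := b2 y hy; omega
    rw [this, h]; simp
  · constructor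
    · rw [Multiset.sup_cons, sup_eq_left]
      exact Multiset.sup_le.2 (fun y hy => (b2 y hy).1)
    · simp

lemma phi_psi {m : ℤ} {t : Multiset ℕ} (ht : Mgood t) (hr : mrk t ≤ m + 1) (h0 : t = 0 → 0 ≤ m) (hm : m ≠ -1) :
    mPhi m (mPsi m t) = t := by
  obtain ⟨b1, b2, b3⟩ := psi_data ht hr h0 hm
  obtain ⟨c1, c2⟩ := psi_sup ht hr h0 hm
  unfold mPhi
  rw [c1, c2]
  conv_rhs => rw [b3]
  have f2 : Multiset.card (t.filter (fun x => 2 ≤ x)) = Multiset.card ((t.filter (fun x => 2 < x)).map (· - 2)) + t.count 2 := by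
    rw [filt2]; simp
  have ev : Even (mEll m t) ↔ 1 ∈ t := by
    rw [← Int.even_coe_nat, b1]
    split_ifs with h
    · simp only [h, iff_true]; exact ⟨(Multiset.card (t.filter (fun x => 2 ≤ x)) : ℤ) + m + 1, by ring⟩
    · simp only [h, iff_false, add_zero]
      rw [Int.not_even_iff_odd]
      exact ⟨(Multiset.card (t.filter (fun x => 2 ≤ x)) : ℤ) + m, by ring⟩
  have e : (((((mEll m t + 1) / 2 : ℕ) : ℤ) - m - 1).toNat - Multiset.card ((t.filter (fun x => 2 < x)).map (· - 2))) = t.count 2 := by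
    split_ifs at b1 <;> omega
  rw [e]
  simp only [ev]

lemma psi_mem {m : ℤ} {t : Multiset ℕ} (ht : Mgood t) (hr : mrk t ≤ m + 1) (h0 : t = 0 → 0 ≤ m) (hm : m ≠ -1) :
    Mgood (mPsi m t) ∧ m ≤ mrk (mPsi m t) ∧ (mPsi m t = 0 → m < 0) := by
  obtain ⟨b1, b2, b3⟩ := psi_data ht hr h0 hm
  obtain ⟨c1, c2⟩ := psi_sup ht hr h0 hm
  have cnt : ∀ j, Odd j → ((t.filter (fun x => 2 < x)).map (· - 2)).count j ≤ 1 := by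
    intro j hj
    have h1 : (((t.filter (fun x => 2 < x)).map (· - 2)).map (· + 2)).count (j + 2) = ((t.filter (fun x => 2 < x)).map (· - 2)).count j :=
      Multiset.count_map_eq_count' _ _ (add_left_injective 2) _
    rw [← h1]
    refine le_trans ?_ (ht.2 (j + 2) (by rcases hj with ⟨k, rfl⟩; exact ⟨k + 1, by ring⟩))
    conv_rhs => rw [b3]
    rw [Multiset.count_add, Multiset.count_add]
    omega
  have f2 : Multiset.card ((t.filter (fun x => 2 < x)).map (· - 2)) ≤ Multiset.card (t.filter (fun x => 2 ≤ x)) := by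
    rw [Multiset.card_map]
    exact Multiset.card_le_card (Multiset.monotone_filter_right _ (fun x h => by omega))
  have hcard : Multiset.card (mPsi m t) = Multiset.card ((t.filter (fun x => 2 < x)).map (· - 2)) + (if mEll m t = 0 then 0 else 1) := by
    unfold mPsi; split_ifs <;> simp
  refine ⟨⟨?_, ?_⟩, ?_, ?_⟩
  · unfold mPsi
    split_ifs with h
    · intro h'; have := b2 0 h'; omega
    · intro h'
      rcases Multiset.mem_cons.1 h' with h' | h'
      · omega
      · have := b2 0 h'; omega
  · intro j hj
    unfold mPsi
    split_ifs with h
    · exact cnt j hj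
    · rw [Multiset.count_cons]
      split_ifs with hj2
      · rw [Multiset.count_eq_zero_of_notMem]
        intro h'
        have h1 : 1 ∉ t := by
          intro h1
          rw [if_pos h1] at b1
          rcases hj with ⟨k, hk⟩
          omega
        have := (b2 j h').2.1 h1
        omega
      · exact cnt j hj
  · unfold mrk
    rw [c1, hcard]
    split_ifs at b1 ⊢ <;> omega
  · intro h
    rw [h] at c1
    simp at c1
    rw [← c1] at b1
    split_ifs at b1 <;> omega

open scoped Classical
open Filter Topology

abbrev MG := {s : Multiset ℕ // Mgood s}

def mgSigma : MG ≃ (Σ n : ℕ, {P : n.Partition // NoRepeatedOddParts P}) where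
  toFun s := ⟨s.1.sum, ⟨⟨s.1, fun {i} hi => Nat.pos_of_ne_zero (fun h => s.2.1 (h ▸ hi)), rfl⟩, s.2.2⟩⟩
  invFun x := ⟨x.2.1.parts, ⟨fun h => (x.2.1.parts_pos h).ne rfl, x.2.2⟩⟩
  left_inv s := rfl
  right_inv x := by
    obtain ⟨n, ⟨⟨parts, hp, rfl⟩, hP⟩⟩ := x
    rfl

lemma card_partition_le (n : ℕ) : Fintype.card n.Partition ≤ 2 ^ n := by
  have := Fintype.card_le_of_surjective _ (Nat.Partition.ofComposition_surj (n := n))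
  rw [composition_card] at this
  exact this.trans (Nat.pow_le_pow_right (by norm_num) (by omega))

lemma mg_summable {Q : ℝ} (h0 : 0 < Q) (h1 : Q < 1 / 2) : Summable (fun s : MG => Q ^ s.1.sum) := by
  rw [← mgSigma.symm.summable_iff]
  rw [summable_sigma_of_nonneg (fun x => by simp only [Function.comp]; positivity)]
  constructor
  · intro n; exact (hasSum_fintype _).summable
  · refine Summable.of_nonneg_of_le (fun n => tsum_nonneg (fun _ => by simp only [Function.comp]; positivity)) ?_ (summable_geometric_of_lt_one (r := 2 * Q) (by positivity) (by linarith))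
    intro n
    rw [tsum_fintype]
    have : ∀ x : {P : n.Partition // NoRepeatedOddParts P}, ((fun s : MG => Q ^ s.1.sum) ∘ mgSigma.symm) ⟨n, x⟩ = Q ^ n := by
      intro x
      simp only [Function.comp]
      congr 1
      exact x.1.parts_sum
    simp only [this, Finset.sum_const, nsmul_eq_mul, mul_pow]
    gcongr
    rw [Finset.card_univ]
    have := (Fintype.card_subtype_le (fun P : n.Partition => NoRepeatedOddParts P)).trans (card_partition_le n)
    exact_mod_cast this

/-- gf of partitions of rank ≥ m -/
noncomputable def gL (Q : ℝ) (m : ℤ) : ℝ := ∑' s : MG, if m ≤ mrk s.1 then Q ^ s.1.sum else 0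
noncomputable def gP (Q : ℝ) : ℝ := ∑' s : MG, Q ^ s.1.sum

lemma ite_summable {Q : ℝ} (h0 : 0 < Q) (h1 : Q < 1 / 2) (p : MG → Prop) [DecidablePred p] :
    Summable (fun s : MG => if p s then Q ^ s.1.sum else 0) := by
  refine Summable.of_nonneg_of_le (fun s => ?_) (fun s => ?_) (mg_summable h0 h1)
  · split_ifs <;> positivity
  · split_ifs
    · exact le_rfl
    · positivity

lemma gL_nonneg {Q : ℝ} (h0 : 0 < Q) (m : ℤ) : 0 ≤ gL Q m := tsum_nonneg (fun s => by split_ifs <;> positivity)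

lemma gL_le {Q : ℝ} (h0 : 0 < Q) (h1 : Q < 1 / 2) (m : ℤ) : gL Q m ≤ gP Q := by
  refine Summable.tsum_le_tsum (fun s => ?_) (ite_summable h0 h1 (fun s => m ≤ mrk s.1)) (mg_summable h0 h1)
  split_ifs
  · exact le_rfl
  · positivity

lemma bij_sum {Q : ℝ} (h0 : 0 < Q) (m : ℤ) (hm : m ≠ -1) :
    (∑' s : MG, if m ≤ mrk s.1 ∧ (s.1 = 0 → m < 0) then Q ^ s.1.sum else 0) =
    Q ^ (2 * m + 1) * ∑' t : MG, if mrk t.1 ≤ m + 1 ∧ (t.1 = 0 → 0 ≤ m) then Q ^ t.1.sum else 0 := by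
  let e : {s : MG | m ≤ mrk s.1 ∧ (s.1 = 0 → m < 0)} ≃ {t : MG | mrk t.1 ≤ m + 1 ∧ (t.1 = 0 → 0 ≤ m)} :=
    { toFun := fun s => ⟨⟨mPhi m s.1.1, (phi_mem s.1.2 s.2.1 s.2.2).1⟩, (phi_mem s.1.2 s.2.1 s.2.2).2.1, by
        intro h
        have h1 := (phi_mem s.1.2 s.2.1 s.2.2).2.2
        have h2 := psi_phi s.1.2 s.2.1 s.2.2
        simp only at h
        by_contra hneg
        have : mrk (mPhi m s.1.1) ≤ m + 1 := (phi_mem s.1.2 s.2.1 s.2.2).2.1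
        rw [h] at this
        simp [mrk] at this
        omega⟩
      invFun := fun t => ⟨⟨mPsi m t.1.1, (psi_mem t.1.2 t.2.1 t.2.2 hm).1⟩, (psi_mem t.1.2 t.2.1 t.2.2 hm).2⟩
      left_inv := fun s => by
        apply Subtype.ext; apply Subtype.ext
        exact psi_phi s.1.2 s.2.1 s.2.2
      right_inv := fun t => by
        apply Subtype.ext; apply Subtype.ext
        exact phi_psi t.1.2 t.2.1 t.2.2 hm }
  have A := tsum_subtype {s : MG | m ≤ mrk s.1 ∧ (s.1 = 0 → m < 0)} (fun s => Q ^ s.1.sum)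
  have B := tsum_subtype {t : MG | mrk t.1 ≤ m + 1 ∧ (t.1 = 0 → 0 ≤ m)} (fun s => Q ^ s.1.sum)
  simp only [Set.indicator_apply, Set.mem_setOf_eq] at A B
  rw [← A, ← B, ← e.tsum_eq, ← tsum_mul_left]
  congr 1
  ext s
  have := (phi_mem s.1.2 s.2.1 s.2.2).2.2
  change Q ^ s.1.1.sum = _ * Q ^ (mPhi m s.1.1).sum
  rw [← zpow_natCast, ← zpow_natCast, ← zpow_add₀ h0.ne', ← this, add_comm]

lemma gL_compl {Q : ℝ} (h0 : 0 < Q) (h1 : Q < 1 / 2) (m : ℤ) :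
    (∑' t : MG, if mrk t.1 ≤ m + 1 then Q ^ t.1.sum else 0) = gP Q - gL Q (m + 2) := by
  unfold gP gL
  rw [← (mg_summable h0 h1).tsum_sub (ite_summable h0 h1 (fun s => m + 2 ≤ mrk s.1))]
  congr 1
  ext s
  split_ifs <;> first | omega | simp

lemma gL_rel {Q : ℝ} (h0 : 0 < Q) (h1 : Q < 1 / 2) (m : ℤ) (hm : 1 ≤ m ∨ m ≤ -2) :
    gL Q m = Q ^ (2 * m + 1) * (gP Q - gL Q (m + 2)) := by
  have := bij_sum h0 m (by omega)
  rw [← gL_compl h0 h1]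
  unfold gL
  have e1 := this
  convert e1 using 3
  · rename_i s
    have : s.1 = 0 → mrk s.1 = 0 := by intro h; rw [h]; simp [mrk]
    by_cases hs : m ≤ mrk s.1
    · rw [if_pos hs, if_pos ⟨hs, fun h => by have := this h; omega⟩]
    · rw [if_neg hs, if_neg (fun h => hs h.1)]
  · ext s
    have : s.1 = 0 → mrk s.1 = 0 := by intro h; rw [h]; simp [mrk]
    by_cases hs : mrk s.1 ≤ m + 1
    · rw [if_pos hs, if_pos ⟨hs, fun h => by have := this h; omega⟩]
    · rw [if_neg hs, if_neg (fun h => hs h.1)]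

lemma gL_rel0 {Q : ℝ} (h0 : 0 < Q) (h1 : Q < 1 / 2) :
    gL Q 0 = 1 + Q * (gP Q - gL Q 2) := by
  have := bij_sum h0 0 (by omega)
  have c := gL_compl h0 h1 0
  rw [zero_add] at c
  have hz : Mgood 0 := ⟨by simp, by simp⟩
  have e : gL Q 0 = 1 + (∑' s : MG, if 0 ≤ mrk s.1 ∧ (s.1 = 0 → (0:ℤ) < 0) then Q ^ s.1.sum else 0) := by
    have H := (hasSum_ite_eq (⟨0, hz⟩ : MG) (1:ℝ)).add (ite_summable h0 h1 (fun s : MG => 0 ≤ mrk s.1 ∧ (s.1 = 0 → (0:ℤ) < 0))).hasSum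
    rw [← H.tsum_eq]
    unfold gL
    congr 1
    ext s
    by_cases hs : s = ⟨0, hz⟩
    · rw [if_pos hs, hs]; simp [mrk]
    · have : s.1 ≠ 0 := fun h => hs (Subtype.ext h)
      rw [if_neg hs, zero_add]
      simp [this]
  rw [e, this]
  rw [zero_add] at c
  rw [← c]
  norm_num

open scoped Classical
open Filter Topology

/-- exponent of lambda series -/
def lamE (m k : ℕ) : ℕ := (k + 1) * (2 * k + 1) + 2 * m * (k + 1)

lemma lam_iter {Q P : ℝ} (h0 : 0 < Q) (l : ℕ → ℝ)
    (h : ∀ m, 1 ≤ m → l m = Q ^ (2 * m + 1) * (P - l (m + 2))) (m : ℕ) (hm : 1 ≤ m) (K : ℕ) :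
    l m = P * ∑ k ∈ Finset.range K, (-1) ^ k * Q ^ lamE m k + (-1) ^ K * Q ^ (K * (2 * m) + (∑ i ∈ Finset.range K, (4 * i + 1))) * l (m + 2 * K) := by
  induction K with
  | zero => simp
  | succ K ih =>
    have hs : ∀ K : ℕ, (∑ i ∈ Finset.range K, (4 * i + 1)) + K = 2 * K ^ 2 := by
      intro K
      induction K with
      | zero => simp
      | succ K ih => rw [Finset.sum_range_succ]; nlinarith
    have h1 := hs K
    have e1 : K * (2 * m) + (∑ i ∈ Finset.range K, (4 * i + 1)) + (2 * (m + 2 * K) + 1) = lamE m K := by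
      unfold lamE; nlinarith
    have e2 : (K + 1) * (2 * m) + (∑ i ∈ Finset.range (K + 1), (4 * i + 1)) = lamE m K := by
      rw [← e1, Finset.sum_range_succ]; ring
    rw [ih, h (m + 2 * K) (by omega), Finset.sum_range_succ, e2, ← e1, show m + 2 * (K + 1) = m + 2 * K + 2 by ring]
    ring

lemma lam_hasSum {Q P : ℝ} (h0 : 0 < Q) (h1 : Q < 1) (l : ℕ → ℝ) (hb : ∀ m, |l m| ≤ P)
    (h : ∀ m, 1 ≤ m → l m = Q ^ (2 * m + 1) * (P - l (m + 2))) (m : ℕ) (hm : 1 ≤ m) :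
    l m = P * ∑' k : ℕ, (-1) ^ k * Q ^ lamE m k := by
  have hP : 0 ≤ P := (abs_nonneg _).trans (hb 0)
  have S : Summable (fun k : ℕ => (-1) ^ k * Q ^ lamE m k) := by
    apply Summable.of_norm_bounded (summable_geometric_of_lt_one h0.le h1)
    intro k
    rw [norm_mul, norm_pow, norm_neg, norm_one, one_pow, one_mul, Real.norm_of_nonneg (by positivity)]
    apply pow_le_pow_of_le_one h0.le h1.le
    unfold lamE; nlinarith
  have T := (S.hasSum.tendsto_sum_nat).const_mul P
  refine tendsto_nhds_unique (tendsto_const_nhds (f := (atTop : Filter ℕ))) ?_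
  have Z : Tendsto (fun K : ℕ => (-1) ^ K * Q ^ (K * (2 * m) + (∑ i ∈ Finset.range K, (4 * i + 1))) * l (m + 2 * K)) atTop (𝓝 0) := by
    have := (tendsto_pow_atTop_nhds_zero_of_lt_one h0.le h1).mul_const P
    rw [zero_mul] at this
    apply squeeze_zero_norm _ this
    intro K
    rw [norm_mul, norm_mul, norm_pow, norm_neg, norm_one, one_pow, one_mul, Real.norm_of_nonneg (by positivity)]
    apply mul_le_mul _ (hb _) (abs_nonneg _) (by positivity)
    apply pow_le_pow_of_le_one h0.le h1.le
    calc K = K * 1 := (mul_one K).symm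
      _ ≤ K * (2 * m) := Nat.mul_le_mul_left _ (by omega)
      _ ≤ _ := Nat.le_add_right _ _
  have := T.add Z
  rw [add_zero] at this
  refine this.congr (fun K => ?_)
  rw [← lam_iter h0 l h m hm K]

noncomputable def lam (Q : ℝ) (m : ℕ) : ℝ := ∑' k : ℕ, (-1) ^ k * Q ^ lamE m k

lemma gL_pos_eq {Q : ℝ} (h0 : 0 < Q) (h1 : Q < 1 / 2) (m : ℕ) (hm : 1 ≤ m) : gL Q m = gP Q * lam Q m := by
  refine lam_hasSum h0 (by linarith) (fun m => gL Q m) (fun m => ?_) (fun m hm => ?_) m hm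
  · rw [abs_of_nonneg (gL_nonneg h0 _)]; exact gL_le h0 h1 _
  · rw [gL_rel h0 h1 m (by omega)]
    push_cast
    congr 1

lemma gL_neg_eq {Q : ℝ} (h0 : 0 < Q) (h1 : Q < 1 / 2) (m : ℕ) (hm : 1 ≤ m) : gL Q (1 - m) = gP Q - gP Q * lam Q m := by
  have := lam_hasSum (P := gP Q) h0 (by linarith) (fun m => gP Q - gL Q (1 - m)) (fun m => ?_) (fun m hm => ?_) m hm
  · unfold lam
    linarith
  · have := gL_nonneg h0 (1 - m)
    have := gL_le h0 h1 (1 - m)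
    rw [abs_of_nonneg (by linarith)]; linarith
  · have := gL_rel h0 h1 (1 - ((m + 2 : ℕ):ℤ)) (by push_cast; omega)
    rw [this, show 1 - ((m + 2 : ℕ):ℤ) + 2 = 1 - m by push_cast; ring]
    have e : Q ^ (2 * m + 1) * Q ^ (2 * (1 - ((m + 2 : ℕ):ℤ)) + 1) = 1 := by
      rw [← zpow_natCast, ← zpow_add₀ h0.ne']
      convert zpow_zero Q using 2
      push_cast; ring
    linear_combination -(gP Q - gL Q (1 - m)) * e

lemma gP_th {Q : ℝ} (h0 : 0 < Q) (h1 : Q < 1 / 2) : gP Q * th Q = 1 := by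
  have a := gL_neg_eq h0 h1 1 le_rfl
  have b := gL_pos_eq h0 h1 2 (by norm_num)
  have c := gL_rel0 h0 h1
  norm_num at a b
  have hlam : ∀ m, HasSum (fun k : ℕ => (-1) ^ k * Q ^ lamE m k) (lam Q m) := by
    intro m
    refine Summable.hasSum ?_
    apply Summable.of_norm_bounded (summable_geometric_of_lt_one h0.le (by linarith : Q < 1))
    intro k
    rw [norm_mul, norm_pow, norm_neg, norm_one, one_pow, one_mul, Real.norm_of_nonneg (by positivity)]
    apply pow_le_pow_of_le_one h0.le (by linarith)
    unfold lamE; nlinarith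
  have t : th Q = 1 - lam Q 1 - Q + Q * lam Q 2 := by
    have H1 : HasSum (fun n : ℕ => (-1 : ℝ) ^ (n:ℤ) * Q ^ (2 * (n:ℤ) ^ 2 + n)) (1 - lam Q 1) := by
      rw [← hasSum_nat_add_iff' 1]
      simp
      refine ((hlam 1).neg).congr_fun ?_
      intro k
      have : 2 * ((k:ℤ) + 1) ^ 2 + (k + 1) = ((lamE 1 k : ℕ) : ℤ) := by unfold lamE; push_cast; ring
      rw [this, zpow_natCast, ← Nat.cast_succ, zpow_natCast, pow_succ]; ring
    have H2 : HasSum (fun n : ℕ => (-1 : ℝ) ^ (-((n:ℤ) + 1)) * Q ^ (2 * (-((n:ℤ) + 1)) ^ 2 + (-((n:ℤ) + 1)))) (- Q + Q * lam Q 2) := by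
      rw [← hasSum_nat_add_iff' 1]
      simp
      refine ((hlam 2).mul_left Q).congr_fun ?_
      intro k
      have e1 : 2 * (-1 + (-1 + -(k:ℤ))) ^ 2 + (-1 + (-1 + -k)) = ((lamE 2 k + 1 : ℕ) : ℤ) := by unfold lamE; push_cast; ring
      have e : (-1 + (-1 + -(k:ℤ))) = -((k + 2 : ℕ) : ℤ) := by push_cast; ring
      have e2 : (-1 : ℝ) ^ (-1 + (-1 + -(k:ℤ))) = (-1) ^ k := by
        rw [e, zpow_neg, zpow_natCast, pow_add]
        rcases Nat.even_or_odd k with h | h <;> simp [h.neg_one_pow]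
      rw [e1, e2, zpow_natCast, pow_succ]; ring
    have := H1.of_nat_of_neg_add_one (f := fun n : ℤ => (-1 : ℝ) ^ n * Q ^ (2 * n ^ 2 + n)) H2
    unfold th
    rw [this.tsum_eq]; ring
  rw [t]
  rw [a, b] at c
  linear_combination c

lemma chi_aux (c : ℝ) (x t : ℤ) :
    (if 10 * t + 1 ≤ x then c else 0) - 2 * (if 10 * t + 3 ≤ x then c else 0) + (if 10 * t + 5 ≤ x then c else 0)
     = if t = x / 10 then (if x % 10 = 1 ∨ x % 10 = 2 then 1 else if x % 10 = 3 ∨ x % 10 = 4 then -1 else 0) * c else 0 := by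
  split_ifs <;> first | omega | ring

lemma gchi_hasSum {Q : ℝ} (h0 : 0 < Q) (h1 : Q < 1 / 2) (χ : ℤ → ℝ)
    (hχ : ∀ x : ℤ, χ x = if x % 10 = 1 ∨ x % 10 = 2 then 1 else if x % 10 = 3 ∨ x % 10 = 4 then -1 else 0) :
    HasSum (fun t : ℤ => gL Q (10 * t + 1) - 2 * gL Q (10 * t + 3) + gL Q (10 * t + 5)) (∑' s : MG, χ (mrk s.1) * Q ^ s.1.sum) := by
  obtain ⟨u, hu0⟩ : ∃ u : MG × ℤ → ℝ, ∀ s t, u (s, t) = (if 10 * t + 1 ≤ mrk s.1 then Q ^ s.1.sum else 0)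
      - 2 * (if 10 * t + 3 ≤ mrk s.1 then Q ^ s.1.sum else 0) + (if 10 * t + 5 ≤ mrk s.1 then Q ^ s.1.sum else 0) :=
    ⟨fun x => (if 10 * x.2 + 1 ≤ mrk x.1.1 then Q ^ x.1.1.sum else 0)
      - 2 * (if 10 * x.2 + 3 ≤ mrk x.1.1 then Q ^ x.1.1.sum else 0) + (if 10 * x.2 + 5 ≤ mrk x.1.1 then Q ^ x.1.1.sum else 0), fun s t => rfl⟩
  have hu : ∀ s t, u (s, t) = if t = mrk s.1 / 10 then χ (mrk s.1) * Q ^ s.1.sum else 0 := by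
    intro s t
    rw [hu0, hχ]
    exact chi_aux (Q ^ s.1.sum) (mrk s.1) t
  have hrow : ∀ s : MG, HasSum (fun t => u (s, t)) (χ (mrk s.1) * Q ^ s.1.sum) := by
    intro s
    simp only [hu]
    exact hasSum_ite_eq _ _
  have hχ1 : ∀ x, |χ x| ≤ 1 := by
    intro x; rw [hχ]; split_ifs <;> norm_num
  have hus : Summable u := by
    apply Summable.of_norm
    rw [summable_prod_of_nonneg (fun x => norm_nonneg _)]
    have hn : ∀ s t, ‖u (s, t)‖ = if t = mrk s.1 / 10 then |χ (mrk s.1)| * Q ^ s.1.sum else 0 := by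
      intro s t; rw [hu]; split_ifs
      · rw [norm_mul, Real.norm_eq_abs, Real.norm_of_nonneg (by positivity)]
      · simp
    have hn' : ∀ s : MG, HasSum (fun t => ‖u (s, t)‖) (|χ (mrk s.1)| * Q ^ s.1.sum) := by
      intro s; simp only [hn]; exact hasSum_ite_eq _ _
    refine ⟨fun s => (hn' s).summable, ?_⟩
    simp only [fun s => (hn' s).tsum_eq]
    refine Summable.of_nonneg_of_le (fun s => by positivity) (fun s => ?_) (mg_summable h0 h1)
    have : 0 < Q ^ s.1.sum := by positivity
    nlinarith [hχ1 (mrk s.1)]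
  have hA : ∑' x, u x = ∑' s : MG, χ (mrk s.1) * Q ^ s.1.sum := by
    rw [hus.tsum_prod' (fun s => (hrow s).summable)]
    simp only [fun s => (hrow s).tsum_eq]
  have hsw : Summable (fun x : ℤ × MG => u (x.2, x.1)) := (Equiv.prodComm ℤ MG).summable_iff.2 hus
  have hB : HasSum (fun x : ℤ × MG => u (x.2, x.1)) (∑' s : MG, χ (mrk s.1) * Q ^ s.1.sum) := by
    rw [← hA]
    exact (Equiv.prodComm ℤ MG).hasSum_iff.2 hus.hasSum
  refine hB.prod_fiberwise (fun t => ?_)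
  have i : ∀ m : ℤ, HasSum (fun s : MG => if m ≤ mrk s.1 then Q ^ s.1.sum else 0) (gL Q m) := fun m =>
    (ite_summable h0 h1 (fun s => m ≤ mrk s.1)).hasSum
  simp only [hu0]
  exact ((i (10 * t + 1)).sub ((i (10 * t + 3)).mul_left 2)).add (i (10 * t + 5))

lemma lam_hs {Q : ℝ} (h0 : 0 < Q) (h1 : Q < 1) (m : ℕ) : HasSum (fun k : ℕ => (-1) ^ k * Q ^ lamE m k) (lam Q m) := by
  refine Summable.hasSum ?_
  apply Summable.of_norm_bounded (summable_geometric_of_lt_one h0.le h1)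
  intro k
  rw [norm_mul, norm_pow, norm_neg, norm_one, one_pow, one_mul, Real.norm_of_nonneg (by positivity)]
  apply pow_le_pow_of_le_one h0.le h1.le
  unfold lamE; nlinarith

lemma gchi_th {r : ℝ} (hr0 : 0 < r) (hr1 : r ^ 8 < 1 / 2) (χ : ℤ → ℝ)
    (hχ : ∀ x : ℤ, χ x = if x % 10 = 1 ∨ x % 10 = 2 then 1 else if x % 10 = 3 ∨ x % 10 = 4 then -1 else 0) :
    (∑' s : MG, χ (mrk s.1) * (r ^ 8) ^ s.1.sum) = gP (r ^ 8) * SS (r ^ 8) := by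
  have hrr : r < 1 := by
    by_contra h
    have : 1 ≤ r ^ 8 := one_le_pow₀ (by linarith)
    linarith
  have hSS := (SS_terms_hasSum hr0 hrr).summable.hasSum
  set Q := r ^ 8 with hQ
  clear_value Q
  have h0 : 0 < Q := by rw [hQ]; positivity
  have h1 : Q < 1 := by linarith
  have A := gchi_hasSum h0 hr1 χ hχ
  have A' := A.nat_add_neg_add_one
  -- column sums
  let v : ℕ × ℕ → ℝ := fun x => (-1) ^ x.2 * (Q ^ lamE (10 * x.1 + 1) x.2 - 2 * Q ^ lamE (10 * x.1 + 3) x.2 + Q ^ lamE (10 * x.1 + 5) x.2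
    - Q ^ lamE (10 * x.1 + 6) x.2 + 2 * Q ^ lamE (10 * x.1 + 8) x.2 - Q ^ lamE (10 * x.1 + 10) x.2)
  have B : HasSum (fun t : ℕ => gP Q * ∑' k, v (t, k)) (∑' s : MG, χ (mrk s.1) * Q ^ s.1.sum) := by
    refine A'.congr_fun ?_
    intro t
    have e : ∑' k, v (t, k) = lam Q (10 * t + 1) - 2 * lam Q (10 * t + 3) + lam Q (10 * t + 5) - lam Q (10 * t + 6) + 2 * lam Q (10 * t + 8) - lam Q (10 * t + 10) := by
      have l := fun m => lam_hs h0 h1 m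
      refine HasSum.tsum_eq ?_
      refine ((((((l (10 * t + 1)).sub ((l (10 * t + 3)).mul_left 2)).add (l (10 * t + 5))).sub (l (10 * t + 6))).add ((l (10 * t + 8)).mul_left 2)).sub (l (10 * t + 10))).congr_fun ?_
      intro k
      simp only [v]; ring
    have p1 := gL_pos_eq h0 hr1 (10 * t + 1) (by omega)
    have p3 := gL_pos_eq h0 hr1 (10 * t + 3) (by omega)
    have p5 := gL_pos_eq h0 hr1 (10 * t + 5) (by omega)
    have p6 := gL_neg_eq h0 hr1 (10 * t + 6) (by omega)
    have p8 := gL_neg_eq h0 hr1 (10 * t + 8) (by omega)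
    have p10 := gL_neg_eq h0 hr1 (10 * t + 10) (by omega)
    push_cast at p1 p3 p5 p6 p8 p10
    rw [e, p1, p3, p5, show (10:ℤ) * -(t + 1) + 1 = 1 - (10 * t + 10) by ring, show (10:ℤ) * -(t + 1) + 3 = 1 - (10 * t + 8) by ring,
      show (10:ℤ) * -(t + 1) + 5 = 1 - (10 * t + 6) by ring, p6, p8, p10]
    ring
  rw [← B.tsum_eq, tsum_mul_left]
  congr 1
  have vs : Summable v := by
    have g := summable_geometric_of_lt_one h0.le h1
    have gg := (g.mul_of_nonneg g (fun _ => by positivity) (fun _ => by positivity)).mul_left 8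
    apply Summable.of_norm_bounded gg
    rintro ⟨t, k⟩
    simp only [v]
    rw [norm_mul, norm_pow, norm_neg, norm_one, one_pow, one_mul]
    have b : ∀ m, t ≤ m → 0 ≤ Q ^ lamE m k ∧ Q ^ lamE m k ≤ Q ^ t * Q ^ k := by
      intro m hm
      refine ⟨by positivity, ?_⟩
      rw [← pow_add]
      apply pow_le_pow_of_le_one h0.le h1.le
      unfold lamE; nlinarith
    have b1 := b (10 * t + 1) (by omega)
    have b2 := b (10 * t + 3) (by omega)
    have b3 := b (10 * t + 5) (by omega)
    have b4 := b (10 * t + 6) (by omega)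
    have b5 := b (10 * t + 8) (by omega)
    have b6 := b (10 * t + 10) (by omega)
    rw [Real.norm_eq_abs, abs_le]
    constructor <;> linarith
  have vs' : Summable (fun c : ℕ × ℕ => v ((Equiv.prodComm ℕ ℕ) c)) := (Equiv.prodComm ℕ ℕ).summable_iff.2 vs
  rw [← vs.tsum_prod' (fun t => vs.comp_injective (Prod.mk_right_injective t)), ← (Equiv.prodComm ℕ ℕ).tsum_eq,
    vs'.tsum_prod' (fun t => vs'.comp_injective (Prod.mk_right_injective t))]
  unfold SS
  have C := hSS.nat_add_neg
  rw [← hasSum_nat_add_iff' 1] at C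
  simp only [Finset.range_one, Finset.sum_singleton] at C
  norm_num at C
  rw [← C.neg.tsum_eq]
  congr 1
  ext k
  obtain ⟨x, hx⟩ : ∃ x, x = Q ^ (k + 1) := ⟨_, rfl⟩
  have hy0 : 0 < x := by rw [hx]; positivity
  have hy1 : x < 1 := by rw [hx]; exact pow_lt_one₀ h0.le h1 (by omega)
  obtain ⟨w, hw⟩ : ∃ w, w = Q ^ ((k + 1) * (2 * k + 1)) := ⟨_, rfl⟩
  have hv : ∀ t, v (t, k) = ((-1) ^ k * w * (x ^ 2 - 2 * x ^ 6 + x ^ 10 - x ^ 12 + 2 * x ^ 16 - x ^ 20)) * (x ^ 20) ^ t := by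
    intro t
    have : ∀ m, Q ^ lamE m k = w * x ^ (2 * m) := by
      intro m; rw [hw, hx, ← pow_mul, ← pow_add]; unfold lamE; congr 1; ring
    simp only [v, this]
    ring
  have hx20 : x ^ 20 < 1 := pow_lt_one₀ hy0.le hy1 (by norm_num)
  have e0 : ∑' t, v (t, k) = ((-1) ^ k * w * (x ^ 2 - 2 * x ^ 6 + x ^ 10 - x ^ 12 + 2 * x ^ 16 - x ^ 20)) * (1 - x ^ 20)⁻¹ := by
    simp only [hv]
    rw [tsum_mul_left, tsum_geometric_of_lt_one (by positivity) hx20]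
  have ez : ∀ m : ℕ, Q ^ ((m : ℤ) * (k + 1)) = x ^ m := by
    intro m; rw [hx, ← pow_mul, ← zpow_natCast]; congr 1; push_cast; ring
  have ezn : ∀ m : ℕ, Q ^ (-((m : ℤ) * (k + 1))) = (x ^ m)⁻¹ := by
    intro m; rw [zpow_neg, ez]
  have q1 : Q ^ (2 * ((k:ℤ) + 1) ^ 2 + (k + 1)) = w * x ^ 2 := by
    rw [hw, hx, ← pow_mul, ← pow_add, ← zpow_natCast]; congr 1; push_cast; ring
  have q2 : Q ^ (2 * ((k:ℤ) + 1) ^ 2 - (k + 1)) = w := by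
    rw [hw, ← zpow_natCast]; congr 1; push_cast; ring
  have s1 : (-1 : ℝ) ^ ((k:ℤ) + 1) = - (-1) ^ k := by
    rw [← Nat.cast_succ, zpow_natCast, pow_succ]; ring
  have s2 : (-1 : ℝ) ^ (-((k:ℤ) + 1)) = - (-1) ^ k := by
    rw [zpow_neg, s1]; rcases Nat.even_or_odd k with h | h <;> simp [h.neg_one_pow]
  have z4 := ez 4
  have z20 := ez 20
  have y4 := ezn 4
  have y20 := ezn 20
  push_cast at z4 z20 y4 y20
  have C0 : (∑' t, v (t, k)) = -((-1) ^ ((k:ℤ) + 1) * Q ^ (2 * ((k:ℤ) + 1) ^ 2 + (k + 1)) * (1 - Q ^ (4 * ((k:ℤ) + 1))) ^ 2 / (1 - Q ^ (20 * ((k:ℤ) + 1)))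
      + (-1) ^ (-((k:ℤ) + 1)) * Q ^ (2 * ((k:ℤ) + 1) ^ 2 - (k + 1)) * (1 - Q ^ (-(4 * ((k:ℤ) + 1)))) ^ 2 / (1 - Q ^ (-(20 * ((k:ℤ) + 1))))) := by
    rw [e0, q1, q2, s1, s2, z4, z20, y4, y20]
    have d1 : 1 - x ^ 20 ≠ 0 := by linarith
    have d2 : 1 - (x ^ 20)⁻¹ = - (1 - x ^ 20) * (x ^ 20)⁻¹ := by field_simp; ring
    rw [d2]
    field_simp
    ring
  rw [show (4:ℤ) * (-1 + -(k:ℤ)) = -(4 * (k + 1)) by ring, show (20:ℤ) * (-1 + -(k:ℤ)) = -(20 * (k + 1)) by ring,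
    show 2 * (-1 + -(k:ℤ)) ^ 2 + (-1 + -(k:ℤ)) = 2 * ((k:ℤ) + 1) ^ 2 - (k + 1) by ring, show (-1 + -(k:ℤ)) = -(k + 1) by ring]
  exact C0

open scoped Classical
open Filter Topology

noncomputable def fN (n : ℕ) : ℝ := (N2 1 10 n : ℝ) + N2 2 10 n - N2 3 10 n - N2 4 10 n

noncomputable def chi10 (x : ℤ) : ℝ := if x % 10 = 1 ∨ x % 10 = 2 then 1 else if x % 10 = 3 ∨ x % 10 = 4 then -1 else 0

lemma N2_sum (r : ℤ) (n : ℕ) : (N2 r 10 n : ℝ) =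
    ∑ P : {P : n.Partition // NoRepeatedOddParts P}, if m2Rank P.1 ≡ r [ZMOD 10] then (1:ℝ) else 0 := by
  unfold N2
  rw [← Nat.card_congr (Equiv.subtypeSubtypeEquivSubtypeInter _ _), Nat.card_eq_fintype_card, Fintype.card_subtype,
    Finset.card_filter]
  push_cast
  rfl

lemma fN_sum (n : ℕ) : fN n = ∑ P : {P : n.Partition // NoRepeatedOddParts P}, chi10 (m2Rank P.1) := by
  unfold fN
  rw [N2_sum, N2_sum, N2_sum, N2_sum, ← Finset.sum_add_distrib, ← Finset.sum_sub_distrib, ← Finset.sum_sub_distrib]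
  refine Finset.sum_congr rfl (fun P _ => ?_)
  unfold chi10 Int.ModEq
  generalize m2Rank P.1 = x
  norm_num only
  by_cases a1 : x % 10 = 1
  · simp [a1]
  by_cases a2 : x % 10 = 2
  · simp [a2]
  by_cases a3 : x % 10 = 3
  · simp [a3]
  by_cases a4 : x % 10 = 4
  · simp [a4]
  simp [a1, a2, a3, a4]

lemma fN_hasSum {Q : ℝ} (h0 : 0 < Q) (h1 : Q < 1 / 2) :
    HasSum (fun n => fN n * Q ^ n) (∑' s : MG, chi10 (mrk s.1) * Q ^ s.1.sum) := by
  have hs : Summable (fun s : MG => chi10 (mrk s.1) * Q ^ s.1.sum) := by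
    refine Summable.of_norm_bounded (mg_summable h0 h1) (fun s => ?_)
    have : 0 < Q ^ s.1.sum := by positivity
    have h : |chi10 (mrk s.1)| ≤ 1 := by unfold chi10; split_ifs <;> norm_num
    rw [norm_mul, Real.norm_eq_abs, Real.norm_of_nonneg this.le]
    nlinarith
  have H := mgSigma.symm.hasSum_iff.2 hs.hasSum
  refine H.sigma (fun n => ?_)
  rw [fN_sum, Finset.sum_mul]
  have : ∀ P : {P : n.Partition // NoRepeatedOddParts P}, chi10 (m2Rank P.1) * Q ^ n =
     ((fun s : MG => chi10 (mrk s.1) * Q ^ s.1.sum) ∘ mgSigma.symm) ⟨n, P⟩ := by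
    intro P
    have : P.1.parts.sum = n := P.1.parts_sum
    change _ = chi10 (mrk P.1.parts) * Q ^ P.1.parts.sum
    rw [this]; rfl
  simp only [this]
  exact hasSum_fintype _

lemma fN_main {r : ℝ} (hr0 : 0 < r) (hr1 : r ^ 8 < 1 / 2) :
    HasSum (fun n => fN n * (r ^ 8) ^ n) (r * (alt0 (sk r 1) (sk r 2) (sk r 3) (sk r 4) (sk r 5) (sk r 6) (sk r 7) (sk r 8) (sk r 9) (sk r 10) (GJ r)
     + alF1 (sk r 1) (sk r 2) (sk r 3) (sk r 4) (sk r 5) (sk r 6) (sk r 7) (sk r 8) (sk r 9) (sk r 10) (GJ r)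
     + alt2 (sk r 1) (sk r 2) (sk r 3) (sk r 4) (sk r 5) (sk r 6) (sk r 7) (sk r 8) (sk r 9) (sk r 10) (GJ r)
     + alF3 (sk r 1) (sk r 2) (sk r 3) (sk r 4) (sk r 5) (sk r 6) (sk r 7) (sk r 8) (sk r 9) (sk r 10) (GJ r)
     + alF4 (sk r 1) (sk r 2) (sk r 3) (sk r 4) (sk r 5) (sk r 6) (sk r 7) (sk r 8) (sk r 9) (sk r 10) (GJ r)
     - mu r 9 3 - mu r 1 7 - mu r 5 3 - mu r 5 7)) := by
  have h := fN_hasSum (Q := r ^ 8) (by positivity) hr1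
  have hrr : r < 1 := by
    by_contra h
    have : 1 ≤ r ^ 8 := one_le_pow₀ (by linarith)
    linarith
  rw [gchi_th hr0 hr1 chi10 (fun x => rfl), main_theta hr0 hrr, ← mul_assoc, gP_th (by positivity) hr1, one_mul] at h
  exact h

open Filter Topology

def PSn (c : ℕ → ℝ) (h : ℝ → ℝ) : Prop := ∀ q : ℝ, 0 < q → q < 1 → HasSum (fun n => c n * q ^ n) (h q)
def NN (h : ℝ → ℝ) : Prop := ∃ c : ℕ → ℝ, (∀ n, 0 ≤ c n) ∧ PSn c h
def N1 (h : ℝ → ℝ) : Prop := ∃ c : ℕ → ℝ, (∀ n, 0 ≤ c n) ∧ 1 ≤ c 0 ∧ PSn c h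

lemma PSn.congr {c : ℕ → ℝ} {h k : ℝ → ℝ} (H : PSn c h) (e : ∀ q, 0 < q → q < 1 → k q = h q) : PSn c k := by
  intro q h0 h1; rw [e q h0 h1]; exact H q h0 h1
lemma NN.congr {h k : ℝ → ℝ} (H : NN h) (e : ∀ q, 0 < q → q < 1 → k q = h q) : NN k := by
  obtain ⟨c, h1, h2⟩ := H
  exact ⟨c, h1, h2.congr e⟩
lemma N1.congr {h k : ℝ → ℝ} (H : N1 h) (e : ∀ q, 0 < q → q < 1 → k q = h q) : N1 k := by
  obtain ⟨c, h0, h1, h2⟩ := H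
  exact ⟨c, h0, h1, h2.congr e⟩
lemma N1.nn {h : ℝ → ℝ} (H : N1 h) : NN h := by
  obtain ⟨c, h0, h1, h2⟩ := H
  exact ⟨c, h0, h2⟩
lemma NN.add {h k : ℝ → ℝ} (H : NN h) (K : NN k) : NN (fun q => h q + k q) := by
  obtain ⟨c, h1, h2⟩ := H
  obtain ⟨d, k1, k2⟩ := K
  refine ⟨fun n => c n + d n, fun n => add_nonneg (h1 n) (k1 n), fun q q0 q1 => ?_⟩
  refine ((h2 q q0 q1).add (k2 q q0 q1)).congr_fun ?_
  intro n; ring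
lemma N1.add {h k : ℝ → ℝ} (H : N1 h) (K : NN k) : N1 (fun q => h q + k q) := by
  obtain ⟨c, h1, h3, h2⟩ := H
  obtain ⟨d, k1, k2⟩ := K
  refine ⟨fun n => c n + d n, fun n => add_nonneg (h1 n) (k1 n), by have := k1 0; simp only; linarith, fun q q0 q1 => ?_⟩
  refine ((h2 q q0 q1).add (k2 q q0 q1)).congr_fun ?_
  intro n; ring
lemma NN.smul {h : ℝ → ℝ} (H : NN h) {a : ℝ} (ha : 0 ≤ a) : NN (fun q => a * h q) := by
  obtain ⟨c, h1, h2⟩ := H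
  refine ⟨fun n => a * c n, fun n => mul_nonneg ha (h1 n), fun q q0 q1 => ?_⟩
  refine ((h2 q q0 q1).mul_left a).congr_fun ?_
  intro n; ring

def cauchy (c d : ℕ → ℝ) (n : ℕ) : ℝ := ∑ x ∈ Finset.HasAntidiagonal.antidiagonal n, c x.1 * d x.2

lemma PSn.mul {h k : ℝ → ℝ} {c d : ℕ → ℝ} (hc : ∀ n, 0 ≤ c n) (hd : ∀ n, 0 ≤ d n) (H : PSn c h) (K : PSn d k) :
    PSn (cauchy c d) (fun q => h q * k q) := by
  intro q q0 q1
  have a := H q q0 q1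
  have b := K q q0 q1
  have na : Summable (fun n => ‖c n * q ^ n‖) := a.summable.norm
  have nb : Summable (fun n => ‖d n * q ^ n‖) := b.summable.norm
  have e := tsum_mul_tsum_eq_tsum_sum_antidiagonal_of_summable_norm na nb
  have s := (summable_norm_sum_mul_antidiagonal_of_summable_norm na nb).of_norm.hasSum
  rw [← e, a.tsum_eq, b.tsum_eq] at s
  refine s.congr_fun ?_
  intro n
  unfold cauchy
  rw [Finset.sum_mul]
  refine Finset.sum_congr rfl (fun x hx => ?_)
  rw [← Finset.HasAntidiagonal.mem_antidiagonal.1 hx, pow_add]; ring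

lemma cauchy_nonneg {c d : ℕ → ℝ} (hc : ∀ n, 0 ≤ c n) (hd : ∀ n, 0 ≤ d n) (n : ℕ) : 0 ≤ cauchy c d n :=
  Finset.sum_nonneg (fun x _ => mul_nonneg (hc _) (hd _))

lemma cauchy_ge {c d : ℕ → ℝ} (hc : ∀ n, 0 ≤ c n) (hd : ∀ n, 0 ≤ d n) (h1 : 1 ≤ d 0) (n : ℕ) : c n ≤ cauchy c d n := by
  have : c n * d 0 ≤ cauchy c d n :=
    Finset.single_le_sum (f := fun x : ℕ × ℕ => c x.1 * d x.2) (fun x _ => mul_nonneg (hc _) (hd _))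
      (a := (n, 0)) (s := Finset.HasAntidiagonal.antidiagonal n) (Finset.HasAntidiagonal.mem_antidiagonal.2 (add_zero n))
  nlinarith [hc n]

lemma NN.mul {h k : ℝ → ℝ} (H : NN h) (K : NN k) : NN (fun q => h q * k q) := by
  obtain ⟨c, h1, h2⟩ := H
  obtain ⟨d, k1, k2⟩ := K
  exact ⟨_, cauchy_nonneg h1 k1, h2.mul h1 k1 k2⟩
lemma N1.mul {h k : ℝ → ℝ} (H : N1 h) (K : N1 k) : N1 (fun q => h q * k q) := by
  obtain ⟨c, h1, h3, h2⟩ := H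
  obtain ⟨d, k1, k3, k2⟩ := K
  exact ⟨_, cauchy_nonneg h1 k1, h3.trans (cauchy_ge h1 k1 k3 0), h2.mul h1 k1 k2⟩
lemma N1.pow {h : ℝ → ℝ} (H : N1 h) (n : ℕ) : N1 (fun q => h q ^ (n + 1)) := by
  induction n with
  | zero => exact H.congr (fun q _ _ => by ring)
  | succ n ih => exact (ih.mul H).congr (fun q _ _ => by ring)

lemma PSn.monomial (k : ℕ) : PSn (fun n => if n = k then 1 else 0) (fun q => q ^ k) := by
  intro q _ _
  refine (hasSum_ite_eq k (q ^ k)).congr_fun ?_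
  intro n; split_ifs with h <;> simp [h]
lemma NN.monomial (k : ℕ) : NN (fun q => q ^ k) := by
  refine ⟨_, fun n => ?_, PSn.monomial k⟩
  split_ifs <;> norm_num
lemma N1.one : N1 (fun _ => 1) := by
  refine ⟨_, fun n => ?_, ?_, (PSn.monomial 0).congr (fun q _ _ => (pow_zero q).symm)⟩
  · split_ifs <;> norm_num
  · simp

/-- difference of N1 with 1 -/
lemma N1.sub_one {h : ℝ → ℝ} (H : N1 h) : NN (fun q => h q - 1) := by
  obtain ⟨c, h1, h3, h2⟩ := H
  refine ⟨fun n => c n - (if n = 0 then 1 else 0), fun n => ?_, fun q q0 q1 => ?_⟩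
  · beta_reduce
    split_ifs with h
    · rw [h]; linarith
    · simpa using h1 n
  · have := (h2 q q0 q1).sub (PSn.monomial 0 q q0 q1)
    beta_reduce at this
    rw [pow_zero] at this
    refine this.congr_fun ?_
    intro n; ring

lemma mono_lim (c : ℕ → ℕ → ℝ) (H : ℕ → ℝ → ℝ) (h : ℝ → ℝ) (h0 : ∀ N n, 0 ≤ c N n) (hm : ∀ n, Monotone (fun N => c N n))
    (hP : ∀ N, PSn (c N) (H N)) (hl : ∀ q, 0 < q → q < 1 → Tendsto (fun N => H N q) atTop (𝓝 (h q))) :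
    ∃ c', PSn c' h ∧ ∀ N n, c N n ≤ c' n := by
  have hHm : ∀ q, 0 < q → q < 1 → Monotone (fun N => H N q) := by
    intro q q0 q1 a b hab
    exact hasSum_le (fun n => mul_le_mul_of_nonneg_right (hm n hab) (by positivity)) (hP a q q0 q1) (hP b q q0 q1)
  have hHb : ∀ q, 0 < q → q < 1 → ∀ N, H N q ≤ h q := fun q q0 q1 N => (hHm q q0 q1).ge_of_tendsto (hl q q0 q1) N
  have hsum : ∀ q, 0 < q → q < 1 → ∀ N (s : Finset ℕ), ∑ n ∈ s, c N n * q ^ n ≤ h q := fun q q0 q1 N s =>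
    (sum_le_hasSum s (fun n _ => mul_nonneg (h0 N n) (by positivity)) (hP N q q0 q1)).trans (hHb q q0 q1 N)
  have hlim : ∀ n, ∃ l, Tendsto (fun N => c N n) atTop (𝓝 l) := by
    intro n
    refine ⟨_, tendsto_atTop_ciSup (hm n) ⟨h (1/2) / (1/2) ^ n, ?_⟩⟩
    rintro _ ⟨N, rfl⟩
    have := hsum (1/2) (by norm_num) (by norm_num) N {n}
    rw [Finset.sum_singleton] at this
    rw [le_div_iff₀ (by positivity)]
    exact this
  choose c' hc' using hlim
  have hle : ∀ N n, c N n ≤ c' n := fun N n => (hm n).ge_of_tendsto (hc' n) N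
  refine ⟨c', fun q q0 q1 => ?_, hle⟩
  have c0 : ∀ n, 0 ≤ c' n := fun n => (h0 0 n).trans (hle 0 n)
  have hs : Summable (fun n => c' n * q ^ n) := by
    apply summable_of_sum_le (c := h q) (fun n => mul_nonneg (c0 n) (by positivity))
    intro s
    refine le_of_tendsto (tendsto_finset_sum s (fun n _ => (hc' n).mul_const (q ^ n))) (Eventually.of_forall (fun N => hsum q q0 q1 N s))
  have T := tendsto_tsum_of_dominated_convergence (𝓕 := atTop) (f := fun N n => c N n * q ^ n) (g := fun n => c' n * q ^ n)
    (bound := fun n => c' n * q ^ n) hs (fun n => (hc' n).mul_const _) (Eventually.of_forall (fun N n => by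
      rw [Real.norm_of_nonneg (mul_nonneg (h0 N n) (by positivity))]
      exact mul_le_mul_of_nonneg_right (hle N n) (by positivity)))
  have e : ∀ N, ∑' n, c N n * q ^ n = H N q := fun N => (hP N q q0 q1).tsum_eq
  simp only [e] at T
  have := tendsto_nhds_unique T (hl q q0 q1)
  rw [← this]
  exact hs.hasSum

lemma N1.prod_lim (g : ℕ → ℝ → ℝ) (h : ℝ → ℝ) (hg : ∀ i, N1 (g i))
    (hl : ∀ q, 0 < q → q < 1 → Tendsto (fun N => ∏ i ∈ Finset.range N, g i q) atTop (𝓝 (h q))) : N1 h := by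
  choose d d0 d1 dP using hg
  let c : ℕ → ℕ → ℝ := fun N => Nat.rec (fun n => if n = 0 then 1 else 0) (fun i e => cauchy e (d i)) N
  have cs : ∀ N, c (N + 1) = cauchy (c N) (d N) := fun N => rfl
  have c0 : ∀ N n, 0 ≤ c N n := by
    intro N
    induction N with
    | zero => intro n; change 0 ≤ (if n = 0 then (1:ℝ) else 0); split_ifs <;> norm_num
    | succ N ih => rw [cs]; exact cauchy_nonneg ih (d0 N)
  have cm : ∀ n, Monotone (fun N => c N n) := fun n => monotone_nat_of_le_succ (fun N => by
    rw [cs]; exact cauchy_ge (c0 N) (d0 N) (d1 N) n)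
  have cP : ∀ N, PSn (c N) (fun q => ∏ i ∈ Finset.range N, g i q) := by
    intro N
    induction N with
    | zero => exact (PSn.monomial 0).congr (fun q _ _ => by simp)
    | succ N ih =>
      rw [cs]; exact (ih.mul (c0 N) (d0 N) (dP N)).congr (fun q _ _ => Finset.prod_range_succ _ _)
  obtain ⟨c', hP, hle⟩ := mono_lim c _ h c0 cm cP hl
  refine ⟨c', fun n => (c0 0 n).trans (hle 0 n), ?_, hP⟩
  have : c 0 0 = 1 := by change (if 0 = 0 then (1:ℝ) else 0) = 1; simp
  rw [← this]; exact hle 0 0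

lemma NN.tsum (g : ℕ → ℝ → ℝ) (h : ℝ → ℝ) (hg : ∀ i, NN (g i))
    (hl : ∀ q, 0 < q → q < 1 → HasSum (fun i => g i q) (h q)) : NN h := by
  choose d d0 dP using hg
  obtain ⟨c', hP, hle⟩ := mono_lim (fun N n => ∑ i ∈ Finset.range N, d i n) (fun N q => ∑ i ∈ Finset.range N, g i q) h
    (fun N n => Finset.sum_nonneg (fun i _ => d0 i n))
    (fun n => monotone_nat_of_le_succ (fun N => by rw [Finset.sum_range_succ]; linarith [d0 N n]))
    (fun N q q0 q1 => by
      refine (hasSum_sum (fun i (_ : i ∈ Finset.range N) => dP i q q0 q1)).congr_fun ?_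
      intro n; rw [Finset.sum_mul])
    (fun q q0 q1 => (hl q q0 q1).tendsto_sum_nat)
  exact ⟨c', fun n => by simpa using hle 0 n, hP⟩

lemma N1.geom (k : ℕ) (hk : 1 ≤ k) : N1 (fun q => 1 / (1 - q ^ k)) := by
  have : NN (fun q => q ^ k / (1 - q ^ k)) := by
    apply NN.tsum (fun i q => q ^ (k * (i + 1))) _ (fun i => NN.monomial _)
    intro q q0 q1
    have := (hasSum_geometric_of_lt_one (by positivity) (pow_lt_one₀ q0.le q1 (by omega : k ≠ 0))).mul_left (q ^ k)
    rw [div_eq_mul_inv]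
    refine this.congr_fun ?_
    intro n; rw [pow_mul, pow_succ]; ring
  refine (N1.one.add this).congr (fun q q0 q1 => ?_)
  have : 1 - q ^ k ≠ 0 := by have := pow_lt_one₀ q0.le q1 (by omega : k ≠ 0); linarith
  field_simp; ring
lemma N1.factor (A B : ℕ) (hA : 1 ≤ A) (hB : 1 ≤ B) : N1 (fun q => (1 - q ^ (A + B)) / ((1 - q ^ A) * (1 - q ^ B))) := by
  refine ((N1.geom A hA).add ((NN.monomial B).mul (N1.geom B hB).nn)).congr (fun q q0 q1 => ?_)
  have : 1 - q ^ A ≠ 0 := by have := pow_lt_one₀ q0.le q1 (by omega : A ≠ 0); linarith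
  have : 1 - q ^ B ≠ 0 := by have := pow_lt_one₀ q0.le q1 (by omega : B ≠ 0); linarith
  rw [pow_add]; field_simp; ring

open Filter Topology

/-- `(q^k; q^20)_∞` -/
noncomputable def Pc (k : ℕ) (q : ℝ) : ℝ := poc (q ^ 20) (q ^ k)

lemma Pc_pos {q : ℝ} (q0 : 0 < q) (q1 : q < 1) (k : ℕ) (hk : 1 ≤ k) : 0 < Pc k q :=
  poc_pos (by positivity) (pow_lt_one₀ q0.le q1 (by norm_num)) (pow_lt_one₀ q0.le q1 (by omega))

lemma Pc_tend {q : ℝ} (q0 : 0 < q) (q1 : q < 1) (k : ℕ) : Tendsto (fun N => ∏ i ∈ Finset.range N, (1 - q ^ (k + 20 * i))) atTop (𝓝 (Pc k q)) := by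
  have := poc_tendsto (p := q ^ 20) (by positivity) (pow_lt_one₀ q0.le q1 (by norm_num)) (q ^ k)
  refine this.congr (fun N => ?_)
  unfold pocN
  refine Finset.prod_congr rfl (fun i _ => ?_)
  rw [pow_add, pow_mul]

lemma one_sub_ne {q : ℝ} (q0 : 0 < q) (q1 : q < 1) (k : ℕ) (hk : 1 ≤ k) : 1 - q ^ k ≠ 0 := by
  have := pow_lt_one₀ q0.le q1 (by omega : k ≠ 0); linarith

lemma block1 (a : ℕ) (ha : 1 ≤ a) : N1 (fun q => 1 / Pc a q) := by
  apply N1.prod_lim (fun i q => 1 / (1 - q ^ (a + 20 * i))) _ (fun i => N1.geom _ (by omega))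
  intro q q0 q1
  have := (Pc_tend q0 q1 a).inv₀ (Pc_pos q0 q1 a ha).ne'
  rw [one_div]
  refine this.congr (fun N => ?_)
  rw [← Finset.prod_inv_distrib]
  simp only [one_div]

lemma block2 (a : ℕ) (ha : 1 ≤ a) : N1 (fun q => Pc (2 * a) q / (Pc a q * Pc (a + 10) q)) := by
  apply N1.prod_lim (fun i q => 1 + q ^ (a + 10 * i)) _ (fun i => N1.one.add (NN.monomial _))
  intro q q0 q1
  have h10 : q ^ 10 < 1 := pow_lt_one₀ q0.le q1 (by norm_num)
  have T := poc_tendsto (p := q ^ 10) (by positivity) h10 (-q ^ a)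
  have e1 := poc_pm (p := q ^ 10) (by positivity) h10 (q ^ a)
  have e2 := poc_split2 (p := q ^ 10) (by positivity) h10 (q ^ a)
  rw [← pow_mul, ← pow_add] at e2
  rw [← pow_mul, ← pow_mul] at e1
  have p1 := Pc_pos q0 q1 a ha
  have p2 := Pc_pos q0 q1 (a + 10) (by omega)
  have : Pc (2 * a) q / (Pc a q * Pc (a + 10) q) = poc (q ^ 10) (-q ^ a) := by
    unfold Pc at *
    rw [div_eq_iff (by positivity), mul_comm 2 a, show (20:ℕ) = 10 * 2 by norm_num, ← e1, e2, add_comm a 10]; ring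
  rw [this]
  refine T.congr (fun N => ?_)
  unfold pocN
  refine Finset.prod_congr rfl (fun i _ => ?_)
  rw [pow_add, pow_mul]; ring

lemma block3 (a b : ℕ) (ha : 1 ≤ a) (hb : 1 ≤ b) : N1 (fun q => (1 - q ^ a) * Pc (a + b) q / (Pc a q ^ 2 * Pc b q ^ 2)) := by
  apply N1.prod_lim (fun j q => ((1 - q ^ ((a + 20 * j) + (b + 20 * j))) / ((1 - q ^ (a + 20 * j)) * (1 - q ^ (b + 20 * j))))
    * ((1 - q ^ ((a + 20 * (j + 1)) + (b + 20 * j))) / ((1 - q ^ (a + 20 * (j + 1))) * (1 - q ^ (b + 20 * j)))))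
    _ (fun i => (N1.factor _ _ (by omega) (by omega)).mul (N1.factor _ _ (by omega) (by omega)))
  intro q q0 q1
  have p1 := Pc_pos q0 q1 a ha
  have p2 := Pc_pos q0 q1 b hb
  have Ta := Pc_tend q0 q1 a
  have Ta' := (tendsto_add_atTop_iff_nat 1).2 Ta
  have Tb := Pc_tend q0 q1 b
  have Tab := (Pc_tend q0 q1 (a + b)).comp tendsto_two_mul
  have T := ((Tab.const_mul (1 - q ^ a)).div ((Ta.mul Ta').mul (Tb.mul Tb)) (by positivity))
  have e : Pc a q ^ 2 * Pc b q ^ 2 = Pc a q * Pc a q * (Pc b q * Pc b q) := by ring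
  rw [e]
  refine T.congr (fun N => ?_)
  simp only [Function.comp_apply, Pi.div_apply]
  have na : ∀ j, 1 - q ^ (a + 20 * j) ≠ 0 := fun j => one_sub_ne q0 q1 _ (by omega)
  have nb : ∀ j, 1 - q ^ (b + 20 * j) ≠ 0 := fun j => one_sub_ne q0 q1 _ (by omega)
  induction N with
  | zero =>
    have := na 0
    simp at this ⊢
    field_simp
    exact this
  | succ N ih =>
    symm
    rw [Finset.prod_range_succ _ N, ← ih, show 2 * (N + 1) = 2 * N + 1 + 1 by ring,
     Finset.prod_range_succ _ (2 * N + 1), Finset.prod_range_succ _ (2 * N), Finset.prod_range_succ _ (N + 1),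
     Finset.prod_range_succ (fun i => 1 - q ^ (b + 20 * i)) N]
    have n1 : ∏ i ∈ Finset.range N, (1 - q ^ (a + 20 * i)) ≠ 0 := Finset.prod_ne_zero_iff.2 (fun i _ => na i)
    have n2 : ∏ i ∈ Finset.range N, (1 - q ^ (b + 20 * i)) ≠ 0 := Finset.prod_ne_zero_iff.2 (fun i _ => nb i)
    have m1 := na N
    have m2 := na (N + 1)
    have m3 := nb N
    rw [Finset.prod_range_succ (fun i => 1 - q ^ (a + 20 * i)) N,
      show a + 20 * N + (b + 20 * N) = a + b + 20 * (2 * N) by ring, show a + 20 * (N + 1) + (b + 20 * N) = a + b + 20 * (2 * N + 1) by ring]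
    generalize ∏ i ∈ Finset.range N, (1 - q ^ (a + 20 * i)) = X1 at *
    generalize ∏ i ∈ Finset.range N, (1 - q ^ (b + 20 * i)) = X2 at *
    generalize 1 - q ^ (a + 20 * N) = Y1 at *
    generalize 1 - q ^ (a + 20 * (N + 1)) = Y2 at *
    generalize 1 - q ^ (b + 20 * N) = Y3 at *
    field_simp

open Filter Topology

lemma Pc_shift {q : ℝ} (q0 : 0 < q) (q1 : q < 1) (a : ℕ) : Pc a q = (1 - q ^ a) * Pc (a + 20) q := by
  refine tendsto_nhds_unique ((tendsto_add_atTop_iff_nat 1).2 (Pc_tend q0 q1 a)) ?_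
  refine ((Pc_tend q0 q1 (a + 20)).const_mul (1 - q ^ a)).congr (fun N => ?_)
  rw [Finset.prod_range_succ']
  simp only [mul_zero, add_zero]
  rw [mul_comm]
  congr 1
  refine Finset.prod_congr rfl (fun i _ => ?_)
  congr 2; ring

lemma block1' (a : ℕ) (ha : 1 ≤ a) : N1 (fun q => (1 - q ^ a) / Pc a q) := by
  refine (block1 (a + 20) (by omega)).congr (fun q q0 q1 => ?_)
  have h1 := one_sub_ne q0 q1 a ha
  have h2 := (Pc_pos q0 q1 (a + 20) (by omega)).ne'
  rw [Pc_shift q0 q1 a]; field_simp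

lemma NN.mul_sub {g h : ℝ → ℝ} (hg : NN g) (hh : N1 h) : NN (fun q => g q * h q - g q) :=
  (hg.mul hh.sub_one).congr (fun q _ _ => by ring)

noncomputable def TT0 (q : ℝ) : ℝ := q * (Pc 20 q ^ 1 * Pc 4 q ^ 2 * Pc 16 q ^ 2 * Pc 6 q ^ 2 * Pc 14 q ^ 2 * Pc 10 q ^ 2) / (Pc 1 q ^ 2 * Pc 19 q ^ 2 * Pc 2 q ^ 2 * Pc 18 q ^ 2 * Pc 3 q ^ 4 * Pc 17 q ^ 4 * Pc 5 q ^ 1 * Pc 15 q ^ 1 * Pc 7 q ^ 4 * Pc 13 q ^ 4 * Pc 8 q ^ 4 * Pc 12 q ^ 4 * Pc 9 q ^ 2 * Pc 11 q ^ 2)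
noncomputable def TT1 (q : ℝ) : ℝ := 2 * q * (Pc 20 q ^ 1 * Pc 10 q ^ 2) / (Pc 1 q ^ 2 * Pc 19 q ^ 2 * Pc 3 q ^ 3 * Pc 17 q ^ 3 * Pc 4 q ^ 1 * Pc 16 q ^ 1 * Pc 5 q ^ 3 * Pc 15 q ^ 3 * Pc 7 q ^ 3 * Pc 13 q ^ 3 * Pc 8 q ^ 1 * Pc 12 q ^ 1 * Pc 9 q ^ 2 * Pc 11 q ^ 2)
noncomputable def TT2 (q : ℝ) : ℝ := q * (Pc 20 q ^ 1 * Pc 2 q ^ 2 * Pc 18 q ^ 2 * Pc 10 q ^ 2) / (Pc 1 q ^ 4 * Pc 19 q ^ 4 * Pc 3 q ^ 2 * Pc 17 q ^ 2 * Pc 4 q ^ 2 * Pc 16 q ^ 2 * Pc 5 q ^ 1 * Pc 15 q ^ 1 * Pc 6 q ^ 2 * Pc 14 q ^ 2 * Pc 7 q ^ 2 * Pc 13 q ^ 2 * Pc 9 q ^ 4 * Pc 11 q ^ 4)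
noncomputable def TT3 (q : ℝ) : ℝ := 1 * (Pc 20 q ^ 1 * Pc 6 q ^ 1 * Pc 14 q ^ 1 * Pc 10 q ^ 2) / (Pc 1 q ^ 2 * Pc 19 q ^ 2 * Pc 2 q ^ 1 * Pc 18 q ^ 1 * Pc 3 q ^ 4 * Pc 17 q ^ 4 * Pc 5 q ^ 1 * Pc 15 q ^ 1 * Pc 7 q ^ 4 * Pc 13 q ^ 4 * Pc 8 q ^ 2 * Pc 12 q ^ 2 * Pc 9 q ^ 2 * Pc 11 q ^ 2)
noncomputable def TT4 (q : ℝ) : ℝ := 1 * (Pc 20 q ^ 1 * Pc 2 q ^ 1 * Pc 18 q ^ 1 * Pc 10 q ^ 2) / (Pc 1 q ^ 3 * Pc 19 q ^ 3 * Pc 3 q ^ 3 * Pc 17 q ^ 3 * Pc 4 q ^ 2 * Pc 16 q ^ 2 * Pc 5 q ^ 1 * Pc 15 q ^ 1 * Pc 6 q ^ 1 * Pc 14 q ^ 1 * Pc 7 q ^ 3 * Pc 13 q ^ 3 * Pc 9 q ^ 3 * Pc 11 q ^ 3)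

lemma T1_h : ∃ h, N1 h ∧ ∀ q, 0 < q → q < 1 →  TT1 q = (2 * q) / ((1 - q ^ 1)) * h q := by
  refine ⟨_, (((((((((((((((((((block2 5 (by norm_num)).pow 1).mul
    (block3 3 17 (by norm_num) (by norm_num))).mul
    (N1.geom 3 (by norm_num))).mul
    (block1' 1 (by norm_num))).mul
    (block1 1 (by norm_num))).mul
    (block1 3 (by norm_num))).mul
    (block1 4 (by norm_num))).mul
    (block1 5 (by norm_num))).mul
    ((block1 7 (by norm_num)).pow 2)).mul
    (block1 8 (by norm_num))).mul
    ((block1 9 (by norm_num)).pow 1)).mul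
    ((block1 11 (by norm_num)).pow 1)).mul
    (block1 12 (by norm_num))).mul
    ((block1 13 (by norm_num)).pow 2)).mul
    (block1 15 (by norm_num))).mul
    (block1 16 (by norm_num))).mul
    (block1 17 (by norm_num))).mul
    ((block1 19 (by norm_num)).pow 1)), fun q q0 q1 => ?_⟩
  have p1 := (Pc_pos q0 q1 1 (by norm_num)).ne'
  have p3 := (Pc_pos q0 q1 3 (by norm_num)).ne'
  have p4 := (Pc_pos q0 q1 4 (by norm_num)).ne'
  have p5 := (Pc_pos q0 q1 5 (by norm_num)).ne'
  have p7 := (Pc_pos q0 q1 7 (by norm_num)).ne'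
  have p8 := (Pc_pos q0 q1 8 (by norm_num)).ne'
  have p9 := (Pc_pos q0 q1 9 (by norm_num)).ne'
  have p10 := (Pc_pos q0 q1 10 (by norm_num)).ne'
  have p11 := (Pc_pos q0 q1 11 (by norm_num)).ne'
  have p12 := (Pc_pos q0 q1 12 (by norm_num)).ne'
  have p13 := (Pc_pos q0 q1 13 (by norm_num)).ne'
  have p15 := (Pc_pos q0 q1 15 (by norm_num)).ne'
  have p16 := (Pc_pos q0 q1 16 (by norm_num)).ne'
  have p17 := (Pc_pos q0 q1 17 (by norm_num)).ne'
  have p19 := (Pc_pos q0 q1 19 (by norm_num)).ne'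
  have p20 := (Pc_pos q0 q1 20 (by norm_num)).ne'
  have g1 := one_sub_ne q0 q1 1 (by norm_num)
  have g3 := one_sub_ne q0 q1 3 (by norm_num)
  unfold TT1
  simp only [Nat.reduceMul, Nat.reduceAdd]
  generalize Pc 1 q = P1 at *
  generalize Pc 3 q = P3 at *
  generalize Pc 4 q = P4 at *
  generalize Pc 5 q = P5 at *
  generalize Pc 7 q = P7 at *
  generalize Pc 8 q = P8 at *
  generalize Pc 9 q = P9 at *
  generalize Pc 10 q = P10 at *
  generalize Pc 11 q = P11 at *
  generalize Pc 12 q = P12 at *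
  generalize Pc 13 q = P13 at *
  generalize Pc 15 q = P15 at *
  generalize Pc 16 q = P16 at *
  generalize Pc 17 q = P17 at *
  generalize Pc 19 q = P19 at *
  generalize Pc 20 q = P20 at *
  generalize 1 - q ^ 1 = Q1 at *
  generalize 1 - q ^ 3 = Q3 at *
  field_simp

lemma T3_h : ∃ h, N1 h ∧ ∀ q, 0 < q → q < 1 →  TT3 q = 1 / ((1 - q ^ 1)) * h q := by
  refine ⟨_, ((((((((((((((((((block2 3 (by norm_num)).mul
    (block2 7 (by norm_num))).mul
    (block2 5 (by norm_num))).mul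
    (block3 3 7 (by norm_num) (by norm_num))).mul
    (N1.geom 3 (by norm_num))).mul
    (block3 8 12 (by norm_num) (by norm_num))).mul
    (N1.geom 8 (by norm_num))).mul
    (block1' 1 (by norm_num))).mul
    (block1 1 (by norm_num))).mul
    (block1 2 (by norm_num))).mul
    (block1 3 (by norm_num))).mul
    (block1 7 (by norm_num))).mul
    ((block1 9 (by norm_num)).pow 1)).mul
    ((block1 11 (by norm_num)).pow 1)).mul
    ((block1 13 (by norm_num)).pow 2)).mul
    ((block1 17 (by norm_num)).pow 2)).mul
    (block1 18 (by norm_num))).mul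
    ((block1 19 (by norm_num)).pow 1)), fun q q0 q1 => ?_⟩
  have p1 := (Pc_pos q0 q1 1 (by norm_num)).ne'
  have p2 := (Pc_pos q0 q1 2 (by norm_num)).ne'
  have p3 := (Pc_pos q0 q1 3 (by norm_num)).ne'
  have p5 := (Pc_pos q0 q1 5 (by norm_num)).ne'
  have p6 := (Pc_pos q0 q1 6 (by norm_num)).ne'
  have p7 := (Pc_pos q0 q1 7 (by norm_num)).ne'
  have p8 := (Pc_pos q0 q1 8 (by norm_num)).ne'
  have p9 := (Pc_pos q0 q1 9 (by norm_num)).ne'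
  have p10 := (Pc_pos q0 q1 10 (by norm_num)).ne'
  have p11 := (Pc_pos q0 q1 11 (by norm_num)).ne'
  have p12 := (Pc_pos q0 q1 12 (by norm_num)).ne'
  have p13 := (Pc_pos q0 q1 13 (by norm_num)).ne'
  have p14 := (Pc_pos q0 q1 14 (by norm_num)).ne'
  have p15 := (Pc_pos q0 q1 15 (by norm_num)).ne'
  have p17 := (Pc_pos q0 q1 17 (by norm_num)).ne'
  have p18 := (Pc_pos q0 q1 18 (by norm_num)).ne'
  have p19 := (Pc_pos q0 q1 19 (by norm_num)).ne'
  have p20 := (Pc_pos q0 q1 20 (by norm_num)).ne'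
  have g1 := one_sub_ne q0 q1 1 (by norm_num)
  have g3 := one_sub_ne q0 q1 3 (by norm_num)
  have g8 := one_sub_ne q0 q1 8 (by norm_num)
  unfold TT3
  simp only [Nat.reduceMul, Nat.reduceAdd]
  generalize Pc 1 q = P1 at *
  generalize Pc 2 q = P2 at *
  generalize Pc 3 q = P3 at *
  generalize Pc 5 q = P5 at *
  generalize Pc 6 q = P6 at *
  generalize Pc 7 q = P7 at *
  generalize Pc 8 q = P8 at *
  generalize Pc 9 q = P9 at *
  generalize Pc 10 q = P10 at *
  generalize Pc 11 q = P11 at *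
  generalize Pc 12 q = P12 at *
  generalize Pc 13 q = P13 at *
  generalize Pc 14 q = P14 at *
  generalize Pc 15 q = P15 at *
  generalize Pc 17 q = P17 at *
  generalize Pc 18 q = P18 at *
  generalize Pc 19 q = P19 at *
  generalize Pc 20 q = P20 at *
  generalize 1 - q ^ 1 = Q1 at *
  generalize 1 - q ^ 3 = Q3 at *
  generalize 1 - q ^ 8 = Q8 at *
  field_simp

lemma T4_h : ∃ h, N1 h ∧ ∀ q, 0 < q → q < 1 →  TT4 q = 1 / ((1 - q ^ 1)) * h q := by
  refine ⟨_, ((((((((((((((((((block2 1 (by norm_num)).mul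
    (block2 9 (by norm_num))).mul
    (block2 5 (by norm_num))).mul
    (block3 3 7 (by norm_num) (by norm_num))).mul
    (N1.geom 3 (by norm_num))).mul
    (block3 4 16 (by norm_num) (by norm_num))).mul
    (N1.geom 4 (by norm_num))).mul
    (block1' 1 (by norm_num))).mul
    (block1 1 (by norm_num))).mul
    (block1 3 (by norm_num))).mul
    (block1 6 (by norm_num))).mul
    (block1 7 (by norm_num))).mul
    ((block1 9 (by norm_num)).pow 1)).mul
    ((block1 11 (by norm_num)).pow 1)).mul
    ((block1 13 (by norm_num)).pow 2)).mul
    (block1 14 (by norm_num))).mul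
    ((block1 17 (by norm_num)).pow 2)).mul
    ((block1 19 (by norm_num)).pow 1)), fun q q0 q1 => ?_⟩
  have p1 := (Pc_pos q0 q1 1 (by norm_num)).ne'
  have p2 := (Pc_pos q0 q1 2 (by norm_num)).ne'
  have p3 := (Pc_pos q0 q1 3 (by norm_num)).ne'
  have p4 := (Pc_pos q0 q1 4 (by norm_num)).ne'
  have p5 := (Pc_pos q0 q1 5 (by norm_num)).ne'
  have p6 := (Pc_pos q0 q1 6 (by norm_num)).ne'
  have p7 := (Pc_pos q0 q1 7 (by norm_num)).ne'
  have p9 := (Pc_pos q0 q1 9 (by norm_num)).ne'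
  have p10 := (Pc_pos q0 q1 10 (by norm_num)).ne'
  have p11 := (Pc_pos q0 q1 11 (by norm_num)).ne'
  have p13 := (Pc_pos q0 q1 13 (by norm_num)).ne'
  have p14 := (Pc_pos q0 q1 14 (by norm_num)).ne'
  have p15 := (Pc_pos q0 q1 15 (by norm_num)).ne'
  have p16 := (Pc_pos q0 q1 16 (by norm_num)).ne'
  have p17 := (Pc_pos q0 q1 17 (by norm_num)).ne'
  have p18 := (Pc_pos q0 q1 18 (by norm_num)).ne'
  have p19 := (Pc_pos q0 q1 19 (by norm_num)).ne'
  have p20 := (Pc_pos q0 q1 20 (by norm_num)).ne'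
  have g1 := one_sub_ne q0 q1 1 (by norm_num)
  have g3 := one_sub_ne q0 q1 3 (by norm_num)
  have g4 := one_sub_ne q0 q1 4 (by norm_num)
  unfold TT4
  simp only [Nat.reduceMul, Nat.reduceAdd]
  generalize Pc 1 q = P1 at *
  generalize Pc 2 q = P2 at *
  generalize Pc 3 q = P3 at *
  generalize Pc 4 q = P4 at *
  generalize Pc 5 q = P5 at *
  generalize Pc 6 q = P6 at *
  generalize Pc 7 q = P7 at *
  generalize Pc 9 q = P9 at *
  generalize Pc 10 q = P10 at *
  generalize Pc 11 q = P11 at *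
  generalize Pc 13 q = P13 at *
  generalize Pc 14 q = P14 at *
  generalize Pc 15 q = P15 at *
  generalize Pc 16 q = P16 at *
  generalize Pc 17 q = P17 at *
  generalize Pc 18 q = P18 at *
  generalize Pc 19 q = P19 at *
  generalize Pc 20 q = P20 at *
  generalize 1 - q ^ 1 = Q1 at *
  generalize 1 - q ^ 3 = Q3 at *
  generalize 1 - q ^ 4 = Q4 at *
  field_simp

lemma T03_h : ∃ h, N1 h ∧ ∀ q, 0 < q → q < 1 → Pc 20 q * Pc 3 q * Pc 17 q * TT0 q = q / ((1 - q ^ 1) * (1 - q ^ 3)) * h q := by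
  refine ⟨_, (((((((((((((((block2 2 (by norm_num)).pow 1).mul
    ((block2 8 (by norm_num)).pow 1)).mul
    ((block2 3 (by norm_num)).pow 1)).mul
    ((block2 7 (by norm_num)).pow 1)).mul
    (block2 5 (by norm_num))).mul
    (block3 1 9 (by norm_num) (by norm_num))).mul
    (block3 8 12 (by norm_num) (by norm_num))).mul
    (N1.geom 8 (by norm_num))).mul
    (block3 7 13 (by norm_num) (by norm_num))).mul
    (N1.geom 7 (by norm_num))).mul
    (block1' 3 (by norm_num))).mul
    ((block1 11 (by norm_num)).pow 1)).mul
    (block1 17 (by norm_num))).mul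
    ((block1 19 (by norm_num)).pow 1)), fun q q0 q1 => ?_⟩
  have p1 := (Pc_pos q0 q1 1 (by norm_num)).ne'
  have p2 := (Pc_pos q0 q1 2 (by norm_num)).ne'
  have p3 := (Pc_pos q0 q1 3 (by norm_num)).ne'
  have p4 := (Pc_pos q0 q1 4 (by norm_num)).ne'
  have p5 := (Pc_pos q0 q1 5 (by norm_num)).ne'
  have p6 := (Pc_pos q0 q1 6 (by norm_num)).ne'
  have p7 := (Pc_pos q0 q1 7 (by norm_num)).ne'
  have p8 := (Pc_pos q0 q1 8 (by norm_num)).ne'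
  have p9 := (Pc_pos q0 q1 9 (by norm_num)).ne'
  have p10 := (Pc_pos q0 q1 10 (by norm_num)).ne'
  have p11 := (Pc_pos q0 q1 11 (by norm_num)).ne'
  have p12 := (Pc_pos q0 q1 12 (by norm_num)).ne'
  have p13 := (Pc_pos q0 q1 13 (by norm_num)).ne'
  have p14 := (Pc_pos q0 q1 14 (by norm_num)).ne'
  have p15 := (Pc_pos q0 q1 15 (by norm_num)).ne'
  have p16 := (Pc_pos q0 q1 16 (by norm_num)).ne'
  have p17 := (Pc_pos q0 q1 17 (by norm_num)).ne'
  have p18 := (Pc_pos q0 q1 18 (by norm_num)).ne'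
  have p19 := (Pc_pos q0 q1 19 (by norm_num)).ne'
  have p20 := (Pc_pos q0 q1 20 (by norm_num)).ne'
  have g1 := one_sub_ne q0 q1 1 (by norm_num)
  have g3 := one_sub_ne q0 q1 3 (by norm_num)
  have g7 := one_sub_ne q0 q1 7 (by norm_num)
  have g8 := one_sub_ne q0 q1 8 (by norm_num)
  unfold TT0
  simp only [Nat.reduceMul, Nat.reduceAdd]
  generalize Pc 1 q = P1 at *
  generalize Pc 2 q = P2 at *
  generalize Pc 3 q = P3 at *
  generalize Pc 4 q = P4 at *
  generalize Pc 5 q = P5 at *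
  generalize Pc 6 q = P6 at *
  generalize Pc 7 q = P7 at *
  generalize Pc 8 q = P8 at *
  generalize Pc 9 q = P9 at *
  generalize Pc 10 q = P10 at *
  generalize Pc 11 q = P11 at *
  generalize Pc 12 q = P12 at *
  generalize Pc 13 q = P13 at *
  generalize Pc 14 q = P14 at *
  generalize Pc 15 q = P15 at *
  generalize Pc 16 q = P16 at *
  generalize Pc 17 q = P17 at *
  generalize Pc 18 q = P18 at *
  generalize Pc 19 q = P19 at *
  generalize Pc 20 q = P20 at *
  generalize 1 - q ^ 1 = Q1 at *
  generalize 1 - q ^ 3 = Q3 at *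
  generalize 1 - q ^ 7 = Q7 at *
  generalize 1 - q ^ 8 = Q8 at *
  field_simp

lemma T07_h : ∃ h, N1 h ∧ ∀ q, 0 < q → q < 1 → Pc 20 q * Pc 7 q * Pc 13 q * TT0 q = q / ((1 - q ^ 1) * (1 - q ^ 3)) * h q := by
  refine ⟨_, ((((((((((((((block2 2 (by norm_num)).pow 1).mul
    ((block2 8 (by norm_num)).pow 1)).mul
    ((block2 3 (by norm_num)).pow 1)).mul
    ((block2 7 (by norm_num)).pow 1)).mul
    (block2 5 (by norm_num))).mul
    (block3 1 9 (by norm_num) (by norm_num))).mul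
    (block3 8 12 (by norm_num) (by norm_num))).mul
    (N1.geom 8 (by norm_num))).mul
    (block3 3 17 (by norm_num) (by norm_num))).mul
    (block1 7 (by norm_num))).mul
    ((block1 11 (by norm_num)).pow 1)).mul
    (block1 13 (by norm_num))).mul
    ((block1 19 (by norm_num)).pow 1)), fun q q0 q1 => ?_⟩
  have p1 := (Pc_pos q0 q1 1 (by norm_num)).ne'
  have p2 := (Pc_pos q0 q1 2 (by norm_num)).ne'
  have p3 := (Pc_pos q0 q1 3 (by norm_num)).ne'
  have p4 := (Pc_pos q0 q1 4 (by norm_num)).ne'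
  have p5 := (Pc_pos q0 q1 5 (by norm_num)).ne'
  have p6 := (Pc_pos q0 q1 6 (by norm_num)).ne'
  have p7 := (Pc_pos q0 q1 7 (by norm_num)).ne'
  have p8 := (Pc_pos q0 q1 8 (by norm_num)).ne'
  have p9 := (Pc_pos q0 q1 9 (by norm_num)).ne'
  have p10 := (Pc_pos q0 q1 10 (by norm_num)).ne'
  have p11 := (Pc_pos q0 q1 11 (by norm_num)).ne'
  have p12 := (Pc_pos q0 q1 12 (by norm_num)).ne'
  have p13 := (Pc_pos q0 q1 13 (by norm_num)).ne'
  have p14 := (Pc_pos q0 q1 14 (by norm_num)).ne'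
  have p15 := (Pc_pos q0 q1 15 (by norm_num)).ne'
  have p16 := (Pc_pos q0 q1 16 (by norm_num)).ne'
  have p17 := (Pc_pos q0 q1 17 (by norm_num)).ne'
  have p18 := (Pc_pos q0 q1 18 (by norm_num)).ne'
  have p19 := (Pc_pos q0 q1 19 (by norm_num)).ne'
  have p20 := (Pc_pos q0 q1 20 (by norm_num)).ne'
  have g1 := one_sub_ne q0 q1 1 (by norm_num)
  have g3 := one_sub_ne q0 q1 3 (by norm_num)
  have g8 := one_sub_ne q0 q1 8 (by norm_num)
  unfold TT0
  simp only [Nat.reduceMul, Nat.reduceAdd]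
  generalize Pc 1 q = P1 at *
  generalize Pc 2 q = P2 at *
  generalize Pc 3 q = P3 at *
  generalize Pc 4 q = P4 at *
  generalize Pc 5 q = P5 at *
  generalize Pc 6 q = P6 at *
  generalize Pc 7 q = P7 at *
  generalize Pc 8 q = P8 at *
  generalize Pc 9 q = P9 at *
  generalize Pc 10 q = P10 at *
  generalize Pc 11 q = P11 at *
  generalize Pc 12 q = P12 at *
  generalize Pc 13 q = P13 at *
  generalize Pc 14 q = P14 at *
  generalize Pc 15 q = P15 at *
  generalize Pc 16 q = P16 at *
  generalize Pc 17 q = P17 at *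
  generalize Pc 18 q = P18 at *
  generalize Pc 19 q = P19 at *
  generalize Pc 20 q = P20 at *
  generalize 1 - q ^ 1 = Q1 at *
  generalize 1 - q ^ 3 = Q3 at *
  generalize 1 - q ^ 8 = Q8 at *
  field_simp

lemma T23_h : ∃ h, N1 h ∧ ∀ q, 0 < q → q < 1 → Pc 20 q * Pc 3 q * Pc 17 q * TT2 q = q / ((1 - q ^ 1) * (1 - q ^ 3)) * h q := by
  refine ⟨_, (((((((((((((((block2 1 (by norm_num)).pow 1).mul
    ((block2 9 (by norm_num)).pow 1)).mul
    (block2 5 (by norm_num))).mul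
    (block3 1 9 (by norm_num) (by norm_num))).mul
    (block3 4 16 (by norm_num) (by norm_num))).mul
    (N1.geom 4 (by norm_num))).mul
    (block3 7 13 (by norm_num) (by norm_num))).mul
    (N1.geom 7 (by norm_num))).mul
    (block1' 3 (by norm_num))).mul
    ((block1 6 (by norm_num)).pow 1)).mul
    ((block1 11 (by norm_num)).pow 1)).mul
    ((block1 14 (by norm_num)).pow 1)).mul
    (block1 17 (by norm_num))).mul
    ((block1 19 (by norm_num)).pow 1)), fun q q0 q1 => ?_⟩
  have p1 := (Pc_pos q0 q1 1 (by norm_num)).ne'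
  have p2 := (Pc_pos q0 q1 2 (by norm_num)).ne'
  have p3 := (Pc_pos q0 q1 3 (by norm_num)).ne'
  have p4 := (Pc_pos q0 q1 4 (by norm_num)).ne'
  have p5 := (Pc_pos q0 q1 5 (by norm_num)).ne'
  have p6 := (Pc_pos q0 q1 6 (by norm_num)).ne'
  have p7 := (Pc_pos q0 q1 7 (by norm_num)).ne'
  have p9 := (Pc_pos q0 q1 9 (by norm_num)).ne'
  have p10 := (Pc_pos q0 q1 10 (by norm_num)).ne'
  have p11 := (Pc_pos q0 q1 11 (by norm_num)).ne'
  have p13 := (Pc_pos q0 q1 13 (by norm_num)).ne'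
  have p14 := (Pc_pos q0 q1 14 (by norm_num)).ne'
  have p15 := (Pc_pos q0 q1 15 (by norm_num)).ne'
  have p16 := (Pc_pos q0 q1 16 (by norm_num)).ne'
  have p17 := (Pc_pos q0 q1 17 (by norm_num)).ne'
  have p18 := (Pc_pos q0 q1 18 (by norm_num)).ne'
  have p19 := (Pc_pos q0 q1 19 (by norm_num)).ne'
  have p20 := (Pc_pos q0 q1 20 (by norm_num)).ne'
  have g1 := one_sub_ne q0 q1 1 (by norm_num)
  have g3 := one_sub_ne q0 q1 3 (by norm_num)
  have g4 := one_sub_ne q0 q1 4 (by norm_num)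
  have g7 := one_sub_ne q0 q1 7 (by norm_num)
  unfold TT2
  simp only [Nat.reduceMul, Nat.reduceAdd]
  generalize Pc 1 q = P1 at *
  generalize Pc 2 q = P2 at *
  generalize Pc 3 q = P3 at *
  generalize Pc 4 q = P4 at *
  generalize Pc 5 q = P5 at *
  generalize Pc 6 q = P6 at *
  generalize Pc 7 q = P7 at *
  generalize Pc 9 q = P9 at *
  generalize Pc 10 q = P10 at *
  generalize Pc 11 q = P11 at *
  generalize Pc 13 q = P13 at *
  generalize Pc 14 q = P14 at *
  generalize Pc 15 q = P15 at *
  generalize Pc 16 q = P16 at *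
  generalize Pc 17 q = P17 at *
  generalize Pc 18 q = P18 at *
  generalize Pc 19 q = P19 at *
  generalize Pc 20 q = P20 at *
  generalize 1 - q ^ 1 = Q1 at *
  generalize 1 - q ^ 3 = Q3 at *
  generalize 1 - q ^ 4 = Q4 at *
  generalize 1 - q ^ 7 = Q7 at *
  field_simp

lemma T27_h : ∃ h, N1 h ∧ ∀ q, 0 < q → q < 1 → Pc 20 q * Pc 7 q * Pc 13 q * TT2 q = q / ((1 - q ^ 1) * (1 - q ^ 3)) * h q := by
  refine ⟨_, ((((((((((((((block2 1 (by norm_num)).pow 1).mul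
    ((block2 9 (by norm_num)).pow 1)).mul
    (block2 5 (by norm_num))).mul
    (block3 1 9 (by norm_num) (by norm_num))).mul
    (block3 4 16 (by norm_num) (by norm_num))).mul
    (N1.geom 4 (by norm_num))).mul
    (block3 3 17 (by norm_num) (by norm_num))).mul
    ((block1 6 (by norm_num)).pow 1)).mul
    (block1 7 (by norm_num))).mul
    ((block1 11 (by norm_num)).pow 1)).mul
    (block1 13 (by norm_num))).mul
    ((block1 14 (by norm_num)).pow 1)).mul
    ((block1 19 (by norm_num)).pow 1)), fun q q0 q1 => ?_⟩
  have p1 := (Pc_pos q0 q1 1 (by norm_num)).ne'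
  have p2 := (Pc_pos q0 q1 2 (by norm_num)).ne'
  have p3 := (Pc_pos q0 q1 3 (by norm_num)).ne'
  have p4 := (Pc_pos q0 q1 4 (by norm_num)).ne'
  have p5 := (Pc_pos q0 q1 5 (by norm_num)).ne'
  have p6 := (Pc_pos q0 q1 6 (by norm_num)).ne'
  have p7 := (Pc_pos q0 q1 7 (by norm_num)).ne'
  have p9 := (Pc_pos q0 q1 9 (by norm_num)).ne'
  have p10 := (Pc_pos q0 q1 10 (by norm_num)).ne'
  have p11 := (Pc_pos q0 q1 11 (by norm_num)).ne'
  have p13 := (Pc_pos q0 q1 13 (by norm_num)).ne'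
  have p14 := (Pc_pos q0 q1 14 (by norm_num)).ne'
  have p15 := (Pc_pos q0 q1 15 (by norm_num)).ne'
  have p16 := (Pc_pos q0 q1 16 (by norm_num)).ne'
  have p17 := (Pc_pos q0 q1 17 (by norm_num)).ne'
  have p18 := (Pc_pos q0 q1 18 (by norm_num)).ne'
  have p19 := (Pc_pos q0 q1 19 (by norm_num)).ne'
  have p20 := (Pc_pos q0 q1 20 (by norm_num)).ne'
  have g1 := one_sub_ne q0 q1 1 (by norm_num)
  have g3 := one_sub_ne q0 q1 3 (by norm_num)
  have g4 := one_sub_ne q0 q1 4 (by norm_num)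
  unfold TT2
  simp only [Nat.reduceMul, Nat.reduceAdd]
  generalize Pc 1 q = P1 at *
  generalize Pc 2 q = P2 at *
  generalize Pc 3 q = P3 at *
  generalize Pc 4 q = P4 at *
  generalize Pc 5 q = P5 at *
  generalize Pc 6 q = P6 at *
  generalize Pc 7 q = P7 at *
  generalize Pc 9 q = P9 at *
  generalize Pc 10 q = P10 at *
  generalize Pc 11 q = P11 at *
  generalize Pc 13 q = P13 at *
  generalize Pc 14 q = P14 at *
  generalize Pc 15 q = P15 at *
  generalize Pc 16 q = P16 at *
  generalize Pc 17 q = P17 at *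
  generalize Pc 18 q = P18 at *
  generalize Pc 19 q = P19 at *
  generalize Pc 20 q = P20 at *
  generalize 1 - q ^ 1 = Q1 at *
  generalize 1 - q ^ 3 = Q3 at *
  generalize 1 - q ^ 4 = Q4 at *
  field_simp

open Filter Topology

lemma NN.geo (m : ℕ) : NN (fun q => (1 - q ^ m) / (1 - q)) := by
  induction m with
  | zero => exact ((NN.monomial 0).smul le_rfl).congr (fun q _ _ => by simp)
  | succ m ih =>
    refine (ih.add (NN.monomial m)).congr (fun q q0 q1 => ?_)
    have : 1 - q ≠ 0 := by linarith
    field_simp; ring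

lemma NN.g1 : NN (fun q => 1 / (1 - q)) := (N1.geom 1 le_rfl).nn.congr (fun q _ _ => by rw [pow_one])

lemma NN.cmp (k E M : ℕ) (h : k ≤ E) (hM : 1 ≤ M) : NN (fun q => q ^ k / (1 - q) - q ^ E / (1 - q ^ M)) := by
  obtain ⟨e, rfl⟩ := Nat.exists_eq_add_of_le h
  obtain ⟨m, rfl⟩ := Nat.exists_eq_add_of_le hM
  refine (((NN.monomial k).mul (NN.geo e)).add ((NN.monomial (k + e + 1)).mul ((NN.geo m).mul (N1.geom (1 + m) (by omega)).nn))).congr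
    (fun q q0 q1 => ?_)
  have h1 : 1 - q ≠ 0 := by linarith
  have h2 := one_sub_ne q0 q1 (1 + m) (by omega)
  field_simp
  ring

lemma NN.poly (m : ℕ) : NN (fun q => ∑ i ∈ Finset.range m, ((i : ℝ) + 1) * q ^ i) := by
  induction m with
  | zero => exact ((NN.monomial 0).smul le_rfl).congr (fun q _ _ => by simp)
  | succ m ih =>
    refine (ih.add ((NN.monomial m).smul (by positivity : (0:ℝ) ≤ m + 1))).congr (fun q q0 q1 => ?_)
    rw [Finset.sum_range_succ]

lemma NN.lin : NN (fun q => q / (10 * (1 - q) ^ 2) - 2 * (q ^ 20 / ((1 - q) * (1 - q ^ 20)))) := by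
  refine (((NN.poly 19).mul ((NN.monomial 1).mul (N1.geom 20 (by norm_num)).nn)).smul (by norm_num : (0:ℝ) ≤ 1 / 10)).congr (fun q q0 q1 => ?_)
  have h1 : 1 - q ≠ 0 := by linarith
  have h2 := one_sub_ne q0 q1 20 (by norm_num)
  have e : (∑ i ∈ Finset.range 19, ((i : ℝ) + 1) * q ^ i) * (1 - q) ^ 2 = 1 - 20 * q ^ 19 + 19 * q ^ 20 := by
    simp only [Finset.sum_range_succ, Finset.sum_range_zero]; push_cast; ring
  have e' : (∑ i ∈ Finset.range 19, ((i : ℝ) + 1) * q ^ i) = (1 - 20 * q ^ 19 + 19 * q ^ 20) / (1 - q) ^ 2 := by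
    rw [eq_div_iff (by positivity), e]
  rw [e']
  field_simp
  ring

lemma NN.lin3 : NN (fun q => q / ((1 - q ^ 1) * (1 - q ^ 3)) - q / (3 * (1 - q) ^ 2)) := by
  refine ((((NN.monomial 1).smul (by norm_num : (0:ℝ) ≤ 2/3)).add ((NN.monomial 2).smul (by norm_num : (0:ℝ) ≤ 1/3))).mul
    (N1.geom 3 (by norm_num)).nn).congr (fun q q0 q1 => ?_)
  have h1 : 1 - q ≠ 0 := by linarith
  have h2 := one_sub_ne q0 q1 3 (by norm_num)
  rw [pow_one]
  field_simp
  ring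

/-- half-theta pieces -/
lemma half_piece {X h : ℝ → ℝ} (hh : N1 h) (e : ∀ q, 0 < q → q < 1 → X q = q / ((1 - q ^ 1) * (1 - q ^ 3)) * h q) :
    NN (fun q => X q / 2 - q / (6 * (1 - q) ^ 2)) := by
  have g : NN (fun q => q / ((1 - q ^ 1) * (1 - q ^ 3))) := by
    refine ((NN.monomial 1).mul ((N1.geom 1 (by norm_num)).nn.mul (N1.geom 3 (by norm_num)).nn)).congr (fun q q0 q1 => ?_)
    have h1 := one_sub_ne q0 q1 1 (by norm_num)
    have h2 := one_sub_ne q0 q1 3 (by norm_num)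
    rw [pow_one] at *
    field_simp
  refine (((g.mul_sub hh).add NN.lin3).smul (by norm_num : (0:ℝ) ≤ 1/2)).congr (fun q q0 q1 => ?_)
  rw [e q q0 q1]
  have h1 : 1 - q ≠ 0 := by linarith
  field_simp
  ring

lemma AA_hasSum {q : ℝ} (q0 : 0 < q) (q1 : q < 1) (a b : ℕ) :
    HasSum (fun n : ℤ => jt (q ^ 20) (q ^ b) n / (1 - q ^ (20 * n - 20 + a + b))) (AA (q ^ 20) (q ^ a) (q ^ b)) := by
  have h := (summable_div_one_sub q0 q1 (jt_summable (p := q ^ 20) (z := q ^ b) (by positivity) (pow_lt_one₀ q0.le q1 (by norm_num)) (by positivity))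
    (fun n => 20 * n - 20 + a + b)).hasSum
  unfold AA
  have e : ∀ n : ℤ, (q ^ 20) ^ (n - 1) * (q ^ a * q ^ b) = q ^ (20 * n - 20 + a + b) := by
    intro n
    rw [← zpow_natCast, ← zpow_natCast, ← zpow_natCast, ← zpow_mul, ← zpow_add₀ q0.ne', ← zpow_add₀ q0.ne']
    congr 1; push_cast; ring
  simp only [e]
  exact h

lemma mock_NN (a b s : ℕ) (E E' M M' : ℕ → ℕ) (hM : ∀ n, M n = 20 * n + a + b) (hM' : ∀ n, M' n + a + b = 20 * n + 20) (hab : 1 ≤ a + b) (hab' : a + b ≤ 19)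
    (hE : ∀ n, E n + s = 10 * (n * (n + 1)) + b * (n + 1)) (hE' : ∀ n, E' n + s + b * n = 10 * (n * (n + 1)) + M' n)
    (hE20 : ∀ n, 1 ≤ n → 20 * n ≤ E n) (hE20' : ∀ n, 1 ≤ n → 20 * n ≤ E' n) :
    NN (fun q => - ((q ^ s)⁻¹ * AA (q ^ 20) (q ^ a) (q ^ b)) + q / (10 * (1 - q) ^ 2)) := by
  have key : NN (fun q => - ((q ^ s)⁻¹ * AA (q ^ 20) (q ^ a) (q ^ b)) + 2 * (q ^ 20 / ((1 - q) * (1 - q ^ 20)))) := by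
    apply NN.tsum (fun n q => (-1) ^ n * (q ^ E n / (1 - q ^ M n) + q ^ E' n / (1 - q ^ M' n)) + 2 * (if n = 0 then 0 else q ^ (20 * n) / (1 - q)))
    · intro n
      have m1 : 1 ≤ M n := by rw [hM]; omega
      have m2 : 1 ≤ M' n := by have := hM' n; omega
      have n1 : NN (fun q => q ^ E n / (1 - q ^ M n)) := ((NN.monomial _).mul (N1.geom _ m1).nn).congr (fun q _ _ => by ring)
      have n2 : NN (fun q => q ^ E' n / (1 - q ^ M' n)) := ((NN.monomial _).mul (N1.geom _ m2).nn).congr (fun q _ _ => by ring)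
      have n3 : NN (fun q => 2 * (if n = 0 then 0 else q ^ (20 * n) / (1 - q))) := by
        refine NN.smul ?_ (by norm_num)
        by_cases h : n = 0
        · exact ((NN.monomial 0).smul le_rfl).congr (fun q _ _ => by simp [h])
        · exact ((NN.monomial (20 * n)).mul NN.g1).congr (fun q _ _ => by simp [h]; ring)
      rcases Nat.even_or_odd n with h | h
      · exact ((n1.add n2).add n3).congr (fun q _ _ => by rw [h.neg_one_pow, one_mul])
      · have n0 : n ≠ 0 := by rintro rfl; simp at h
        refine ((NN.cmp (20 * n) (E n) (M n) (hE20 n (by omega)) m1).add (NN.cmp (20 * n) (E' n) (M' n) (hE20' n (by omega)) m2)).congr (fun q _ _ => ?_)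
        rw [h.neg_one_pow, if_neg n0]; ring
    · intro q q0 q1
      refine HasSum.add ?_ (HasSum.mul_left 2 ?_)
      · have A := (((Equiv.addRight (1:ℤ)).hasSum_iff.2 (AA_hasSum q0 q1 a b)).nat_add_neg_add_one.mul_left ((q ^ s)⁻¹)).neg
        refine A.congr_fun ?_
        intro n
        simp only [Function.comp_apply, Equiv.coe_addRight]
        unfold jt
        have t1 : tri ((n:ℤ) + 1) * 2 = n * (n + 1) := by have := two_tri ((n:ℤ) + 1); linarith
        have t2 : tri (-((n:ℤ) + 1) + 1) * 2 = n * (n + 1) := by have := two_tri (-((n:ℤ) + 1) + 1); linarith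
        have z1 : (q ^ 20) ^ tri ((n:ℤ) + 1) * (q ^ b) ^ ((n:ℤ) + 1) = q ^ s * q ^ E n := by
          rw [← pow_add, ← zpow_natCast, ← zpow_natCast, ← zpow_natCast, ← zpow_mul, ← zpow_mul, ← zpow_add₀ q0.ne']
          congr 1
          have := hE n
          have : (E n : ℤ) + s = 10 * (n * (n + 1)) + b * (n + 1) := by exact_mod_cast this
          push_cast; linarith
        have z2 : (q ^ 20) ^ tri (-((n:ℤ) + 1) + 1) * (q ^ b) ^ (-((n:ℤ) + 1) + 1) = q ^ s * q ^ E' n * (q ^ M' n)⁻¹ := by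
          rw [← pow_add, ← zpow_natCast, ← zpow_natCast, ← zpow_natCast, ← zpow_natCast, ← zpow_mul, ← zpow_mul, ← zpow_add₀ q0.ne', ← zpow_neg, ← zpow_add₀ q0.ne']
          congr 1
          have := hE' n
          have : (E' n : ℤ) + s + b * n = 10 * (n * (n + 1)) + M' n := by exact_mod_cast this
          push_cast; linarith
        have z3 : q ^ (20 * ((n:ℤ) + 1) - 20 + a + b) = q ^ M n := by
          rw [← zpow_natCast, hM]; congr 1; push_cast; ring
        have z4 : q ^ (20 * (-((n:ℤ) + 1) + 1) - 20 + a + b) = (q ^ M' n)⁻¹ := by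
          rw [← zpow_natCast, ← zpow_neg]; congr 1
          have := hM' n
          have : (M' n : ℤ) + a + b = 20 * n + 20 := by exact_mod_cast this
          linarith
        have s1 : (-1 : ℝ) ^ ((n:ℤ) + 1) = - (-1) ^ n := by
          rw [← Nat.cast_succ, zpow_natCast, pow_succ]; ring
        have s2 : (-1 : ℝ) ^ (-((n:ℤ) + 1) + 1) = (-1) ^ n := by
          rw [show -((n:ℤ) + 1) + 1 = -n by ring, zpow_neg, zpow_natCast]; rcases Nat.even_or_odd n with h | h <;> simp [h.neg_one_pow]
        rw [mul_assoc, mul_assoc, z1, z2, z3, z4, s1, s2]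
        have d1 := one_sub_ne q0 q1 (M n) (by rw [hM]; omega)
        have d2 := one_sub_ne q0 q1 (M' n) (by have := hM' n; omega)
        have d3 : 1 - (q ^ M' n)⁻¹ = - (1 - q ^ M' n) * (q ^ M' n)⁻¹ := by field_simp; ring
        rw [d3]
        have := q0.ne'
        field_simp
        ring
      · rw [← hasSum_nat_add_iff' 1]
        simp
        have := (hasSum_geometric_of_lt_one (by positivity) (pow_lt_one₀ q0.le q1 (by norm_num : 20 ≠ 0))).mul_left (q ^ 20 / (1 - q))
        have e : q ^ 20 / ((1 - q) * (1 - q ^ 20)) = q ^ 20 / (1 - q) * (1 - q ^ 20)⁻¹ := by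
          have h1 : 1 - q ≠ 0 := by linarith
          have h2 := one_sub_ne q0 q1 20 (by norm_num)
          field_simp
        rw [e]
        refine this.congr_fun ?_
        intro n
        rw [mul_add, pow_add, pow_mul]; ring
  exact (key.add NN.lin).congr (fun q _ _ => by ring)

open Filter Topology

lemma mu_piece {T X Y u m g : ℝ → ℝ} (hu : N1 u) (hg : NN g) (hY : NN Y) (hX : ∀ q, 0 < q → q < 1 → X q * u q = T q)
   (hm : ∀ q, 0 < q → q < 1 → X q / 2 - m q = Y q + g q) :
    NN (fun q => T q / 2 - m q * u q - g q) := by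
  refine ((hY.mul hu.nn).add (hg.mul_sub hu)).congr (fun q q0 q1 => ?_)
  have := hm q q0 q1
  rw [← hX q q0 q1]
  linear_combination u q * this

lemma NN.g15 : NN (fun q => q / (15 * (1 - q) ^ 2)) := by
  refine (((NN.monomial 1).mul (NN.g1.mul NN.g1)).smul (by norm_num : (0:ℝ) ≤ 1/15)).congr (fun q q0 q1 => ?_)
  have h1 : 1 - q ≠ 0 := by linarith
  field_simp

noncomputable def u3 (q : ℝ) : ℝ := 1 / (Pc 20 q * Pc 3 q * Pc 17 q)
noncomputable def u7 (q : ℝ) : ℝ := 1 / (Pc 20 q * Pc 7 q * Pc 13 q)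

lemma u3_N1 : N1 u3 := (((block1 20 (by norm_num)).mul (block1 3 (by norm_num))).mul (block1 17 (by norm_num))).congr
  (fun q q0 q1 => by unfold u3; field_simp)
lemma u7_N1 : N1 u7 := (((block1 20 (by norm_num)).mul (block1 7 (by norm_num))).mul (block1 13 (by norm_num))).congr
  (fun q q0 q1 => by unfold u7; field_simp)

lemma p03 : NN (fun q => TT0 q / 2 - ((q ^ 0)⁻¹ * AA (q ^ 20) (q ^ 9) (q ^ 3)) * u3 q - q / (15 * (1 - q) ^ 2)) := by
  obtain ⟨h, hh, he⟩ := T03_h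
  have m := mock_NN 9 3 0 (fun n => 10 * (n * (n + 1)) + 3 * (n + 1)) (fun n => 10 * (n * n) + 27 * n + 8) (fun n => 20 * n + 12) (fun n => 20 * n + 8)
    (fun n => by ring) (fun n => by ring) (by norm_num) (by norm_num) (fun n => by ring) (fun n => by ring)
    (fun n hn => by nlinarith) (fun n hn => by nlinarith)
  refine mu_piece (X := fun q => Pc 20 q * Pc 3 q * Pc 17 q * TT0 q) u3_N1 NN.g15 ((half_piece (X := fun q => Pc 20 q * Pc 3 q * Pc 17 q * TT0 q) hh he).add m) (fun q q0 q1 => ?_) (fun q q0 q1 => ?_)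
  · have p1 := (Pc_pos q0 q1 20 (by norm_num)).ne'
    have p2 := (Pc_pos q0 q1 3 (by norm_num)).ne'
    have p3 := (Pc_pos q0 q1 17 (by norm_num)).ne'
    unfold u3; field_simp
  · have h1 : 1 - q ≠ 0 := by linarith
    field_simp
    ring

lemma p07 : NN (fun q => TT0 q / 2 - ((q ^ 2)⁻¹ * AA (q ^ 20) (q ^ 1) (q ^ 7)) * u7 q - q / (15 * (1 - q) ^ 2)) := by
  obtain ⟨h, hh, he⟩ := T07_h
  have m := mock_NN 1 7 2 (fun n => 10 * (n * (n + 1)) + 7 * n + 5) (fun n => 10 * (n * n) + 23 * n + 10) (fun n => 20 * n + 8) (fun n => 20 * n + 12)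
    (fun n => by ring) (fun n => by ring) (by norm_num) (by norm_num) (fun n => by ring) (fun n => by ring)
    (fun n hn => by nlinarith) (fun n hn => by nlinarith)
  refine mu_piece (X := fun q => Pc 20 q * Pc 7 q * Pc 13 q * TT0 q) u7_N1 NN.g15 ((half_piece (X := fun q => Pc 20 q * Pc 7 q * Pc 13 q * TT0 q) hh he).add m) (fun q q0 q1 => ?_) (fun q q0 q1 => ?_)
  · have p1 := (Pc_pos q0 q1 20 (by norm_num)).ne'
    have p2 := (Pc_pos q0 q1 7 (by norm_num)).ne'
    have p3 := (Pc_pos q0 q1 13 (by norm_num)).ne'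
    unfold u7; field_simp
  · have h1 : 1 - q ≠ 0 := by linarith
    field_simp
    ring

lemma p23 : NN (fun q => TT2 q / 2 - ((q ^ 1)⁻¹ * AA (q ^ 20) (q ^ 5) (q ^ 3)) * u3 q - q / (15 * (1 - q) ^ 2)) := by
  obtain ⟨h, hh, he⟩ := T23_h
  have m := mock_NN 5 3 1 (fun n => 10 * (n * (n + 1)) + 3 * n + 2) (fun n => 10 * (n * n) + 27 * n + 11) (fun n => 20 * n + 8) (fun n => 20 * n + 12)
    (fun n => by ring) (fun n => by ring) (by norm_num) (by norm_num) (fun n => by ring) (fun n => by ring)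
    (fun n hn => by nlinarith) (fun n hn => by nlinarith)
  refine mu_piece (X := fun q => Pc 20 q * Pc 3 q * Pc 17 q * TT2 q) u3_N1 NN.g15 ((half_piece (X := fun q => Pc 20 q * Pc 3 q * Pc 17 q * TT2 q) hh he).add m) (fun q q0 q1 => ?_) (fun q q0 q1 => ?_)
  · have p1 := (Pc_pos q0 q1 20 (by norm_num)).ne'
    have p2 := (Pc_pos q0 q1 3 (by norm_num)).ne'
    have p3 := (Pc_pos q0 q1 17 (by norm_num)).ne'
    unfold u3; field_simp
  · have h1 : 1 - q ≠ 0 := by linarith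
    field_simp
    ring

lemma p27 : NN (fun q => TT2 q / 2 - ((q ^ 1)⁻¹ * AA (q ^ 20) (q ^ 5) (q ^ 7)) * u7 q - q / (15 * (1 - q) ^ 2)) := by
  obtain ⟨h, hh, he⟩ := T27_h
  have m := mock_NN 5 7 1 (fun n => 10 * (n * (n + 1)) + 7 * n + 6) (fun n => 10 * (n * n) + 23 * n + 7) (fun n => 20 * n + 12) (fun n => 20 * n + 8)
    (fun n => by ring) (fun n => by ring) (by norm_num) (by norm_num) (fun n => by ring) (fun n => by ring)
    (fun n hn => by nlinarith) (fun n hn => by nlinarith)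
  refine mu_piece (X := fun q => Pc 20 q * Pc 7 q * Pc 13 q * TT2 q) u7_N1 NN.g15 ((half_piece (X := fun q => Pc 20 q * Pc 7 q * Pc 13 q * TT2 q) hh he).add m) (fun q q0 q1 => ?_) (fun q q0 q1 => ?_)
  · have p1 := (Pc_pos q0 q1 20 (by norm_num)).ne'
    have p2 := (Pc_pos q0 q1 7 (by norm_num)).ne'
    have p3 := (Pc_pos q0 q1 13 (by norm_num)).ne'
    unfold u7; field_simp
  · have h1 : 1 - q ≠ 0 := by linarith
    field_simp
    ring

noncomputable def F0 (q : ℝ) : ℝ := TT0 q - ((q ^ 0)⁻¹ * AA (q ^ 20) (q ^ 9) (q ^ 3)) * u3 q - ((q ^ 2)⁻¹ * AA (q ^ 20) (q ^ 1) (q ^ 7)) * u7 q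
noncomputable def F2 (q : ℝ) : ℝ := TT2 q - ((q ^ 1)⁻¹ * AA (q ^ 20) (q ^ 5) (q ^ 3)) * u3 q - ((q ^ 1)⁻¹ * AA (q ^ 20) (q ^ 5) (q ^ 7)) * u7 q

lemma F0_NN : NN (fun q => F0 q - 2 * (q / (15 * (1 - q) ^ 2))) := (p03.add p07).congr (fun q _ _ => by unfold F0; ring)
lemma F2_NN : NN (fun q => F2 q - 2 * (q / (15 * (1 - q) ^ 2))) := (p23.add p27).congr (fun q _ _ => by unfold F2; ring)
lemma F1_NN : NN (fun q => TT1 q - 2 * (q / (1 - q))) := by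
  obtain ⟨h, hh, he⟩ := T1_h
  have g : NN (fun q => 2 * (q / (1 - q))) := (((NN.monomial 1).mul NN.g1).smul (by norm_num : (0:ℝ) ≤ 2)).congr (fun q _ _ => by ring)
  exact (g.mul_sub hh).congr (fun q q0 q1 => by rw [he q q0 q1]; ring)
lemma F3_NN : NN (fun q => TT3 q - 1 / (1 - q)) := by
  obtain ⟨h, hh, he⟩ := T3_h
  exact (NN.g1.mul_sub hh).congr (fun q q0 q1 => by rw [he q q0 q1]; ring)
lemma F4_NN : NN (fun q => TT4 q - 1 / (1 - q)) := by
  obtain ⟨h, hh, he⟩ := T4_h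
  exact (NN.g1.mul_sub hh).congr (fun q q0 q1 => by rw [he q q0 q1]; ring)

lemma j_Pc {q : ℝ} (q0 : 0 < q) (q1 : q < 1) (k : ℕ) (hk : k ≤ 20) : j (q ^ 20) (q ^ (k:ℤ)) = Pc 20 q * Pc k q * Pc (20 - k) q := by
  rw [jtp (by positivity) (pow_lt_one₀ q0.le q1 (by norm_num)) (by positivity), zpow_natCast]
  unfold Pc
  congr 2
  rw [pow_sub₀ _ q0.ne' hk]; rfl

lemma sk_Pc {r : ℝ} (hr : 0 < r) (hr1 : r < 1) (k e : ℕ) (hk : k ≤ 20) (he : (10 - (k:ℤ)) ^ 2 = e) :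
    sk r k = r ^ e * (Pc 20 (r ^ 40) * Pc k (r ^ 40) * Pc (20 - k) (r ^ 40)) := by
  unfold sk
  rw [j_Pc (by positivity) (pow_lt_one₀ hr.le hr1 (by norm_num)) k hk, he, zpow_natCast]

lemma alt0_eq {r : ℝ} (hr : 0 < r) (hr1 : r < 1) : r * alt0 (sk r 1) (sk r 2) (sk r 3) (sk r 4) (sk r 5) (sk r 6) (sk r 7) (sk r 8) (sk r 9) (sk r 10) (GJ r) = TT0 (r ^ 40) := by
  have q0 : 0 < r ^ 40 := by positivity
  have q1 : r ^ 40 < 1 := pow_lt_one₀ hr.le hr1 (by norm_num)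
  have hG : GJ r = r ^ 100 * Pc 20 (r ^ 40) ^ 3 := by
    unfold GJ; rw [J3_eq (by positivity) (pow_lt_one₀ q0.le q1 (by norm_num))]; rfl
  have s1 := sk_Pc hr hr1 1 81 (by norm_num) (by norm_num)
  have s2 := sk_Pc hr hr1 2 64 (by norm_num) (by norm_num)
  have s3 := sk_Pc hr hr1 3 49 (by norm_num) (by norm_num)
  have s4 := sk_Pc hr hr1 4 36 (by norm_num) (by norm_num)
  have s5 := sk_Pc hr hr1 5 25 (by norm_num) (by norm_num)
  have s6 := sk_Pc hr hr1 6 16 (by norm_num) (by norm_num)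
  have s7 := sk_Pc hr hr1 7 9 (by norm_num) (by norm_num)
  have s8 := sk_Pc hr hr1 8 4 (by norm_num) (by norm_num)
  have s9 := sk_Pc hr hr1 9 1 (by norm_num) (by norm_num)
  have s10 := sk_Pc hr hr1 10 0 (by norm_num) (by norm_num)
  simp only [Nat.reduceSub, Nat.cast_ofNat, Nat.cast_one] at s1 s2 s3 s4 s5 s6 s7 s8 s9 s10
  rw [hG, s1, s2, s3, s4, s5, s6, s7, s8, s9, s10]
  have p1 := (Pc_pos q0 q1 1 (by norm_num)).ne'
  have p2 := (Pc_pos q0 q1 2 (by norm_num)).ne'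
  have p3 := (Pc_pos q0 q1 3 (by norm_num)).ne'
  have p4 := (Pc_pos q0 q1 4 (by norm_num)).ne'
  have p5 := (Pc_pos q0 q1 5 (by norm_num)).ne'
  have p6 := (Pc_pos q0 q1 6 (by norm_num)).ne'
  have p7 := (Pc_pos q0 q1 7 (by norm_num)).ne'
  have p8 := (Pc_pos q0 q1 8 (by norm_num)).ne'
  have p9 := (Pc_pos q0 q1 9 (by norm_num)).ne'
  have p10 := (Pc_pos q0 q1 10 (by norm_num)).ne'
  have p11 := (Pc_pos q0 q1 11 (by norm_num)).ne'
  have p12 := (Pc_pos q0 q1 12 (by norm_num)).ne'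
  have p13 := (Pc_pos q0 q1 13 (by norm_num)).ne'
  have p14 := (Pc_pos q0 q1 14 (by norm_num)).ne'
  have p15 := (Pc_pos q0 q1 15 (by norm_num)).ne'
  have p16 := (Pc_pos q0 q1 16 (by norm_num)).ne'
  have p17 := (Pc_pos q0 q1 17 (by norm_num)).ne'
  have p18 := (Pc_pos q0 q1 18 (by norm_num)).ne'
  have p19 := (Pc_pos q0 q1 19 (by norm_num)).ne'
  have p20 := (Pc_pos q0 q1 20 (by norm_num)).ne'
  unfold alt0 TT0
  generalize Pc 1 (r ^ 40) = P1 at *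
  generalize Pc 2 (r ^ 40) = P2 at *
  generalize Pc 3 (r ^ 40) = P3 at *
  generalize Pc 4 (r ^ 40) = P4 at *
  generalize Pc 5 (r ^ 40) = P5 at *
  generalize Pc 6 (r ^ 40) = P6 at *
  generalize Pc 7 (r ^ 40) = P7 at *
  generalize Pc 8 (r ^ 40) = P8 at *
  generalize Pc 9 (r ^ 40) = P9 at *
  generalize Pc 10 (r ^ 40) = P10 at *
  generalize Pc 11 (r ^ 40) = P11 at *
  generalize Pc 12 (r ^ 40) = P12 at *
  generalize Pc 13 (r ^ 40) = P13 at *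
  generalize Pc 14 (r ^ 40) = P14 at *
  generalize Pc 15 (r ^ 40) = P15 at *
  generalize Pc 16 (r ^ 40) = P16 at *
  generalize Pc 17 (r ^ 40) = P17 at *
  generalize Pc 18 (r ^ 40) = P18 at *
  generalize Pc 19 (r ^ 40) = P19 at *
  generalize Pc 20 (r ^ 40) = P20 at *
  clear s1 s2 s3 s4 s5 s6 s7 s8 s9 s10 hG q0 q1
  have := hr.ne'
  field_simp

lemma alF1_eq {r : ℝ} (hr : 0 < r) (hr1 : r < 1) : r * alF1 (sk r 1) (sk r 2) (sk r 3) (sk r 4) (sk r 5) (sk r 6) (sk r 7) (sk r 8) (sk r 9) (sk r 10) (GJ r) = r ^ 8 * TT1 (r ^ 40) := by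
  have q0 : 0 < r ^ 40 := by positivity
  have q1 : r ^ 40 < 1 := pow_lt_one₀ hr.le hr1 (by norm_num)
  have hG : GJ r = r ^ 100 * Pc 20 (r ^ 40) ^ 3 := by
    unfold GJ; rw [J3_eq (by positivity) (pow_lt_one₀ q0.le q1 (by norm_num))]; rfl
  have s1 := sk_Pc hr hr1 1 81 (by norm_num) (by norm_num)
  have s2 := sk_Pc hr hr1 2 64 (by norm_num) (by norm_num)
  have s3 := sk_Pc hr hr1 3 49 (by norm_num) (by norm_num)
  have s4 := sk_Pc hr hr1 4 36 (by norm_num) (by norm_num)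
  have s5 := sk_Pc hr hr1 5 25 (by norm_num) (by norm_num)
  have s6 := sk_Pc hr hr1 6 16 (by norm_num) (by norm_num)
  have s7 := sk_Pc hr hr1 7 9 (by norm_num) (by norm_num)
  have s8 := sk_Pc hr hr1 8 4 (by norm_num) (by norm_num)
  have s9 := sk_Pc hr hr1 9 1 (by norm_num) (by norm_num)
  have s10 := sk_Pc hr hr1 10 0 (by norm_num) (by norm_num)
  simp only [Nat.reduceSub, Nat.cast_ofNat, Nat.cast_one] at s1 s2 s3 s4 s5 s6 s7 s8 s9 s10
  rw [hG, s1, s2, s3, s4, s5, s6, s7, s8, s9, s10]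
  have p1 := (Pc_pos q0 q1 1 (by norm_num)).ne'
  have p2 := (Pc_pos q0 q1 2 (by norm_num)).ne'
  have p3 := (Pc_pos q0 q1 3 (by norm_num)).ne'
  have p4 := (Pc_pos q0 q1 4 (by norm_num)).ne'
  have p5 := (Pc_pos q0 q1 5 (by norm_num)).ne'
  have p6 := (Pc_pos q0 q1 6 (by norm_num)).ne'
  have p7 := (Pc_pos q0 q1 7 (by norm_num)).ne'
  have p8 := (Pc_pos q0 q1 8 (by norm_num)).ne'
  have p9 := (Pc_pos q0 q1 9 (by norm_num)).ne'
  have p10 := (Pc_pos q0 q1 10 (by norm_num)).ne'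
  have p11 := (Pc_pos q0 q1 11 (by norm_num)).ne'
  have p12 := (Pc_pos q0 q1 12 (by norm_num)).ne'
  have p13 := (Pc_pos q0 q1 13 (by norm_num)).ne'
  have p14 := (Pc_pos q0 q1 14 (by norm_num)).ne'
  have p15 := (Pc_pos q0 q1 15 (by norm_num)).ne'
  have p16 := (Pc_pos q0 q1 16 (by norm_num)).ne'
  have p17 := (Pc_pos q0 q1 17 (by norm_num)).ne'
  have p18 := (Pc_pos q0 q1 18 (by norm_num)).ne'
  have p19 := (Pc_pos q0 q1 19 (by norm_num)).ne'
  have p20 := (Pc_pos q0 q1 20 (by norm_num)).ne'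
  unfold alF1 TT1
  generalize Pc 1 (r ^ 40) = P1 at *
  generalize Pc 2 (r ^ 40) = P2 at *
  generalize Pc 3 (r ^ 40) = P3 at *
  generalize Pc 4 (r ^ 40) = P4 at *
  generalize Pc 5 (r ^ 40) = P5 at *
  generalize Pc 6 (r ^ 40) = P6 at *
  generalize Pc 7 (r ^ 40) = P7 at *
  generalize Pc 8 (r ^ 40) = P8 at *
  generalize Pc 9 (r ^ 40) = P9 at *
  generalize Pc 10 (r ^ 40) = P10 at *
  generalize Pc 11 (r ^ 40) = P11 at *
  generalize Pc 12 (r ^ 40) = P12 at *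
  generalize Pc 13 (r ^ 40) = P13 at *
  generalize Pc 14 (r ^ 40) = P14 at *
  generalize Pc 15 (r ^ 40) = P15 at *
  generalize Pc 16 (r ^ 40) = P16 at *
  generalize Pc 17 (r ^ 40) = P17 at *
  generalize Pc 18 (r ^ 40) = P18 at *
  generalize Pc 19 (r ^ 40) = P19 at *
  generalize Pc 20 (r ^ 40) = P20 at *
  clear s1 s2 s3 s4 s5 s6 s7 s8 s9 s10 hG q0 q1
  have := hr.ne'
  field_simp

lemma alt2_eq {r : ℝ} (hr : 0 < r) (hr1 : r < 1) : r * alt2 (sk r 1) (sk r 2) (sk r 3) (sk r 4) (sk r 5) (sk r 6) (sk r 7) (sk r 8) (sk r 9) (sk r 10) (GJ r) = (r ^ 8) ^ 2 * TT2 (r ^ 40) := by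
  have q0 : 0 < r ^ 40 := by positivity
  have q1 : r ^ 40 < 1 := pow_lt_one₀ hr.le hr1 (by norm_num)
  have hG : GJ r = r ^ 100 * Pc 20 (r ^ 40) ^ 3 := by
    unfold GJ; rw [J3_eq (by positivity) (pow_lt_one₀ q0.le q1 (by norm_num))]; rfl
  have s1 := sk_Pc hr hr1 1 81 (by norm_num) (by norm_num)
  have s2 := sk_Pc hr hr1 2 64 (by norm_num) (by norm_num)
  have s3 := sk_Pc hr hr1 3 49 (by norm_num) (by norm_num)
  have s4 := sk_Pc hr hr1 4 36 (by norm_num) (by norm_num)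
  have s5 := sk_Pc hr hr1 5 25 (by norm_num) (by norm_num)
  have s6 := sk_Pc hr hr1 6 16 (by norm_num) (by norm_num)
  have s7 := sk_Pc hr hr1 7 9 (by norm_num) (by norm_num)
  have s8 := sk_Pc hr hr1 8 4 (by norm_num) (by norm_num)
  have s9 := sk_Pc hr hr1 9 1 (by norm_num) (by norm_num)
  have s10 := sk_Pc hr hr1 10 0 (by norm_num) (by norm_num)
  simp only [Nat.reduceSub, Nat.cast_ofNat, Nat.cast_one] at s1 s2 s3 s4 s5 s6 s7 s8 s9 s10
  rw [hG, s1, s2, s3, s4, s5, s6, s7, s8, s9, s10]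
  have p1 := (Pc_pos q0 q1 1 (by norm_num)).ne'
  have p2 := (Pc_pos q0 q1 2 (by norm_num)).ne'
  have p3 := (Pc_pos q0 q1 3 (by norm_num)).ne'
  have p4 := (Pc_pos q0 q1 4 (by norm_num)).ne'
  have p5 := (Pc_pos q0 q1 5 (by norm_num)).ne'
  have p6 := (Pc_pos q0 q1 6 (by norm_num)).ne'
  have p7 := (Pc_pos q0 q1 7 (by norm_num)).ne'
  have p8 := (Pc_pos q0 q1 8 (by norm_num)).ne'
  have p9 := (Pc_pos q0 q1 9 (by norm_num)).ne'
  have p10 := (Pc_pos q0 q1 10 (by norm_num)).ne'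
  have p11 := (Pc_pos q0 q1 11 (by norm_num)).ne'
  have p12 := (Pc_pos q0 q1 12 (by norm_num)).ne'
  have p13 := (Pc_pos q0 q1 13 (by norm_num)).ne'
  have p14 := (Pc_pos q0 q1 14 (by norm_num)).ne'
  have p15 := (Pc_pos q0 q1 15 (by norm_num)).ne'
  have p16 := (Pc_pos q0 q1 16 (by norm_num)).ne'
  have p17 := (Pc_pos q0 q1 17 (by norm_num)).ne'
  have p18 := (Pc_pos q0 q1 18 (by norm_num)).ne'
  have p19 := (Pc_pos q0 q1 19 (by norm_num)).ne'
  have p20 := (Pc_pos q0 q1 20 (by norm_num)).ne'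
  unfold alt2 TT2
  generalize Pc 1 (r ^ 40) = P1 at *
  generalize Pc 2 (r ^ 40) = P2 at *
  generalize Pc 3 (r ^ 40) = P3 at *
  generalize Pc 4 (r ^ 40) = P4 at *
  generalize Pc 5 (r ^ 40) = P5 at *
  generalize Pc 6 (r ^ 40) = P6 at *
  generalize Pc 7 (r ^ 40) = P7 at *
  generalize Pc 8 (r ^ 40) = P8 at *
  generalize Pc 9 (r ^ 40) = P9 at *
  generalize Pc 10 (r ^ 40) = P10 at *
  generalize Pc 11 (r ^ 40) = P11 at *
  generalize Pc 12 (r ^ 40) = P12 at *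
  generalize Pc 13 (r ^ 40) = P13 at *
  generalize Pc 14 (r ^ 40) = P14 at *
  generalize Pc 15 (r ^ 40) = P15 at *
  generalize Pc 16 (r ^ 40) = P16 at *
  generalize Pc 17 (r ^ 40) = P17 at *
  generalize Pc 18 (r ^ 40) = P18 at *
  generalize Pc 19 (r ^ 40) = P19 at *
  generalize Pc 20 (r ^ 40) = P20 at *
  clear s1 s2 s3 s4 s5 s6 s7 s8 s9 s10 hG q0 q1
  have := hr.ne'
  field_simp

lemma alF3_eq {r : ℝ} (hr : 0 < r) (hr1 : r < 1) : r * alF3 (sk r 1) (sk r 2) (sk r 3) (sk r 4) (sk r 5) (sk r 6) (sk r 7) (sk r 8) (sk r 9) (sk r 10) (GJ r) = (r ^ 8) ^ 3 * TT3 (r ^ 40) := by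
  have q0 : 0 < r ^ 40 := by positivity
  have q1 : r ^ 40 < 1 := pow_lt_one₀ hr.le hr1 (by norm_num)
  have hG : GJ r = r ^ 100 * Pc 20 (r ^ 40) ^ 3 := by
    unfold GJ; rw [J3_eq (by positivity) (pow_lt_one₀ q0.le q1 (by norm_num))]; rfl
  have s1 := sk_Pc hr hr1 1 81 (by norm_num) (by norm_num)
  have s2 := sk_Pc hr hr1 2 64 (by norm_num) (by norm_num)
  have s3 := sk_Pc hr hr1 3 49 (by norm_num) (by norm_num)
  have s4 := sk_Pc hr hr1 4 36 (by norm_num) (by norm_num)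
  have s5 := sk_Pc hr hr1 5 25 (by norm_num) (by norm_num)
  have s6 := sk_Pc hr hr1 6 16 (by norm_num) (by norm_num)
  have s7 := sk_Pc hr hr1 7 9 (by norm_num) (by norm_num)
  have s8 := sk_Pc hr hr1 8 4 (by norm_num) (by norm_num)
  have s9 := sk_Pc hr hr1 9 1 (by norm_num) (by norm_num)
  have s10 := sk_Pc hr hr1 10 0 (by norm_num) (by norm_num)
  simp only [Nat.reduceSub, Nat.cast_ofNat, Nat.cast_one] at s1 s2 s3 s4 s5 s6 s7 s8 s9 s10
  rw [hG, s1, s2, s3, s4, s5, s6, s7, s8, s9, s10]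
  have p1 := (Pc_pos q0 q1 1 (by norm_num)).ne'
  have p2 := (Pc_pos q0 q1 2 (by norm_num)).ne'
  have p3 := (Pc_pos q0 q1 3 (by norm_num)).ne'
  have p4 := (Pc_pos q0 q1 4 (by norm_num)).ne'
  have p5 := (Pc_pos q0 q1 5 (by norm_num)).ne'
  have p6 := (Pc_pos q0 q1 6 (by norm_num)).ne'
  have p7 := (Pc_pos q0 q1 7 (by norm_num)).ne'
  have p8 := (Pc_pos q0 q1 8 (by norm_num)).ne'
  have p9 := (Pc_pos q0 q1 9 (by norm_num)).ne'
  have p10 := (Pc_pos q0 q1 10 (by norm_num)).ne'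
  have p11 := (Pc_pos q0 q1 11 (by norm_num)).ne'
  have p12 := (Pc_pos q0 q1 12 (by norm_num)).ne'
  have p13 := (Pc_pos q0 q1 13 (by norm_num)).ne'
  have p14 := (Pc_pos q0 q1 14 (by norm_num)).ne'
  have p15 := (Pc_pos q0 q1 15 (by norm_num)).ne'
  have p16 := (Pc_pos q0 q1 16 (by norm_num)).ne'
  have p17 := (Pc_pos q0 q1 17 (by norm_num)).ne'
  have p18 := (Pc_pos q0 q1 18 (by norm_num)).ne'
  have p19 := (Pc_pos q0 q1 19 (by norm_num)).ne'
  have p20 := (Pc_pos q0 q1 20 (by norm_num)).ne'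
  unfold alF3 TT3
  generalize Pc 1 (r ^ 40) = P1 at *
  generalize Pc 2 (r ^ 40) = P2 at *
  generalize Pc 3 (r ^ 40) = P3 at *
  generalize Pc 4 (r ^ 40) = P4 at *
  generalize Pc 5 (r ^ 40) = P5 at *
  generalize Pc 6 (r ^ 40) = P6 at *
  generalize Pc 7 (r ^ 40) = P7 at *
  generalize Pc 8 (r ^ 40) = P8 at *
  generalize Pc 9 (r ^ 40) = P9 at *
  generalize Pc 10 (r ^ 40) = P10 at *
  generalize Pc 11 (r ^ 40) = P11 at *
  generalize Pc 12 (r ^ 40) = P12 at *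
  generalize Pc 13 (r ^ 40) = P13 at *
  generalize Pc 14 (r ^ 40) = P14 at *
  generalize Pc 15 (r ^ 40) = P15 at *
  generalize Pc 16 (r ^ 40) = P16 at *
  generalize Pc 17 (r ^ 40) = P17 at *
  generalize Pc 18 (r ^ 40) = P18 at *
  generalize Pc 19 (r ^ 40) = P19 at *
  generalize Pc 20 (r ^ 40) = P20 at *
  clear s1 s2 s3 s4 s5 s6 s7 s8 s9 s10 hG q0 q1
  have := hr.ne'
  field_simp

lemma alF4_eq {r : ℝ} (hr : 0 < r) (hr1 : r < 1) : r * alF4 (sk r 1) (sk r 2) (sk r 3) (sk r 4) (sk r 5) (sk r 6) (sk r 7) (sk r 8) (sk r 9) (sk r 10) (GJ r) = (r ^ 8) ^ 4 * TT4 (r ^ 40) := by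
  have q0 : 0 < r ^ 40 := by positivity
  have q1 : r ^ 40 < 1 := pow_lt_one₀ hr.le hr1 (by norm_num)
  have hG : GJ r = r ^ 100 * Pc 20 (r ^ 40) ^ 3 := by
    unfold GJ; rw [J3_eq (by positivity) (pow_lt_one₀ q0.le q1 (by norm_num))]; rfl
  have s1 := sk_Pc hr hr1 1 81 (by norm_num) (by norm_num)
  have s2 := sk_Pc hr hr1 2 64 (by norm_num) (by norm_num)
  have s3 := sk_Pc hr hr1 3 49 (by norm_num) (by norm_num)
  have s4 := sk_Pc hr hr1 4 36 (by norm_num) (by norm_num)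
  have s5 := sk_Pc hr hr1 5 25 (by norm_num) (by norm_num)
  have s6 := sk_Pc hr hr1 6 16 (by norm_num) (by norm_num)
  have s7 := sk_Pc hr hr1 7 9 (by norm_num) (by norm_num)
  have s8 := sk_Pc hr hr1 8 4 (by norm_num) (by norm_num)
  have s9 := sk_Pc hr hr1 9 1 (by norm_num) (by norm_num)
  have s10 := sk_Pc hr hr1 10 0 (by norm_num) (by norm_num)
  simp only [Nat.reduceSub, Nat.cast_ofNat, Nat.cast_one] at s1 s2 s3 s4 s5 s6 s7 s8 s9 s10
  rw [hG, s1, s2, s3, s4, s5, s6, s7, s8, s9, s10]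
  have p1 := (Pc_pos q0 q1 1 (by norm_num)).ne'
  have p2 := (Pc_pos q0 q1 2 (by norm_num)).ne'
  have p3 := (Pc_pos q0 q1 3 (by norm_num)).ne'
  have p4 := (Pc_pos q0 q1 4 (by norm_num)).ne'
  have p5 := (Pc_pos q0 q1 5 (by norm_num)).ne'
  have p6 := (Pc_pos q0 q1 6 (by norm_num)).ne'
  have p7 := (Pc_pos q0 q1 7 (by norm_num)).ne'
  have p8 := (Pc_pos q0 q1 8 (by norm_num)).ne'
  have p9 := (Pc_pos q0 q1 9 (by norm_num)).ne'
  have p10 := (Pc_pos q0 q1 10 (by norm_num)).ne'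
  have p11 := (Pc_pos q0 q1 11 (by norm_num)).ne'
  have p12 := (Pc_pos q0 q1 12 (by norm_num)).ne'
  have p13 := (Pc_pos q0 q1 13 (by norm_num)).ne'
  have p14 := (Pc_pos q0 q1 14 (by norm_num)).ne'
  have p15 := (Pc_pos q0 q1 15 (by norm_num)).ne'
  have p16 := (Pc_pos q0 q1 16 (by norm_num)).ne'
  have p17 := (Pc_pos q0 q1 17 (by norm_num)).ne'
  have p18 := (Pc_pos q0 q1 18 (by norm_num)).ne'
  have p19 := (Pc_pos q0 q1 19 (by norm_num)).ne'
  have p20 := (Pc_pos q0 q1 20 (by norm_num)).ne'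
  unfold alF4 TT4
  generalize Pc 1 (r ^ 40) = P1 at *
  generalize Pc 2 (r ^ 40) = P2 at *
  generalize Pc 3 (r ^ 40) = P3 at *
  generalize Pc 4 (r ^ 40) = P4 at *
  generalize Pc 5 (r ^ 40) = P5 at *
  generalize Pc 6 (r ^ 40) = P6 at *
  generalize Pc 7 (r ^ 40) = P7 at *
  generalize Pc 8 (r ^ 40) = P8 at *
  generalize Pc 9 (r ^ 40) = P9 at *
  generalize Pc 10 (r ^ 40) = P10 at *
  generalize Pc 11 (r ^ 40) = P11 at *
  generalize Pc 12 (r ^ 40) = P12 at *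
  generalize Pc 13 (r ^ 40) = P13 at *
  generalize Pc 14 (r ^ 40) = P14 at *
  generalize Pc 15 (r ^ 40) = P15 at *
  generalize Pc 16 (r ^ 40) = P16 at *
  generalize Pc 17 (r ^ 40) = P17 at *
  generalize Pc 18 (r ^ 40) = P18 at *
  generalize Pc 19 (r ^ 40) = P19 at *
  generalize Pc 20 (r ^ 40) = P20 at *
  clear s1 s2 s3 s4 s5 s6 s7 s8 s9 s10 hG q0 q1
  have := hr.ne'
  field_simp

open Filter Topology

lemma coef_unique (e : ℕ → ℝ) (h : ∀ Q : ℝ, 0 < Q → Q < 1 / 2 → HasSum (fun n => e n * Q ^ n) 0) : ∀ n, e n = 0 := by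
  intro n
  induction n using Nat.strong_induction_on with
  | _ n ih =>
  have hz : ∀ Q : ℝ, 0 < Q → Q < 1 / 2 → HasSum (fun k => e (k + n) * Q ^ k) 0 := by
    intro Q q0 q1
    have h1 := h Q q0 q1
    rw [← hasSum_nat_add_iff' n] at h1
    have z : ∑ i ∈ Finset.range n, e i * Q ^ i = 0 :=
      Finset.sum_eq_zero (fun i hi => by rw [ih i (Finset.mem_range.1 hi), zero_mul])
    rw [z, sub_zero] at h1
    have h2 := h1.mul_left ((Q ^ n)⁻¹)
    rw [mul_zero] at h2
    refine h2.congr_fun ?_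
    intro k; rw [pow_add]; field_simp
  have hs : ∀ Q : ℝ, 0 < Q → Q < 1 / 2 → HasSum (fun k => e (k + 1 + n) * Q ^ k) (- e n / Q) := by
    intro Q q0 q1
    have h1 := hz Q q0 q1
    rw [← hasSum_nat_add_iff' 1] at h1
    have h2 := h1.mul_left (Q⁻¹)
    simp only [Finset.range_one, Finset.sum_singleton, pow_zero, mul_one, zero_add, zero_sub] at h2
    rw [neg_div, div_eq_inv_mul, ← mul_neg]
    refine h2.congr_fun ?_
    intro k; rw [pow_succ]; field_simp
  have ab : Summable (fun k => ‖e (k + 1 + n) * (1/4 : ℝ) ^ k‖) := (hs (1/4) (by norm_num) (by norm_num)).summable.norm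
  set C := ∑' k, ‖e (k + 1 + n) * (1/4 : ℝ) ^ k‖ with hC
  have bd : ∀ Q : ℝ, 0 < Q → Q ≤ 1 / 4 → |e n| ≤ C * Q := by
    intro Q q0 q1
    have h1 := hs Q q0 (by linarith)
    have : ‖- e n / Q‖ ≤ C := by
      rw [← h1.tsum_eq]
      refine tsum_of_norm_bounded ab.hasSum (fun k => ?_)
      rw [norm_mul, norm_mul]
      refine mul_le_mul_of_nonneg_left ?_ (norm_nonneg _)
      rw [Real.norm_of_nonneg (by positivity), Real.norm_of_nonneg (by positivity)]
      exact pow_le_pow_left₀ q0.le q1 k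
    rw [norm_div, norm_neg, Real.norm_of_nonneg q0.le, div_le_iff₀ q0] at this
    exact this
  have T : Tendsto (fun Q : ℝ => C * Q) (𝓝[>] 0) (𝓝 0) := by
    have : Tendsto (fun Q : ℝ => C * Q) (𝓝 0) (𝓝 (C * 0)) := (continuous_const.mul continuous_id).tendsto 0
    rw [mul_zero] at this
    exact this.mono_left nhdsWithin_le_nhds
  have : |e n| ≤ 0 := by
    refine ge_of_tendsto T ?_
    filter_upwards [Ioc_mem_nhdsGT (show (0:ℝ) < 1/4 by norm_num)] with Q hQ
    exact bd Q hQ.1 hQ.2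
  exact abs_eq_zero.1 (le_antisymm this (abs_nonneg _))

lemma spread {c : ℕ → ℝ} {h : ℝ → ℝ} (H : PSn c h) (i : ℕ) (hi : i < 5) {Q : ℝ} (q0 : 0 < Q) (q1 : Q < 1) :
    HasSum (fun n => (if n % 5 = i then c (n / 5) else 0) * Q ^ n) (Q ^ i * h (Q ^ 5)) := by
  have h1 := (H (Q ^ 5) (by positivity) (pow_lt_one₀ q0.le q1 (by norm_num))).mul_left (Q ^ i)
  have inj : Function.Injective (fun k : ℕ => 5 * k + i) := fun a b hab => by simp only at hab; omega
  rw [← inj.hasSum_iff]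
  · refine h1.congr_fun ?_
    intro k
    simp only [Function.comp_apply]
    rw [if_pos (by omega), show (5 * k + i) / 5 = k by omega, pow_add, pow_mul]; ring
  · intro n hn
    rw [if_neg, zero_mul]
    intro hm
    exact hn ⟨n / 5, by simp only; omega⟩

lemma NN.pos_of {h g : ℝ → ℝ} {d : ℕ → ℝ} (H : NN (fun q => h q - g q)) (hg : PSn d g) : ∃ c, (∀ n, d n ≤ c n) ∧ PSn c h := by
  obtain ⟨c, c0, hc⟩ := H
  refine ⟨fun n => c n + d n, fun n => by have := c0 n; linarith, fun q q0 q1 => ?_⟩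
  have := (hc q q0 q1).add (hg q q0 q1)
  simp only [sub_add_cancel] at this
  refine this.congr_fun ?_
  intro n; ring

lemma PSn.inv : PSn (fun _ => 1) (fun q => 1 / (1 - q)) := by
  intro q q0 q1
  beta_reduce
  rw [one_div]
  simpa using hasSum_geometric_of_lt_one q0.le q1
lemma PSn.qinv : PSn (fun n => 2 * (if n = 0 then 0 else 1)) (fun q => 2 * (q / (1 - q))) := by
  intro q q0 q1
  have : HasSum (fun n => (if n = 0 then 0 else 1) * q ^ n) (q / (1 - q)) := by
    rw [← hasSum_nat_add_iff' 1]
    simp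
    rw [div_eq_mul_inv]
    refine ((hasSum_geometric_of_lt_one q0.le q1).mul_left q).congr_fun ?_
    intro n; rw [pow_succ]; ring
  refine (this.mul_left 2).congr_fun ?_
  intro n; ring
lemma PSn.sq : PSn (fun n => 2 / 15 * (n:ℝ)) (fun q => 2 * (q / (15 * (1 - q) ^ 2))) := by
  intro q q0 q1
  have := (hasSum_coe_mul_geometric_of_norm_lt_one (r := q) (by rw [Real.norm_of_nonneg q0.le]; exact q1)).mul_left (2 / 15)
  have h1 : 1 - q ≠ 0 := by linarith
  have e : 2 * (q / (15 * (1 - q) ^ 2)) = 2 / 15 * (q / (1 - q) ^ 2) := by field_simp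
  beta_reduce
  rw [e]
  refine this.congr_fun ?_
  intro n; ring

lemma fN_pieces {r : ℝ} (hr0 : 0 < r) (hr1 : r ^ 8 < 1 / 2) :
    HasSum (fun n => fN n * (r ^ 8) ^ n) ((r ^ 8) ^ 0 * F0 ((r ^ 8) ^ 5) + (r ^ 8) ^ 1 * TT1 ((r ^ 8) ^ 5) + (r ^ 8) ^ 2 * F2 ((r ^ 8) ^ 5)
      + (r ^ 8) ^ 3 * TT3 ((r ^ 8) ^ 5) + (r ^ 8) ^ 4 * TT4 ((r ^ 8) ^ 5)) := by
  have h := fN_main hr0 hr1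
  have hrr : r < 1 := by
    by_contra h
    have : 1 ≤ r ^ 8 := one_le_pow₀ (by linarith)
    linarith
  have q0 : 0 < r ^ 40 := by positivity
  have q1 : r ^ 40 < 1 := pow_lt_one₀ hr0.le hrr (by norm_num)
  have a0 := alt0_eq hr0 hrr
  have a1 := alF1_eq hr0 hrr
  have a2 := alt2_eq hr0 hrr
  have a3 := alF3_eq hr0 hrr
  have a4 := alF4_eq hr0 hrr
  have j3 := j_Pc q0 q1 3 (by norm_num)
  have j7 := j_Pc q0 q1 7 (by norm_num)
  simp only [Nat.reduceSub, Nat.cast_ofNat] at j3 j7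
  have hr := hr0.ne'
  have m1 : r * mu r 9 3 = ((r ^ 40) ^ 0)⁻¹ * AA ((r ^ 40) ^ 20) ((r ^ 40) ^ 9) ((r ^ 40) ^ 3) * u3 (r ^ 40) := by
    unfold mu u3
    rw [j3, show (-(10 - 9) ^ 2 : ℤ) = -1 by norm_num, zpow_neg_one]
    norm_cast
    field_simp
  have m2 : r * mu r 1 7 = ((r ^ 40) ^ 2)⁻¹ * AA ((r ^ 40) ^ 20) ((r ^ 40) ^ 1) ((r ^ 40) ^ 7) * u7 (r ^ 40) := by
    unfold mu u7
    rw [j7, show (-(10 - 1) ^ 2 : ℤ) = -81 by norm_num]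
    norm_cast
    rw [zpow_negSucc]
    field_simp
  have m3 : r * mu r 5 3 = (r ^ 8) ^ 2 * (((r ^ 40) ^ 1)⁻¹ * AA ((r ^ 40) ^ 20) ((r ^ 40) ^ 5) ((r ^ 40) ^ 3) * u3 (r ^ 40)) := by
    unfold mu u3
    rw [j3, show (-(10 - 5) ^ 2 : ℤ) = -25 by norm_num]
    norm_cast
    rw [zpow_negSucc]
    field_simp
  have m4 : r * mu r 5 7 = (r ^ 8) ^ 2 * (((r ^ 40) ^ 1)⁻¹ * AA ((r ^ 40) ^ 20) ((r ^ 40) ^ 5) ((r ^ 40) ^ 7) * u7 (r ^ 40)) := by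
    unfold mu u7
    rw [j7, show (-(10 - 5) ^ 2 : ℤ) = -25 by norm_num]
    norm_cast
    rw [zpow_negSucc]
    field_simp
  rw [show (r ^ 8) ^ 5 = r ^ 40 by ring]
  unfold F0 F2
  convert h using 1
  linear_combination m1 + m2 + m3 + m4 - a0 - a1 - a2 - a3 - a4

theorem fN_pos (n : ℕ) (hn : 3 ≤ n) : 0 < fN n := by
  obtain ⟨c0, d0, p0⟩ := F0_NN.pos_of PSn.sq
  obtain ⟨c1, d1, p1⟩ := F1_NN.pos_of PSn.qinv
  obtain ⟨c2, d2, p2⟩ := F2_NN.pos_of PSn.sq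
  obtain ⟨c3, d3, p3⟩ := F3_NN.pos_of PSn.inv
  obtain ⟨c4, d4, p4⟩ := F4_NN.pos_of PSn.inv
  have U := coef_unique (fun n => fN n - ((if n % 5 = 0 then c0 (n / 5) else 0) + (if n % 5 = 1 then c1 (n / 5) else 0)
    + (if n % 5 = 2 then c2 (n / 5) else 0) + (if n % 5 = 3 then c3 (n / 5) else 0) + (if n % 5 = 4 then c4 (n / 5) else 0))) (by
    intro Q q0 q1
    obtain ⟨r, hr0, rfl⟩ : ∃ r : ℝ, 0 < r ∧ r ^ 8 = Q := ⟨Q ^ ((8:ℝ)⁻¹), by positivity, by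
      have := Real.rpow_inv_natCast_pow q0.le (by norm_num : (8:ℕ) ≠ 0)
      simpa using this⟩
    have h1 : r ^ 8 < 1 := by linarith
    have A := fN_pieces hr0 q1
    have B := ((((spread p0 0 (by norm_num) q0 h1).add (spread p1 1 (by norm_num) q0 h1)).add (spread p2 2 (by norm_num) q0 h1)).add
      (spread p3 3 (by norm_num) q0 h1)).add (spread p4 4 (by norm_num) q0 h1)
    have C := A.sub B
    rw [sub_self] at C
    refine C.congr_fun ?_
    intro n; ring)
  have u := U n
  beta_reduce at u
  have hk : n % 5 = 0 ∨ n % 5 = 1 ∨ n % 5 = 2 ∨ n % 5 = 3 ∨ n % 5 = 4 := by omega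
  rcases hk with h | h | h | h | h <;> simp [h] at u
  · have := d0 (n / 5)
    have k : 1 ≤ n / 5 := by omega
    have k : (1:ℝ) ≤ ((n / 5 : ℕ) : ℝ) := by exact_mod_cast k
    linarith
  · have := d1 (n / 5)
    have k : n / 5 ≠ 0 := by omega
    rw [if_neg k] at this
    linarith
  · have := d2 (n / 5)
    have k : 1 ≤ n / 5 := by omega
    have k : (1:ℝ) ≤ ((n / 5 : ℕ) : ℝ) := by exact_mod_cast k
    linarith
  · have := d3 (n / 5); linarith
  · have := d4 (n / 5); linarith

theorem N2_mod10_inequality (n : ℕ) (hn : 3 ≤ n) : N2 1 10 n + N2 2 10 n > N2 3 10 n + N2 4 10 n := by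
  have h := fN_pos n hn
  unfold fN at h
  have : (N2 3 10 n : ℝ) + N2 4 10 n < N2 1 10 n + N2 2 10 n := by linarith
  exact_mod_cast this
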